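/- Let K be a number field of degree n_K over ℚ. There exists a constant B = B(K) such that for x ≥ 2, Σ_{0 ≠ m ideal of O_K, N(m) ≤ x} 1/N(m) = κ log x + B + O(x^{−2/(n_K+1)}), where the implied constant depends only on K. -/

import Mathlib

open Filter Topology
open scoped BigOperators

noncomputable section

variable (K : Type) [Field K] [NumberField K]

/-- The residue `κ` of the Dedekind zeta function of `K` at `s = 1`. -/
def kappa : ℝ :=
  (2 ^ NumberField.InfinitePlace.nrRealPlaces K *
      (2 * Real.pi) ^ NumberField.InfinitePlace.nrComplexPlaces K *
      (NumberField.classNumber K) * NumberField.Units.regulator K) /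
    ((NumberField.Units.torsionOrder K) * Real.sqrt |(NumberField.discr K : ℝ)|)

end

namespace Landau
set_option linter.unusedSectionVars false
open MeasureTheory Filter Topology Set
open scoped ContDiff

/-- Families of functions whose first `k` derivatives along the directions `d i` exist on `Ω`, are
continuous there and are uniformly bounded. -/
def Good {I E : Type*} [NormedAddCommGroup E] [NormedSpace ℝ E] (d : I → E) (Ω : Set E) :
    ℕ → (I → E → ℂ) → Prop
  | 0, F => (∃ C : ℝ, ∀ i, ∀ y ∈ Ω, ‖F i y‖ ≤ C) ∧ ∀ i, ContinuousOn (F i) Ω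
  | k + 1, F => ((∃ C : ℝ, ∀ i, ∀ y ∈ Ω, ‖F i y‖ ≤ C) ∧ ∀ i, ContinuousOn (F i) Ω) ∧
      ∃ F' : I → E → ℂ, (∀ i, ∀ y ∈ Ω, HasLineDerivAt ℝ (F i) (F' i y) y (d i)) ∧ Good d Ω k F'

section good
variable {I E : Type*} [NormedAddCommGroup E] [NormedSpace ℝ E] {d : I → E} {Ω : Set E}

lemma Good.base {k : ℕ} {F : I → E → ℂ} (h : Good d Ω k F) :
    (∃ C : ℝ, ∀ i, ∀ y ∈ Ω, ‖F i y‖ ≤ C) ∧ ∀ i, ContinuousOn (F i) Ω := by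
  cases k with
  | zero => exact h
  | succ k => exact h.1

lemma Good.pred {k : ℕ} : ∀ {F : I → E → ℂ}, Good d Ω (k + 1) F → Good d Ω k F := by
  induction k with
  | zero => intro F h; exact h.1
  | succ k ih =>
    intro F h
    obtain ⟨h1, F', h2, h3⟩ := h
    exact ⟨h1, F', h2, ih h3⟩

lemma HasLineDerivAt.congr_open {f g : E → ℂ} {f' : ℂ} {y v : E} (hΩ : IsOpen Ω) (hy : y ∈ Ω)
    (hfg : ∀ z ∈ Ω, f z = g z) (h : HasLineDerivAt ℝ f f' y v) : HasLineDerivAt ℝ g f' y v := by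
  unfold HasLineDerivAt at *
  refine h.congr_of_eventuallyEq ?_
  have hc : ContinuousAt (fun t : ℝ => y + t • v) 0 := by fun_prop
  have : Ω ∈ 𝓝 (y + (0:ℝ) • v) := by simpa using hΩ.mem_nhds hy
  filter_upwards [hc this] with t ht
  exact (hfg _ ht).symm

lemma Good.congr (hΩ : IsOpen Ω) {k : ℕ} {F G : I → E → ℂ} (hFG : ∀ i, ∀ y ∈ Ω, F i y = G i y)
    (h : Good d Ω k F) : Good d Ω k G := by
  have hb : (∃ C : ℝ, ∀ i, ∀ y ∈ Ω, ‖G i y‖ ≤ C) ∧ ∀ i, ContinuousOn (G i) Ω := by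
    obtain ⟨⟨C, hC⟩, h2⟩ := h.base
    exact ⟨⟨C, fun i y hy => by rw [← hFG i y hy]; exact hC i y hy⟩,
      fun i => (h2 i).congr fun y hy => (hFG i y hy).symm⟩
  cases k with
  | zero => exact hb
  | succ k =>
    obtain ⟨_, F', h2, h3⟩ := h
    exact ⟨hb, F', fun i y hy => HasLineDerivAt.congr_open hΩ hy (hFG i) (h2 i y hy), h3⟩

lemma Good.add {k : ℕ} : ∀ {F G : I → E → ℂ}, Good d Ω k F → Good d Ω k G →
    Good d Ω k (fun i y => F i y + G i y) := by
  have hb : ∀ {k : ℕ} {F G : I → E → ℂ}, Good d Ω k F → Good d Ω k G →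
      (∃ C : ℝ, ∀ i, ∀ y ∈ Ω, ‖F i y + G i y‖ ≤ C) ∧
        ∀ i, ContinuousOn (fun y => F i y + G i y) Ω := by
    intro k F G hF hG
    obtain ⟨⟨C, hC⟩, h2⟩ := hF.base
    obtain ⟨⟨D, hD⟩, h3⟩ := hG.base
    exact ⟨⟨C + D, fun i y hy => (norm_add_le _ _).trans (add_le_add (hC i y hy) (hD i y hy))⟩,
      fun i => (h2 i).add (h3 i)⟩
  induction k with
  | zero => intro F G hF hG; exact hb hF hG
  | succ k ih =>
    intro F G hF hG
    refine ⟨hb hF hG, ?_⟩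
    obtain ⟨_, F', h2, h3⟩ := hF
    obtain ⟨_, G', h4, h5⟩ := hG
    exact ⟨_, fun i y hy => HasDerivAt.add (h2 i y hy) (h4 i y hy), ih h3 h5⟩

lemma Good.mul {k : ℕ} : ∀ {F G : I → E → ℂ}, Good d Ω k F → Good d Ω k G →
    Good d Ω k (fun i y => F i y * G i y) := by
  have hb : ∀ {k : ℕ} {F G : I → E → ℂ}, Good d Ω k F → Good d Ω k G →
      (∃ C : ℝ, ∀ i, ∀ y ∈ Ω, ‖F i y * G i y‖ ≤ C) ∧
        ∀ i, ContinuousOn (fun y => F i y * G i y) Ω := by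
    intro k F G hF hG
    obtain ⟨⟨C, hC⟩, h2⟩ := hF.base
    obtain ⟨⟨D, hD⟩, h3⟩ := hG.base
    refine ⟨⟨C * D, fun i y hy => ?_⟩, fun i => (h2 i).mul (h3 i)⟩
    rw [norm_mul]
    exact mul_le_mul (hC i y hy) (hD i y hy) (norm_nonneg _) ((norm_nonneg _).trans (hC i y hy))
  induction k with
  | zero => intro F G hF hG; exact hb hF hG
  | succ k ih =>
    intro F G hF hG
    refine ⟨hb hF hG, ?_⟩
    have hF0 := hF.pred
    have hG0 := hG.pred
    obtain ⟨_, F', h2, h3⟩ := hF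
    obtain ⟨_, G', h4, h5⟩ := hG
    refine ⟨fun i y => F' i y * G i y + F i y * G' i y, fun i y hy => ?_,
      Good.add (ih h3 hG0) (ih hF0 h5)⟩
    have := HasDerivAt.mul (h2 i y hy) (h4 i y hy)
    simp only [zero_smul, add_zero] at this
    exact this

lemma Good.neg {k : ℕ} : ∀ {F : I → E → ℂ}, Good d Ω k F →
    Good d Ω k (fun i y => - F i y) := by
  induction k with
  | zero =>
    intro F hF
    obtain ⟨⟨C, hC⟩, h2⟩ := hF.base
    exact ⟨⟨C, fun i y hy => by rw [norm_neg]; exact hC i y hy⟩, fun i => (h2 i).neg⟩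
  | succ k ih =>
    intro F hF
    obtain ⟨⟨⟨C, hC⟩, h2⟩, F', h3, h4⟩ := hF
    exact ⟨⟨⟨C, fun i y hy => by rw [norm_neg]; exact hC i y hy⟩, fun i => (h2 i).neg⟩, _,
      fun i y hy => HasDerivAt.neg (h3 i y hy), ih h4⟩

lemma Good.inv {c : ℝ} (hc : 0 < c) {F : I → E → ℂ} (hF : ∀ i, ∀ y ∈ Ω, c ≤ ‖F i y‖) {k : ℕ} :
    Good d Ω k F → Good d Ω k (fun i y => (F i y)⁻¹) := by
  have h0 : ∀ i, ∀ y ∈ Ω, F i y ≠ 0 := fun i y hy => by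
    have := hF i y hy
    exact norm_pos_iff.mp (by linarith)
  have hb : ∀ {k : ℕ}, Good d Ω k F →
      (∃ C : ℝ, ∀ i, ∀ y ∈ Ω, ‖(F i y)⁻¹‖ ≤ C) ∧ ∀ i, ContinuousOn (fun y => (F i y)⁻¹) Ω := by
    intro k h
    refine ⟨⟨c⁻¹, fun i y hy => ?_⟩, fun i => (h.base.2 i).inv₀ (h0 i)⟩
    rw [norm_inv]
    exact inv_anti₀ hc (hF i y hy)
  induction k with
  | zero => intro h; exact hb h
  | succ k ih =>
    intro h
    refine ⟨hb h, ?_⟩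
    have hp := ih h.pred
    obtain ⟨_, F', h2, h3⟩ := h
    refine ⟨fun i y => -(F' i y * ((F i y)⁻¹ * (F i y)⁻¹)), fun i y hy => ?_,
      (Good.mul h3 (hp.mul hp)).neg⟩
    have := HasDerivAt.inv (h2 i y hy) (by simpa using h0 i y hy)
    simp only [zero_smul, add_zero] at this
    refine HasDerivAt.congr_deriv this ?_
    have := h0 i y hy
    field_simp

lemma Good.pow {k : ℕ} {F : I → E → ℂ} (hF : Good d Ω k F) (j : ℕ) :
    Good d Ω k (fun i y => (F i y) ^ (j + 1)) := by
  induction j with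
  | zero => simpa using hF
  | succ j ih => simpa only [pow_succ] using ih.mul hF

lemma Good.comap {I' : Type*} (e : I' → I) {k : ℕ} : ∀ {F : I → E → ℂ}, Good d Ω k F →
    Good (fun i => d (e i)) Ω k (fun i y => F (e i) y) := by
  induction k with
  | zero =>
    intro F hF
    obtain ⟨⟨C, hC⟩, h2⟩ := hF
    exact ⟨⟨C, fun i y hy => hC _ y hy⟩, fun i => h2 _⟩
  | succ k ih =>
    intro F hF
    obtain ⟨⟨⟨C, hC⟩, h2⟩, F', h3, h4⟩ := hF
    exact ⟨⟨⟨C, fun i y hy => hC _ y hy⟩, fun i => h2 _⟩, _, fun i y hy => h3 _ y hy, ih h4⟩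

lemma good_of_contDiff {P : Type*} [NormedAddCommGroup P] [NormedSpace ℝ P]
    {S : Set P} {T : Set E} (hS : IsCompact S) (hT : IsCompact T) (hΩT : Ω ⊆ T)
    (p : I → P) (hp : ∀ i, p i ∈ S) (D : P →L[ℝ] E) (k : ℕ) :
    ∀ (F : P × E → ℂ), ContDiff ℝ ∞ F →
      Good (fun i => D (p i)) Ω k (fun i y => F (p i, y)) := by
  have hb : ∀ (F : P × E → ℂ), ContDiff ℝ ∞ F →
      (∃ C : ℝ, ∀ i, ∀ y ∈ Ω, ‖F (p i, y)‖ ≤ C) ∧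
      ∀ i, ContinuousOn (fun y => F (p i, y)) Ω := by
    intro F hF
    have hFc := hF.continuous
    obtain ⟨C, hC⟩ := (hS.prod hT).exists_bound_of_continuousOn hFc.continuousOn
    exact ⟨⟨C, fun i y hy => hC _ ⟨hp i, hΩT hy⟩⟩, fun i => by fun_prop⟩
  induction k with
  | zero => intro F hF; exact hb F hF
  | succ k ih =>
    intro F hF
    refine ⟨hb F hF, fun i y => fderiv ℝ F (p i, y) (0, D (p i)), fun i y hy => ?_, ?_⟩
    · have h1 : HasFDerivAt F (fderiv ℝ F (p i, y)) (p i, y) :=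
        (hF.differentiable (by simp)).differentiableAt.hasFDerivAt
      have h2 := h1.hasLineDerivAt (0, D (p i))
      unfold HasLineDerivAt at *
      simpa using h2
    · have h3 : ContDiff ℝ ∞ (fun q : P × E => fderiv ℝ F q (0, D q.1)) := by
        have : ContDiff ℝ ∞ (fderiv ℝ F) := hF.fderiv_right (by simp)
        exact this.clm_apply (by fun_prop)
      exact ih _ h3

lemma continuous_of_continuousOn_supp {f : E → ℂ} {B : Set E} (hΩ : IsOpen Ω) (hB : IsClosed B)
    (hBΩ : B ⊆ Ω) (hf : ContinuousOn f Ω) (h0 : ∀ y, y ∉ B → f y = 0) : Continuous f := by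
  rw [continuous_iff_continuousAt]
  intro y
  by_cases hy : y ∈ B
  · exact hf.continuousAt (hΩ.mem_nhds (hBΩ hy))
  · have : f =ᶠ[𝓝 y] fun _ => 0 := by
      filter_upwards [hB.isOpen_compl.mem_nhds hy] with z hz using h0 z hz
    exact this.continuousAt

theorem nonstat [FiniteDimensional ℝ E] [MeasurableSpace E] [BorelSpace E] (μ : Measure E)
    [μ.IsAddHaarMeasure] (hΩ : IsOpen Ω) {B : Set E} (hB : IsCompact B) (hBΩ : B ⊆ Ω)
    (Q m : I → E → ℝ) (hQc : ∀ i, Continuous (Q i)) (hmc : ∀ i, Continuous (m i))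
    (hQ : ∀ i y, HasLineDerivAt ℝ (Q i) (m i y) y (d i))
    {c : ℝ} (hc : 0 < c) (hm : ∀ i, ∀ y ∈ Ω, c ≤ |m i y|) (k : ℕ)
    (hmg : Good d Ω k (fun i y => (m i y : ℂ))) :
    ∀ (u : I → E → ℂ), Good d Ω k u → (∀ i, ∀ y, y ∉ B → u i y = 0) →
      ∃ C : ℝ, ∀ i, ∀ t : ℝ, t ≠ 0 →
        ‖∫ y, u i y * Complex.exp (Complex.I * (t * Q i y : ℝ)) ∂μ‖ ≤ C / |t| ^ k := by
  have hmn : ∀ i, ∀ y ∈ Ω, c ≤ ‖(m i y : ℂ)‖ := fun i y hy => by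
    simpa using hm i y hy
  have hm0 : ∀ i, ∀ y ∈ Ω, (m i y : ℂ) ≠ 0 := fun i y hy => by
    have := hmn i y hy
    exact norm_pos_iff.mp (by linarith)
  induction k with
  | zero =>
    intro u hu hu0
    obtain ⟨⟨C, hC⟩, h2⟩ := hu.base
    refine ⟨C * μ.real B, fun i t _ => ?_⟩
    rw [pow_zero, div_one]
    have : ∫ y, u i y * Complex.exp (Complex.I * (t * Q i y : ℝ)) ∂μ =
        ∫ y in B, u i y * Complex.exp (Complex.I * (t * Q i y : ℝ)) ∂μ := by
      rw [setIntegral_eq_integral_of_forall_compl_eq_zero]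
      intro y hy
      rw [hu0 i y hy, zero_mul]
    rw [this]
    refine norm_setIntegral_le_of_norm_le_const hB.measure_lt_top fun y hy => ?_
    rw [norm_mul, mul_comm Complex.I, Complex.norm_exp_ofReal_mul_I, mul_one]
    exact hC i y (hBΩ hy)
  | succ k ih =>
    intro u hu hu0
    have hg : Good d Ω (k + 1) (fun i y => u i y * ((m i y : ℂ))⁻¹) :=
      hu.mul (hmg.inv hc hmn)
    obtain ⟨⟨_, hgc⟩, F', hF', hF'g⟩ := hg
    have hF0 : ∀ i, ∀ y ∈ Ω, y ∉ B → F' i y = 0 := by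
      intro i y hy hyB
      have h1 := hF' i y hy
      have h2 : HasLineDerivAt ℝ (fun _ : E => (0:ℂ)) (F' i y) y (d i) := by
        refine HasLineDerivAt.congr_open hB.isClosed.isOpen_compl hyB (fun z hz => ?_) h1
        simp [hu0 i z hz]
      have h3 : HasLineDerivAt ℝ (fun _ : E => (0:ℂ)) 0 y (d i) := hasDerivAt_const _ _
      exact HasDerivAt.unique h2 h3
    classical
    set u1 : I → E → ℂ := fun i y => if y ∈ B then F' i y else 0 with hu1
    have hu1F : ∀ i, ∀ y ∈ Ω, F' i y = u1 i y := by
      intro i y hy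
      by_cases hyB : y ∈ B
      · simp [hu1, hyB]
      · simp [hu1, hyB, hF0 i y hy hyB]
    have hu1g : Good d Ω k u1 := hF'g.congr hΩ hu1F
    have hu10 : ∀ i, ∀ y, y ∉ B → u1 i y = 0 := fun i y hy => by simp [hu1, hy]
    obtain ⟨C, hC⟩ := ih hmg.pred u1 hu1g hu10
    refine ⟨C, fun i t ht => ?_⟩
    set f : E → ℂ := fun y => u i y * ((m i y : ℂ))⁻¹ with hf
    have hf0 : ∀ y, y ∉ B → f y = 0 := fun y hy => by simp [hf, hu0 i y hy]
    have hfc : Continuous f := continuous_of_continuousOn_supp hΩ hB.isClosed hBΩ (hgc i) hf0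
    have hu1c : Continuous (u1 i) :=
      continuous_of_continuousOn_supp hΩ hB.isClosed hBΩ (hu1g.base.2 i) (hu10 i)
    set g : E → ℂ := fun y => Complex.exp (Complex.I * (t * Q i y : ℝ)) with hg
    set g' : E → ℂ := fun y => Complex.exp (Complex.I * (t * Q i y : ℝ)) *
      (Complex.I * (t * m i y : ℝ)) with hg'
    have hQci := hQc i
    have hmci := hmc i
    have hgc : Continuous g := by fun_prop
    have hg'c : Continuous g' := by fun_prop
    have hcs : ∀ (a b : E → ℂ), Continuous a → Continuous b → (∀ y, y ∉ B → a y = 0) →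
        Integrable (fun x => ContinuousLinearMap.mul ℝ ℂ (a x) (b x)) μ := by
      intro a b ha hb ha0
      have hcont : Continuous (fun x => a x * b x) := ha.mul hb
      refine hcont.integrable_of_hasCompactSupport ?_
      exact HasCompactSupport.intro hB fun y hy => by simp [ha0 y hy]
    have hfd : ∀ y, HasLineDerivAt ℝ f (u1 i y) y (d i) := by
      intro y
      by_cases hy : y ∈ Ω
      · rw [← hu1F i y hy]; exact hF' i y hy
      · have hyB : y ∉ B := fun h => hy (hBΩ h)
        rw [hu10 i y hyB]
        refine HasLineDerivAt.congr_open (f := fun _ => 0) hB.isClosed.isOpen_compl hyB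
          (fun z hz => (hf0 z hz).symm) (hasDerivAt_const _ _)
    have hgd : ∀ y, HasLineDerivAt ℝ g (g' y) y (d i) := by
      intro y
      have h1 : HasDerivAt (fun s : ℝ => Q i (y + s • d i)) (m i y) 0 := hQ i y
      have h2 := ((h1.const_mul t).ofReal_comp.const_mul Complex.I).cexp
      simpa [HasLineDerivAt, hg, hg'] using h2
    have key := integral_bilinear_hasLineDerivAt_right_eq_neg_left_of_integrable (μ := μ)
      (B := ContinuousLinearMap.mul ℝ ℂ) (f := f) (f' := u1 i) (g := g) (g' := g') (v := d i)
      (hcs _ _ hu1c hgc (hu10 i)) (hcs _ _ hfc hg'c hf0) (hcs _ _ hfc hgc hf0)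
      (fun y _ => hfd y) (fun y _ => hgd y)
    simp only [ContinuousLinearMap.mul_apply'] at key
    have e1 : ∀ y, f y * g' y = (Complex.I * t) * (u i y * g y) := by
      intro y
      by_cases hy : y ∈ B
      · have := hm0 i y (hBΩ hy)
        simp only [hf, hg', hg]
        push_cast
        field_simp
      · simp [hf, hu0 i y hy]
    simp only [e1] at key
    rw [integral_const_mul] at key
    have hn := congrArg norm key
    rw [norm_mul, norm_mul, Complex.norm_I, one_mul, norm_neg, Complex.norm_real,
      Real.norm_eq_abs] at hn
    have h5 := hC i t ht
    have h6 : 0 < |t| := abs_pos.mpr ht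
    rw [le_div_iff₀ (by positivity)] at h5 ⊢
    rw [pow_succ]
    calc _ = (|t| * ‖∫ y, u i y * g y ∂μ‖) * |t| ^ k := by ring
      _ ≤ C := by rw [hn]; exact h5

end good
end Landau

namespace Landau
set_option linter.unusedSectionVars false
open MeasureTheory Filter Topology Set
open scoped ContDiff

/-- A commutative real algebra with a trace form, an exponential, and the trace-zero space `E`. -/
structure TrData (A E : Type*) [NormedCommRing A] [NormedAlgebra ℝ A]
    [NormedAddCommGroup E] [NormedSpace ℝ E] where
  Tr : A →L[ℝ] ℝ
  ι : E →L[ℝ] A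
  τ : E → E
  ex : A → A
  norm_ι : ∀ y, ‖ι y‖ = ‖y‖
  norm_τ : ∀ y, ‖τ y‖ ≤ ‖y‖
  pos : ∀ y, ‖y‖ ^ 2 ≤ Tr (ι y * ι (τ y))
  Tr_ι : ∀ y, Tr (ι y) = 0
  decomp : ∀ ξ : A, ∃ (l : ℝ) (η : E), ξ = l • (1 : A) + ι η
  one_le : 1 ≤ Tr 1
  ex_zero : ex 0 = 1
  ex_add : ∀ x y, ex (x + y) = ex x * ex y
  ex_deriv : ∀ x, HasFDerivAt ex (ContinuousLinearMap.mul ℝ A (ex x)) x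
  ex_smooth : ContDiff ℝ ∞ ex

section tr
variable {A E : Type*} [NormedCommRing A] [NormedAlgebra ℝ A] [NormOneClass A]
    [NormedAddCommGroup E] [NormedSpace ℝ E] (D : TrData A E)

lemma TrData.ex_small (e : ℝ) (he : 0 < e) : ∃ r > 0, ∀ y : E, ‖y‖ < r →
    ‖D.ex (D.ι y) - 1‖ ≤ e ∧ ‖D.ex (D.ι y) - 1 - D.ι y‖ ≤ e * ‖y‖ := by
  have h1 := D.ex_deriv 0
  have h2 := h1.isLittleO.def he
  have h3 : ContinuousAt D.ex 0 := D.ex_smooth.continuous.continuousAt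
  have h4 := Metric.continuousAt_iff.mp h3 e he
  obtain ⟨r1, hr1, h4⟩ := h4
  obtain ⟨r2, hr2, h2⟩ := Metric.eventually_nhds_iff.mp h2
  refine ⟨min r1 r2, lt_min hr1 hr2, fun y hy => ?_⟩
  have a1 : dist (D.ι y) 0 < r1 := by
    rw [dist_zero_right, D.norm_ι]; exact hy.trans_le (min_le_left _ _)
  have a2 : dist (D.ι y) 0 < r2 := by
    rw [dist_zero_right, D.norm_ι]; exact hy.trans_le (min_le_right _ _)
  have b1 := h4 a1
  have b2 := h2 a2
  rw [D.ex_zero, dist_eq_norm] at b1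
  simp only [D.ex_zero, sub_zero, ContinuousLinearMap.mul_apply', one_mul, D.norm_ι] at b2
  exact ⟨b1.le, b2⟩

lemma TrData.consts : ∃ c ρ : ℝ, 0 < c ∧ c ≤ 1/2 ∧ 0 < ρ ∧
    (∀ (l : ℝ) (η y : E), η ≠ 0 → c * |l| < ‖η‖ → ‖y‖ < 5 * ρ →
      1/2 ≤ D.Tr ((‖η‖⁻¹ • (l • 1 + D.ι η)) * D.ι (‖η‖⁻¹ • D.τ η) * D.ex (D.ι y))) ∧
    (∀ (w : A) (y : E), ‖w - 1‖ ≤ c → ‖y‖ < 5 * ρ → 1/2 ≤ D.Tr (w * D.ex (D.ι y))) ∧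
    (∀ (w : A) (h y : E), ‖w - 1‖ ≤ c → h ≠ 0 → ‖h‖ < 5 * ρ → ‖y‖ < 5 * ρ →
      ‖‖h‖⁻¹ • (w * (D.ex (D.ι h) - 1))‖ ≤ 4 ∧
      1/2 ≤ D.Tr ((‖h‖⁻¹ • (w * (D.ex (D.ι h) - 1))) * D.ι (‖h‖⁻¹ • D.τ h) * D.ex (D.ι y))) := by
  set T : ℝ := 1 + ‖D.Tr‖ with hT
  have hT1 : 1 ≤ T := by have := norm_nonneg D.Tr; linarith
  have hTr : ∀ a, |D.Tr a| ≤ T * ‖a‖ := fun a => by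
    have := D.Tr.le_opNorm a
    rw [Real.norm_eq_abs] at this
    have := norm_nonneg a
    nlinarith
  set c : ℝ := 1 / (32 * T) with hc
  have hTc : T * c = 1/32 := by rw [hc]; field_simp
  have hc0 : 0 < c := by positivity
  have hc1 : c ≤ 1/32 := by nlinarith
  set e : ℝ := c / (8 * T) with he
  have hTe : T * e = c / 8 := by rw [he]; field_simp
  have he0 : 0 < e := by positivity
  have hec : e ≤ c / 8 := by nlinarith
  obtain ⟨r, hr, hex⟩ := D.ex_small e he0
  have hdn : ∀ h : E, h ≠ 0 → ‖D.ι (‖h‖⁻¹ • D.τ h)‖ ≤ 1 := fun h hh => by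
    have : 0 < ‖h‖ := norm_pos_iff.mpr hh
    rw [D.norm_ι, norm_smul, norm_inv, norm_norm, inv_mul_le_iff₀ this, mul_one]
    exact D.norm_τ h
  have hpos : ∀ h : E, h ≠ 0 → 1 ≤ D.Tr ((‖h‖⁻¹ • D.ι h) * D.ι (‖h‖⁻¹ • D.τ h)) := fun h hh => by
    have h0 : 0 < ‖h‖ := norm_pos_iff.mpr hh
    have h1 := D.pos h
    rw [map_smul, smul_mul_smul_comm, map_smul, smul_eq_mul]
    have : ‖h‖⁻¹ * ‖h‖⁻¹ * ‖h‖ ^ 2 = 1 := by field_simp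
    rw [← this]
    gcongr
  refine ⟨c, r / 5, hc0, by linarith, by positivity, ?_, ?_, ?_⟩
  · intro l η y hη hl hy
    have hy' : ‖y‖ < r := by linarith
    have h0 : 0 < ‖η‖ := norm_pos_iff.mpr hη
    set d := D.ι (‖η‖⁻¹ • D.τ η) with hd
    have hd1 := hdn η hη
    have hk : ‖‖η‖⁻¹ • (l • (1:A) + D.ι η)‖ ≤ 1 / c + 1 := by
      rw [norm_smul, norm_inv, norm_norm, inv_mul_le_iff₀ h0]
      have h1 : ‖l • (1:A) + D.ι η‖ ≤ |l| + ‖η‖ := by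
        refine (norm_add_le _ _).trans ?_
        rw [norm_smul, norm_one, mul_one, D.norm_ι, Real.norm_eq_abs]
      have h2 : |l| ≤ ‖η‖ * (1/c) := by
        rw [mul_one_div, le_div_iff₀ hc0]; linarith
      linarith
    set k := ‖η‖⁻¹ • (l • (1:A) + D.ι η) with hkdef
    have e1 : k * d * D.ex (D.ι y) = (‖η‖⁻¹ • D.ι η) * d + (‖η‖⁻¹ * l) • d
        + k * d * (D.ex (D.ι y) - 1) := by
      have e2 : k * d = (‖η‖⁻¹ • D.ι η) * d + (‖η‖⁻¹ * l) • d := by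
        rw [hkdef, smul_add, add_mul, smul_smul, smul_mul_assoc, one_mul, add_comm]
      rw [← e2]; ring
    rw [e1, map_add, map_add, map_smul, hd, D.Tr_ι, smul_zero, ← hd]
    have h3 := hpos η hη
    have h4 := hTr (k * d * (D.ex (D.ι y) - 1))
    have h5 : ‖k * d * (D.ex (D.ι y) - 1)‖ ≤ (1/c + 1) * 1 * e := by
      refine (norm_mul_le _ _).trans ?_
      gcongr
      · exact (norm_mul_le _ _).trans (by gcongr)
      · exact (hex y hy').1
    have h6 : T * ((1/c + 1) * 1 * e) = (1 + c) / 8 := by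
      rw [mul_one, mul_left_comm, hTe]; field_simp
    have h7 : |D.Tr (k * d * (D.ex (D.ι y) - 1))| ≤ 1/4 := by
      have : T * ‖k * d * (D.ex (D.ι y) - 1)‖ ≤ T * ((1/c + 1) * 1 * e) := by gcongr
      linarith
    have := (abs_le.mp h7).1
    linarith
  all_goals
    have hE : ∀ (w : A) (y : E), ‖w - 1‖ ≤ c → ‖y‖ < r → ‖w * D.ex (D.ι y) - 1‖ ≤ 3 * c := by
      intro w y hw hy
      have e1 : w * D.ex (D.ι y) - 1 = (w - 1) * (D.ex (D.ι y) - 1) + (w - 1) +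
        (D.ex (D.ι y) - 1) := by ring
      have h1 := (hex y hy).1
      have h2 : ‖(w - 1) * (D.ex (D.ι y) - 1)‖ ≤ c * e := (norm_mul_le _ _).trans (by gcongr)
      rw [e1]
      refine (norm_add₃_le).trans ?_
      nlinarith
  · intro w y hw hy
    have h1 := hE w y hw (by linarith)
    have h2 := hTr (w * D.ex (D.ι y) - 1)
    have h3 : T * ‖w * D.ex (D.ι y) - 1‖ ≤ T * (3 * c) := by gcongr
    rw [map_sub] at h2
    have := (abs_le.mp (h2.trans h3)).1
    have := D.one_le
    linarith
  · intro w h y hw hh hhr hy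
    have h0 : 0 < ‖h‖ := norm_pos_iff.mpr hh
    have hr1 := (hex h (by linarith)).2
    have hR : ‖‖h‖⁻¹ • (D.ex (D.ι h) - 1 - D.ι h)‖ ≤ e := by
      rw [norm_smul, norm_inv, norm_norm, inv_mul_le_iff₀ h0]; linarith
    have hH : ‖‖h‖⁻¹ • D.ι h‖ = 1 := by
      rw [norm_smul, norm_inv, norm_norm, D.norm_ι, inv_mul_cancel₀ h0.ne']
    set R := ‖h‖⁻¹ • (D.ex (D.ι h) - 1 - D.ι h) with hRd
    set H := ‖h‖⁻¹ • D.ι h with hHd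
    have e0 : ‖h‖⁻¹ • (w * (D.ex (D.ι h) - 1)) = w * (H + R) := by
      rw [hRd, hHd, ← smul_add, mul_smul_comm]; congr 2; abel
    rw [e0]
    have hHR : ‖H + R‖ ≤ 2 := (norm_add_le _ _).trans (by rw [hH]; linarith)
    have hw1 : ‖w‖ ≤ 2 := by
      have : w = (w - 1) + 1 := by ring
      rw [this]; refine (norm_add_le _ _).trans ?_
      rw [norm_one]; linarith
    refine ⟨(norm_mul_le _ _).trans (by nlinarith [norm_nonneg w, norm_nonneg (H + R)]), ?_⟩
    set d := D.ι (‖h‖⁻¹ • D.τ h) with hd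
    have hd1 : ‖d‖ ≤ 1 := hdn h hh
    have e1 : w * (H + R) * d * D.ex (D.ι y) = H * d +
        (R * d + (w * D.ex (D.ι y) - 1) * ((H + R) * d)) := by ring
    have h1 := hE w y hw (by linarith)
    have h2 : ‖R * d + (w * D.ex (D.ι y) - 1) * ((H + R) * d)‖ ≤ e * 1 + 3 * c * (2 * 1) := by
      refine (norm_add_le _ _).trans ?_
      gcongr
      · exact (norm_mul_le _ _).trans (by gcongr)
      · refine (norm_mul_le _ _).trans ?_
        gcongr
        exact (norm_mul_le _ _).trans (by gcongr)
    have h3 := hTr (R * d + (w * D.ex (D.ι y) - 1) * ((H + R) * d))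
    have h4 : T * ‖R * d + (w * D.ex (D.ι y) - 1) * ((H + R) * d)‖ ≤
      T * (e * 1 + 3 * c * (2 * 1)) := by gcongr
    have h5 := (abs_le.mp (h3.trans h4)).1
    have h6 := hpos h hh
    rw [e1, map_add]
    linarith

end tr
end Landau

namespace Landau
set_option linter.unusedSectionVars false
open MeasureTheory Filter Topology Set Metric
open scoped ContDiff

section tr
variable {A E : Type*} [NormedCommRing A] [NormedAlgebra ℝ A] [NormOneClass A]
    [FiniteDimensional ℝ A]
    [NormedAddCommGroup E] [NormedSpace ℝ E] [FiniteDimensional ℝ E]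
    [MeasurableSpace E] [BorelSpace E] (D : TrData A E)
    (μ : Measure E) [μ.IsAddHaarMeasure]

lemma TrData.nonstatTr {I : Type*} (p : I → A × E) {R ρ : ℝ}
    (hp : ∀ i, ‖p i‖ ≤ R) (hρ : 0 < ρ)
    (hm : ∀ i y, ‖y‖ < 2 * ρ → 1/2 ≤ D.Tr ((p i).1 * D.ι (p i).2 * D.ex (D.ι y)))
    (k : ℕ) (u : I → E → ℂ) (hu : Good (fun i => (p i).2) (ball 0 (2 * ρ)) k u)
    (hu0 : ∀ i, ∀ y, y ∉ closedBall (0:E) ρ → u i y = 0) :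
    ∃ C : ℝ, ∀ i, ∀ t : ℝ, t ≠ 0 →
      ‖∫ y, u i y * Complex.exp (Complex.I * (t * D.Tr ((p i).1 * D.ex (D.ι y)) : ℝ)) ∂μ‖
        ≤ C / |t| ^ k := by
  have hex := D.ex_smooth
  have hexc := hex.continuous
  refine nonstat (d := fun i => (p i).2) (Ω := ball 0 (2 * ρ)) μ isOpen_ball
    (isCompact_closedBall 0 ρ) ?_
    (fun i y => D.Tr ((p i).1 * D.ex (D.ι y)))
    (fun i y => D.Tr ((p i).1 * D.ι (p i).2 * D.ex (D.ι y))) ?_ ?_ ?_ (c := 1/2) (by norm_num)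
    ?_ k ?_ u hu hu0
  · exact closedBall_subset_ball (by linarith)
  · intro i; fun_prop
  · intro i; fun_prop
  · intro i y
    have h1 : HasFDerivAt (fun y : E => D.Tr ((p i).1 * D.ex (D.ι y)))
        (D.Tr.comp ((ContinuousLinearMap.mul ℝ A (p i).1).comp
          ((ContinuousLinearMap.mul ℝ A (D.ex (D.ι y))).comp D.ι))) y := by
      have h2 : HasFDerivAt (fun y : E => D.ex (D.ι y)) _ y :=
        (D.ex_deriv (D.ι y)).comp y D.ι.hasFDerivAt
      have h3 := (ContinuousLinearMap.mul ℝ A (p i).1).hasFDerivAt.comp y h2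
      exact D.Tr.hasFDerivAt.comp y h3
    have h4 := h1.hasLineDerivAt (p i).2
    convert h4 using 1
    simp [mul_assoc, mul_comm]
  · intro i y hy
    have := hm i y (by simpa using hy)
    exact this.trans (le_abs_self _)
  · have := good_of_contDiff (I := I) (E := E) (Ω := ball 0 (2*ρ))
      (isCompact_closedBall (0 : A × E) R) (isCompact_closedBall (0:E) (2*ρ))
      ball_subset_closedBall p (fun i => by simpa using hp i) (ContinuousLinearMap.snd ℝ A E) k
      (fun q => ((D.Tr (q.1.1 * D.ι q.1.2 * D.ex (D.ι q.2)) : ℝ) : ℂ))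
      (by
        apply Complex.ofRealCLM.contDiff.comp
        apply D.Tr.contDiff.comp
        apply ContDiff.mul
        · exact ContDiff.mul (by fun_prop) (by fun_prop)
        · exact hex.comp (by fun_prop))
    simpa using this

/-- Nonstationary estimate away from the scalar direction. -/
lemma TrData.oscA {c ρ : ℝ} (hc : 0 < c) (hρ : 0 < ρ)
    (hA : ∀ (l : ℝ) (η y : E), η ≠ 0 → c * |l| < ‖η‖ → ‖y‖ < 5 * ρ →
      1/2 ≤ D.Tr ((‖η‖⁻¹ • (l • 1 + D.ι η)) * D.ι (‖η‖⁻¹ • D.τ η) * D.ex (D.ι y)))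
    (a : E → ℝ) (ha : ContDiff ℝ ∞ a) (ha0 : ∀ y, y ∉ closedBall (0:E) ρ → a y = 0) (k : ℕ) :
    ∃ C : ℝ, 0 ≤ C ∧ ∀ (l : ℝ) (η : E), c * |l| < ‖η‖ → ∀ t : ℝ, t ≠ 0 →
      ‖∫ y, (a y : ℂ) * Complex.exp (Complex.I *
        (t * D.Tr ((l • 1 + D.ι η) * D.ex (D.ι y)) : ℝ)) ∂μ‖
        ≤ C / (|t| * ‖l • 1 + D.ι η‖) ^ k := by
  let I := {q : ℝ × E // c * |q.1| < ‖q.2‖}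
  have hne : ∀ i : I, 0 < ‖i.1.2‖ := fun i => lt_of_le_of_lt (by positivity) i.2
  have hb : ∀ i : I, ‖i.1.1 • (1:A) + D.ι i.1.2‖ ≤ (1 / c + 1) * ‖i.1.2‖ := fun i => by
    have h1 : ‖i.1.1 • (1:A) + D.ι i.1.2‖ ≤ |i.1.1| + ‖i.1.2‖ := by
      refine (norm_add_le _ _).trans ?_
      rw [norm_smul, norm_one, mul_one, D.norm_ι, Real.norm_eq_abs]
    have h2 : |i.1.1| ≤ 1/c * ‖i.1.2‖ := by
      rw [div_mul_eq_mul_div, le_div_iff₀ hc]; linarith [i.2]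
    linarith
  let p : I → A × E := fun i => (‖i.1.2‖⁻¹ • (i.1.1 • (1:A) + D.ι i.1.2), ‖i.1.2‖⁻¹ • D.τ i.1.2)
  obtain ⟨C, hC⟩ := D.nonstatTr μ p (R := 1 / c + 1) (ρ := ρ) (fun i => by
      have h0 := hne i
      rw [Prod.norm_def]
      apply max_le
      · simp only [p]
        rw [norm_smul, norm_inv, norm_norm, inv_mul_le_iff₀ h0]
        linarith [hb i]
      · simp only [p]
        rw [norm_smul, norm_inv, norm_norm, inv_mul_le_iff₀ h0]
        have := D.norm_τ i.1.2
        have : 0 < 1/c := by positivity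
        nlinarith) hρ
    (fun i y hy => hA _ _ _ (norm_pos_iff.mp (hne i)) i.2 (by linarith)) k
    (fun i y => (a y : ℂ)) (by
      have := good_of_contDiff (I := I) (E := E) (Ω := ball 0 (2*ρ))
        (isCompact_closedBall (0 : E) 1) (isCompact_closedBall (0:E) (2*ρ))
        ball_subset_closedBall (fun i => (p i).2) (fun i => by
          simp only [p, mem_closedBall_zero_iff]
          rw [norm_smul, norm_inv, norm_norm, inv_mul_le_iff₀ (hne i)]
          linarith [D.norm_τ i.1.2]) (ContinuousLinearMap.id ℝ E) k
        (fun q => (a q.2 : ℂ)) (Complex.ofRealCLM.contDiff.comp (ha.comp contDiff_snd))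
      simpa using this) (fun i y hy => by simp [ha0 y hy])
  refine ⟨|C| * (1/c + 1) ^ k, by positivity, fun l η hl t ht => ?_⟩
  have h1 := hC ⟨(l, η), hl⟩ (t * ‖η‖) (mul_ne_zero ht (hne ⟨(l, η), hl⟩).ne')
  have h0 : 0 < ‖η‖ := hne ⟨(l, η), hl⟩
  have e1 : ∀ y, t * ‖η‖ * D.Tr ((p ⟨(l, η), hl⟩).1 * D.ex (D.ι y)) =
      t * D.Tr ((l • 1 + D.ι η) * D.ex (D.ι y)) := fun y => by
    simp only [p]
    rw [smul_mul_assoc, map_smul, smul_eq_mul]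
    field_simp
  simp only [e1] at h1
  refine h1.trans ?_
  have ht' : 0 < |t| := abs_pos.mpr ht
  rcases eq_or_ne (‖l • 1 + D.ι η‖) 0 with hz | hz
  · exfalso
    have h2 := hA l η 0 (norm_pos_iff.mp h0) hl (by simpa using hρ)
    rw [norm_eq_zero.mp hz] at h2
    norm_num at h2
  · have h2 := hb ⟨(l, η), hl⟩
    simp only at h2
    have hz' : 0 < ‖l • 1 + D.ι η‖ := lt_of_le_of_ne (norm_nonneg _) (Ne.symm hz)
    rw [abs_mul, abs_norm, div_le_div_iff₀ (by positivity) (by positivity)]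
    calc C * (|t| * ‖l • 1 + D.ι η‖) ^ k ≤ |C| * (|t| * ((1 / c + 1) * ‖η‖)) ^ k := by
          gcongr; exact le_abs_self C
      _ = _ := by rw [mul_pow, mul_pow, mul_pow]; ring

end tr
end Landau

namespace Landau
set_option linter.unusedSectionVars false
open MeasureTheory Filter Topology Set Metric
open scoped ContDiff

section tr
variable {A E : Type*} [NormedCommRing A] [NormedAlgebra ℝ A] [NormOneClass A]
    [FiniteDimensional ℝ A]
    [NormedAddCommGroup E] [NormedSpace ℝ E] [FiniteDimensional ℝ E]
    [MeasurableSpace E] [BorelSpace E] (D : TrData A E)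
    (μ : Measure E) [μ.IsAddHaarMeasure]

/-- `TT*` identity and estimate. -/
lemma ttstar {B : E → ℂ} (hB : Continuous B) (hBs : HasCompactSupport B) {g : E → ℝ}
    (hg : Integrable g μ)
    (h : ∀ᵐ h ∂μ, ‖∫ y, B (y + h) * (starRingEnd ℂ) (B y) ∂μ‖ ≤ g h) :
    ‖∫ y, B y ∂μ‖ ^ 2 ≤ ∫ h, g h ∂μ := by
  have hc : Continuous (fun q : E × E => B (q.1 + q.2) * (starRingEnd ℂ) (B q.1)) := by
    have := Complex.continuous_conj
    fun_prop
  have hs : HasCompactSupport (fun q : E × E => B (q.1 + q.2) * (starRingEnd ℂ) (B q.1)) := by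
    have hK : IsCompact (tsupport B) := hBs
    refine HasCompactSupport.of_support_subset_isCompact
      (K := (fun q : E × E => (q.1, q.2 - q.1)) '' (tsupport B ×ˢ tsupport B))
      ((hK.prod hK).image (by fun_prop)) ?_
    intro q hq
    rw [Function.mem_support] at hq
    refine ⟨(q.1, q.1 + q.2), ⟨?_, ?_⟩, by simp⟩
    · apply subset_tsupport
      intro h0; apply hq; simp [h0]
    · apply subset_tsupport
      intro h0; apply hq; simp at h0; simp [h0]
  have hi : Integrable (fun q : E × E => B (q.1 + q.2) * (starRingEnd ℂ) (B q.1)) (μ.prod μ) :=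
    hc.integrable_of_hasCompactSupport hs
  have e1 : (∫ y, B y ∂μ) * (starRingEnd ℂ) (∫ y, B y ∂μ) =
      ∫ h, ∫ y, B (y + h) * (starRingEnd ℂ) (B y) ∂μ ∂μ := by
    rw [← integral_integral_swap hi, ← integral_conj, ← integral_const_mul]
    congr 1; ext y
    rw [integral_mul_const, integral_add_left_eq_self]
  have e2 : ‖∫ y, B y ∂μ‖ ^ 2 = ‖(∫ y, B y ∂μ) * (starRingEnd ℂ) (∫ y, B y ∂μ)‖ := by
    rw [norm_mul, RCLike.norm_conj, sq]
  rw [e2, e1]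
  exact norm_integral_le_of_norm_le hg h

lemma integral_decay (s : ℝ) (hs : s ≠ 0) :
    Integrable (fun h : E => ((1 + ‖s • h‖) ^ (Module.finrank ℝ E + 1))⁻¹) μ ∧
    ∫ h : E, ((1 + ‖s • h‖) ^ (Module.finrank ℝ E + 1))⁻¹ ∂μ =
      (|s| ^ (Module.finrank ℝ E))⁻¹ *
      ∫ h : E, ((1 + ‖h‖) ^ (Module.finrank ℝ E + 1))⁻¹ ∂μ := by
  have h1 : Integrable (fun h : E => ((1 + ‖h‖) ^ (Module.finrank ℝ E + 1))⁻¹) μ := by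
    have := integrable_one_add_norm (E := E) (μ := μ) (r := (Module.finrank ℝ E : ℝ) + 1)
      (by linarith)
    convert this using 2 with h
    rw [Real.rpow_neg (by positivity)]
    norm_cast
  refine ⟨h1.comp_smul hs, ?_⟩
  have := Measure.integral_comp_smul μ (fun h : E => ((1 + ‖h‖) ^ (Module.finrank ℝ E + 1))⁻¹) s
  rw [this, abs_inv, abs_pow, smul_eq_mul]

lemma TrData.oscB [Nontrivial E] {c ρ : ℝ} (hc : 0 < c) (hρ : 0 < ρ)
    (hA : ∀ (w : A) (y : E), ‖w - 1‖ ≤ c → ‖y‖ < 5 * ρ → 1/2 ≤ D.Tr (w * D.ex (D.ι y)))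
    (hH : ∀ (w : A) (h y : E), ‖w - 1‖ ≤ c → h ≠ 0 → ‖h‖ < 5 * ρ → ‖y‖ < 5 * ρ →
      ‖‖h‖⁻¹ • (w * (D.ex (D.ι h) - 1))‖ ≤ 4 ∧
      1/2 ≤ D.Tr ((‖h‖⁻¹ • (w * (D.ex (D.ι h) - 1))) * D.ι (‖h‖⁻¹ • D.τ h) * D.ex (D.ι y)))
    (a : E → ℝ) (ha : ContDiff ℝ ∞ a) (ha0 : ∀ y, y ∉ closedBall (0:E) ρ → a y = 0) (j : ℕ) :
    ∃ C : ℝ, 0 ≤ C ∧ ∀ w : A, ‖w - 1‖ ≤ c → ∀ t : ℝ, t ≠ 0 →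
      ‖∫ y, (a y * ((D.Tr (w * D.ex (D.ι y)) : ℂ)⁻¹) ^ (j + 1)) * Complex.exp (Complex.I *
        (t * D.Tr (w * D.ex (D.ι y)) : ℝ)) ∂μ‖ ^ 2 ≤ C / |t| ^ (Module.finrank ℝ E) := by
  have hex := D.ex_smooth
  have hexc := hex.continuous
  let I := {q : A × E // ‖q.1 - 1‖ ≤ c ∧ q.2 ≠ 0 ∧ ‖q.2‖ ≤ 2 * ρ}
  have hne : ∀ i : I, 0 < ‖i.1.2‖ := fun i => norm_pos_iff.mpr i.2.2.1
  let p : I → A × E := fun i =>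
    (‖i.1.2‖⁻¹ • (i.1.1 * (D.ex (D.ι i.1.2) - 1)), ‖i.1.2‖⁻¹ • D.τ i.1.2)
  have hp2 : ∀ i, ‖(p i).2‖ ≤ 1 := fun i => by
    simp only [p]
    rw [norm_smul, norm_inv, norm_norm, inv_mul_le_iff₀ (hne i)]
    linarith [D.norm_τ i.1.2]
  have hp : ∀ i, ‖p i‖ ≤ 4 := fun i => by
    rw [Prod.norm_def]
    refine max_le (hH i.1.1 i.1.2 0 i.2.1 i.2.2.1 (by linarith [i.2.2.2])
      (by simpa using hρ)).1 (by linarith [hp2 i])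
  let f : A → E → ℂ := fun w y => a y * ((D.Tr (w * D.ex (D.ι y)) : ℂ)⁻¹) ^ (j + 1)
  let u : I → E → ℂ := fun i y => f i.1.1 (y + i.1.2) * f i.1.1 y
  have hu0 : ∀ i, ∀ y, y ∉ closedBall (0:E) ρ → u i y = 0 := fun i y hy => by
    simp [u, f, ha0 y hy]
  have hgood : ∀ k, Good (fun i => (p i).2) (ball (0:E) (2 * ρ)) k u := by
    intro k
    have hS : ∀ i : I, ((i.1.1, i.1.2, (p i).2) : A × E × E) ∈
        closedBall (1 : A) c ×ˢ closedBall (0:E) (2*ρ) ×ˢ closedBall (0:E) 1 := fun i =>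
      ⟨by simpa [dist_eq_norm] using i.2.1, by simpa using i.2.2.2, by simpa using hp2 i⟩
    have key := fun F hF => good_of_contDiff (I := I) (E := E) (Ω := ball 0 (2*ρ))
        ((isCompact_closedBall (1 : A) c).prod
          ((isCompact_closedBall (0:E) (2*ρ)).prod (isCompact_closedBall (0:E) 1)))
        (isCompact_closedBall (0:E) (2*ρ)) ball_subset_closedBall
        (fun i => (i.1.1, i.1.2, (p i).2)) hS
        ((ContinuousLinearMap.snd ℝ E E).comp (ContinuousLinearMap.snd ℝ A (E × E))) k F hF
    have g1 := key (fun q => (a (q.2 + q.1.2.1) : ℂ))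
      (Complex.ofRealCLM.contDiff.comp (ha.comp (by fun_prop)))
    have g2 := key (fun q => (a q.2 : ℂ))
      (Complex.ofRealCLM.contDiff.comp (ha.comp (by fun_prop)))
    have g3 := key (fun q => (D.Tr (q.1.1 * D.ex (D.ι (q.2 + q.1.2.1))) : ℂ)) (by
      apply Complex.ofRealCLM.contDiff.comp
      apply D.Tr.contDiff.comp
      apply ContDiff.mul (by fun_prop)
      exact hex.comp (by fun_prop))
    have g4 := key (fun q => (D.Tr (q.1.1 * D.ex (D.ι q.2)) : ℂ)) (by
      apply Complex.ofRealCLM.contDiff.comp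
      apply D.Tr.contDiff.comp
      apply ContDiff.mul (by fun_prop)
      exact hex.comp (by fun_prop))
    have g3' := (Good.inv (c := 1/2) (by norm_num) (fun i y hy => by
      have hy' : ‖y‖ < 2 * ρ := by simpa using hy
      have := hA i.1.1 (y + i.1.2) i.2.1 (by linarith [norm_add_le y i.1.2, i.2.2.2])
      rw [Complex.norm_real]; exact this.trans (le_abs_self _)) g3).pow j
    have g4' := (Good.inv (c := 1/2) (by norm_num) (fun i y hy => by
      have hy' : ‖y‖ < 2 * ρ := by simpa using hy
      have := hA i.1.1 y i.2.1 (by linarith)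
      rw [Complex.norm_real]; exact this.trans (le_abs_self _)) g4).pow j
    exact (g1.mul g3').mul (g2.mul g4')
  set N := Module.finrank ℝ E with hN
  have hm : ∀ i y, ‖y‖ < 2 * ρ → 1/2 ≤ D.Tr ((p i).1 * D.ι (p i).2 * D.ex (D.ι y)) :=
    fun i y hy => (hH i.1.1 i.1.2 y i.2.1 i.2.2.1 (by linarith [i.2.2.2]) (by linarith)).2
  obtain ⟨C1, hC1⟩ := D.nonstatTr μ p hp hρ hm (N + 1) u (hgood _) hu0
  obtain ⟨C2, hC2⟩ := D.nonstatTr μ p hp hρ hm 0 u (hgood _) hu0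
  set C3 : ℝ := 2 ^ (N + 1) * (|C1| + |C2|) with hC3
  set c0 := ∫ h : E, ((1 + ‖h‖) ^ (N + 1))⁻¹ ∂μ with hc0
  have hc0' : 0 ≤ c0 := integral_nonneg (fun h => by positivity)
  refine ⟨C3 * c0, by positivity, fun w hw t ht => ?_⟩
  have ht' : 0 < |t| := abs_pos.mpr ht
  let B : E → ℂ := fun y => f w y * Complex.exp (Complex.I * (t * D.Tr (w * D.ex (D.ι y)) : ℝ))
  have hB0 : ∀ y, y ∉ closedBall (0:E) ρ → B y = 0 := fun y hy => by simp [B, f, ha0 y hy]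
  have hBc : Continuous B := by
    refine continuous_of_continuousOn_supp (Ω := ball 0 (5 * ρ)) isOpen_ball
      (isClosed_closedBall (x := (0:E)) (ε := ρ))
      (closedBall_subset_ball (by linarith)) ?_ hB0
    have hac := ha.continuous
    refine ContinuousOn.mul (ContinuousOn.mul (by fun_prop) (ContinuousOn.pow
      (ContinuousOn.inv₀ (by fun_prop) ?_) _)) (by fun_prop)
    intro y hy
    have := hA w y hw (by simpa using hy)
    exact_mod_cast (by linarith : (0:ℝ) < D.Tr (w * D.ex (D.ι y))).ne'
  have hBs : HasCompactSupport B :=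
    HasCompactSupport.intro (isCompact_closedBall (0:E) ρ) hB0
  obtain ⟨hdi, hde⟩ := integral_decay μ t ht
  have hfin := ttstar μ hBc hBs (hdi.const_mul C3) ?_
  · rw [integral_const_mul, hde, ← hN, ← hc0] at hfin
    refine hfin.trans (le_of_eq ?_)
    rw [div_eq_mul_inv]; ring
  · have h0 : ∀ᵐ h ∂μ, h ≠ 0 := by
      rw [ae_iff]; simp
    filter_upwards [h0] with h hh
    have h0 : 0 < ‖h‖ := norm_pos_iff.mpr hh
    by_cases hh2 : ‖h‖ ≤ 2 * ρ
    · have hconj : ∀ y, (starRingEnd ℂ) (B y) =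
          f w y * Complex.exp (Complex.I * ((-(t * D.Tr (w * D.ex (D.ι y))) : ℝ) : ℂ)) := fun y => by
        simp only [B, f, map_mul, map_pow, map_inv₀, Complex.conj_ofReal, ← Complex.exp_conj,
          Complex.conj_I]
        congr 2; push_cast; ring
      have e1 : ∀ y, B (y + h) * (starRingEnd ℂ) (B y) = u ⟨(w, h), hw, hh, hh2⟩ y *
          Complex.exp (Complex.I * (((t * ‖h‖) * D.Tr ((p ⟨(w, h), hw, hh, hh2⟩).1 *
            D.ex (D.ι y)) : ℝ) : ℂ)) := fun y => by
        rw [hconj]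
        have e2 : (t * ‖h‖) * D.Tr ((p ⟨(w, h), hw, hh, hh2⟩).1 * D.ex (D.ι y)) =
          t * D.Tr (w * D.ex (D.ι (y + h))) + -(t * D.Tr (w * D.ex (D.ι y))) := by
          simp only [p]
          rw [smul_mul_assoc, map_smul, smul_eq_mul, map_add, D.ex_add]
          have : w * (D.ex (D.ι h) - 1) * D.ex (D.ι y) =
            w * (D.ex (D.ι y) * D.ex (D.ι h)) - w * D.ex (D.ι y) := by ring
          rw [this, map_sub]
          field_simp; ring
        rw [e2, Complex.ofReal_add, mul_add, Complex.exp_add]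
        simp only [u, B]
        ring
      simp only [e1]
      have b1 := hC1 ⟨(w, h), hw, hh, hh2⟩ (t * ‖h‖) (mul_ne_zero ht h0.ne')
      have b2 := hC2 ⟨(w, h), hw, hh, hh2⟩ (t * ‖h‖) (mul_ne_zero ht h0.ne')
      rw [pow_zero, div_one] at b2
      rw [abs_mul, abs_norm] at b1
      rw [norm_smul, Real.norm_eq_abs]
      set s := |t| * ‖h‖ with hs
      have hs0 : 0 < s := by positivity
      rw [← div_eq_mul_inv]
      rcases le_total s 1 with hs1 | hs1
      · refine b2.trans ?_
        rw [le_div_iff₀ (by positivity)]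
        calc C2 * (1 + s) ^ (N + 1) ≤ (|C1| + |C2|) * 2 ^ (N + 1) := by
              gcongr
              · linarith [le_abs_self C2, abs_nonneg C1]
              · linarith
          _ = C3 := by rw [hC3]; ring
      · refine b1.trans ?_
        rw [div_le_div_iff₀ (by positivity) (by positivity)]
        calc C1 * (1 + s) ^ (N + 1) ≤ (|C1| + |C2|) * (2 * s) ^ (N + 1) := by
              gcongr
              · linarith [le_abs_self C1, abs_nonneg C2]
              · linarith
          _ = C3 * s ^ (N + 1) := by rw [hC3, mul_pow]; ring
    · have : ∀ y, B (y + h) * (starRingEnd ℂ) (B y) = 0 := fun y => by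
        by_cases hy : y ∈ closedBall (0:E) ρ
        · rw [hB0 (y + h), zero_mul]
          intro hyh
          simp only [mem_closedBall_zero_iff] at hy hyh
          have : ‖h‖ ≤ ‖y + h‖ + ‖y‖ := by
            have := norm_sub_le (y + h) y
            simpa using this
          linarith
        · rw [hB0 y hy, map_zero, mul_zero]
      simp only [this, integral_zero, norm_zero]
      positivity

end tr
end Landau

namespace Landau
set_option linter.unusedSectionVars false
open MeasureTheory Filter Topology Set Metric
open scoped ContDiff FourierTransform

section tr
variable {A E : Type*} [NormedCommRing A] [NormedAlgebra ℝ A] [NormOneClass A]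
    [FiniteDimensional ℝ A]
    [NormedAddCommGroup E] [NormedSpace ℝ E] [FiniteDimensional ℝ E]
    [MeasurableSpace E] [BorelSpace E] (D : TrData A E)
    (μ : Measure E) [μ.IsAddHaarMeasure]

/-- the phase `e(-r q)` -/
noncomputable def ph (r q : ℝ) : ℂ := Complex.exp (Complex.I * ((-(2 * Real.pi * r) * q : ℝ) : ℂ))

lemma norm_ph (r q : ℝ) : ‖ph r q‖ = 1 := by
  unfold ph; rw [mul_comm]; exact Complex.norm_exp_ofReal_mul_I _

lemma continuous_ph {X : Type*} [TopologicalSpace X] {r q : X → ℝ} (hr : Continuous r)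
    (hq : Continuous q) : Continuous (fun x => ph (r x) (q x)) := by
  unfold ph; fun_prop

lemma swapGB {g : ℝ → ℂ} {b : E → ℂ} {q : E → ℝ} (hg : Continuous g) (hgs : HasCompactSupport g)
    (hb : Continuous b) (hbs : HasCompactSupport b) (hq : Continuous q) :
    ∫ r, g r * ∫ y, b y * ph r (q y) ∂μ = ∫ y, b y * (∫ r, g r * ph r (q y)) ∂μ := by
  have h1 : Integrable (fun z : ℝ × E => g z.1 * (b z.2 * ph z.1 (q z.2))) (volume.prod μ) := by
    apply Continuous.integrable_of_hasCompactSupport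
    · have := continuous_ph (X := ℝ × E) continuous_fst (hq.comp continuous_snd)
      simp only [Function.comp_def] at this
      fun_prop
    · refine HasCompactSupport.intro ((hgs : IsCompact _).prod (hbs : IsCompact _)) ?_
      intro z hz
      rw [mem_prod, not_and_or] at hz
      rcases hz with hz | hz
      · rw [image_eq_zero_of_notMem_tsupport hz, zero_mul]
      · rw [image_eq_zero_of_notMem_tsupport hz, zero_mul, mul_zero]
  have := integral_integral_swap (f := fun r y => g r * (b y * ph r (q y))) h1
  simp only [← integral_const_mul]
  rw [this]
  congr 1; ext y; congr 1; ext r; ring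

lemma ibp {g : ℝ → ℂ} (hg : ContDiff ℝ ∞ g) (hgs : HasCompactSupport g) (j : ℕ) {q : ℝ}
    (hq : q ≠ 0) : ∫ r, g r * ph r q =
      (((2 * Real.pi * Complex.I : ℂ))⁻¹) ^ j * ((q : ℂ)⁻¹) ^ j *
        ∫ r, iteratedDeriv j g r * ph r q := by
  have hIntg : ∀ m : ℕ, Integrable (iteratedDeriv m g) := fun m => by
    apply Continuous.integrable_of_hasCompactSupport
    · exact hg.continuous_iteratedDeriv m (by exact_mod_cast le_top)
    · rw [iteratedDeriv_eq_equiv_comp]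
      exact (hgs.iteratedFDeriv m).comp_left (by simp)
  have h := Real.fourier_iteratedDeriv (N := ⊤) (n := j) hg (fun m _ => hIntg m) le_top
  have h1 := congrFun h q
  rw [Real.fourier_real_eq_integral_exp_smul, Real.fourier_real_eq_integral_exp_smul] at h1
  have e : ∀ f : ℝ → ℂ, ∫ v : ℝ, Complex.exp (↑(-2 * Real.pi * v * q) * Complex.I) • f v =
      ∫ r, f r * ph r q := fun f => by
    congr 1; ext r
    unfold ph
    rw [smul_eq_mul, mul_comm]
    congr 2
    push_cast; ring
  rw [e, e, smul_eq_mul] at h1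
  rw [h1, ← mul_assoc]
  have : (((2 * Real.pi * Complex.I : ℂ))⁻¹) ^ j * ((q : ℂ)⁻¹) ^ j *
     (2 * Real.pi * Complex.I * q) ^ j = 1 := by
    rw [← mul_pow, ← mul_pow]
    have h2 : (2 * Real.pi * Complex.I : ℂ) ≠ 0 := Complex.two_pi_I_ne_zero
    have h3 : (q : ℂ) ≠ 0 := by exact_mod_cast hq
    rw [mul_comm _ (2 * Real.pi * Complex.I * q : ℂ), ← mul_inv, mul_inv_cancel₀ (mul_ne_zero h2 h3),
      one_pow]
  rw [this, one_mul]

theorem TrData.ghat [Nontrivial E] : ∃ ρ > 0, ∀ a : E → ℝ, ContDiff ℝ ∞ a →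
    (∀ y, y ∉ closedBall (0:E) ρ → a y = 0) →
    ∃ C : ℝ, 0 ≤ C ∧ ∀ (δ K : ℝ) (g : ℝ → ℂ), 0 < δ → ContDiff ℝ ∞ g →
      (∀ r, r ∉ Icc (1/2:ℝ) (5/2) → g r = 0) →
      (∫ r, ‖g r‖ ≤ K) → (∫ r, ‖iteratedDeriv 1 g r‖ ≤ K) →
      (∫ r, ‖iteratedDeriv (Module.finrank ℝ E + 2) g r‖ ≤ K * (δ ^ (Module.finrank ℝ E + 1))⁻¹) →
      ∀ ξ : A, ξ ≠ 0 → ‖∫ r, g r * ∫ y, a y * ph r (D.Tr (ξ * D.ex (D.ι y))) ∂μ‖ ≤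
        C * K * ((‖ξ‖ ^ (Module.finrank ℝ E + 2))⁻¹ +
          (√‖ξ‖ ^ (Module.finrank ℝ E + 2))⁻¹ * min 1 ((δ * ‖ξ‖) ^ (Module.finrank ℝ E + 1))⁻¹) := by
  obtain ⟨c, ρ, hc, hc2, hρ, hA1, hA2, hA3⟩ := D.consts
  refine ⟨ρ, hρ, fun a ha ha0 => ?_⟩
  set N := Module.finrank ℝ E with hN
  obtain ⟨C0, hC0, hosc0⟩ := D.oscA μ hc hρ hA1 a ha ha0 (N + 2)
  obtain ⟨C1, hC1, hosc1⟩ := D.oscB μ hc hρ hA2 hA3 a ha ha0 0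
  obtain ⟨C2, hC2, hosc2⟩ := D.oscB μ hc hρ hA2 hA3 a ha ha0 (N + 1)
  have hexc := D.ex_smooth.continuous
  have hac := ha.continuous
  refine ⟨C0 + (√C1 + √C2) * 2 ^ (2 * N + 3), by positivity, ?_⟩
  intro δ K g hδ hg hg0 hK0 hK1 hK2 ξ hξ
  have hK : 0 ≤ K := (integral_nonneg (fun r => norm_nonneg _)).trans hK0
  have hξ' : 0 < ‖ξ‖ := norm_pos_iff.mpr hξ
  have hgs : HasCompactSupport g := HasCompactSupport.intro isCompact_Icc hg0
  obtain ⟨l, η, rfl⟩ := D.decomp ξ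
  have hdi : ∀ m : ℕ, Continuous (iteratedDeriv m g) := fun m =>
    hg.continuous_iteratedDeriv m (by exact_mod_cast le_top)
  have hds : ∀ m : ℕ, HasCompactSupport (iteratedDeriv m g) := fun m => by
    rw [iteratedDeriv_eq_equiv_comp]
    exact (hgs.iteratedFDeriv m).comp_left (by simp)
  have hd0 : ∀ m : ℕ, ∀ r, r ∉ Icc (1/2:ℝ) (5/2) → iteratedDeriv m g r = 0 := fun m r hr => by
    have h1 : g =ᶠ[𝓝 r] fun _ => 0 := by
      filter_upwards [isClosed_Icc.isOpen_compl.mem_nhds hr] with z hz using hg0 z hz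
    rw [h1.iteratedDeriv_eq m]
    simp [iteratedDeriv_fun_const_zero]
  -- general bound of an outer integral
  have outer : ∀ (m : ℕ) (Φ : ℝ → ℂ) (X : ℝ), (∀ r ∈ Icc (1/2:ℝ) (5/2), ‖Φ r‖ ≤ X) →
      ‖∫ r, iteratedDeriv m g r * Φ r‖ ≤ (∫ r, ‖iteratedDeriv m g r‖) * X := by
    intro m Φ X hX
    rw [← integral_mul_const]
    refine norm_integral_le_of_norm_le ?_ (Eventually.of_forall fun r => ?_)
    · exact ((hdi m).integrable_of_hasCompactSupport (hds m)).norm.mul_const _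
    · rw [norm_mul]
      by_cases hr : r ∈ Icc (1/2:ℝ) (5/2)
      · exact mul_le_mul_of_nonneg_left (hX r hr) (norm_nonneg _)
      · simp [hd0 m r hr]
  have hpi : ∀ r ∈ Icc (1/2:ℝ) (5/2), 1 ≤ |-(2 * Real.pi * r)| := fun r hr => by
    rw [abs_neg, abs_of_nonneg (by have := hr.1; positivity)]
    nlinarith [hr.1, Real.pi_gt_three]
  have hpi0 : ∀ r ∈ Icc (1/2:ℝ) (5/2), -(2 * Real.pi * r) ≠ 0 := fun r hr h0 => by
    have := hpi r hr
    rw [h0] at this; norm_num at this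
  set s := ‖l • 1 + D.ι η‖ with hs
  have hmin : 0 ≤ min 1 ((δ * s) ^ (N + 1))⁻¹ := le_min zero_le_one (by positivity)
  by_cases hcase : c * |l| < ‖η‖
  · have h1 := outer 0 (fun r => ∫ y, a y * ph r (D.Tr ((l • 1 + D.ι η) * D.ex (D.ι y))) ∂μ)
      (C0 / s ^ (N + 2)) (fun r hr => by
        have h2 := hosc0 l η hcase _ (hpi0 r hr)
        unfold ph
        refine h2.trans ?_
        gcongr
        rw [← hs]
        have := hpi r hr
        nlinarith)
    simp only [iteratedDeriv_zero] at h1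
    refine h1.trans ?_
    calc (∫ r, ‖g r‖) * (C0 / s ^ (N + 2)) ≤ K * (C0 / s ^ (N + 2)) := by gcongr
      _ = C0 * K * ((s ^ (N + 2))⁻¹ + 0) := by rw [div_eq_mul_inv]; ring
      _ ≤ _ := by
        gcongr
        · have : 0 ≤ (√C1 + √C2) * 2 ^ (2 * N + 3) := by positivity
          linarith
        · positivity
  · push Not at hcase
    have hl : l ≠ 0 := by
      rintro rfl
      simp only [abs_zero, mul_zero] at hcase
      have : η = 0 := norm_le_zero_iff.mp hcase
      subst this
      simp at hξ
    have hl' : 0 < |l| := abs_pos.mpr hl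
    have hsl : s ≤ 2 * |l| := by
      have : s ≤ |l| + ‖η‖ := by
        refine (norm_add_le _ _).trans ?_
        rw [norm_smul, norm_one, mul_one, D.norm_ι, Real.norm_eq_abs]
      nlinarith
    set w : A := 1 + l⁻¹ • D.ι η with hw
    have hw1 : ‖w - 1‖ ≤ c := by
      rw [hw, add_sub_cancel_left, norm_smul, D.norm_ι, norm_inv, Real.norm_eq_abs,
        inv_mul_le_iff₀ hl']
      linarith
    have hlw : l • 1 + D.ι η = l • w := by
      rw [hw, smul_add, smul_smul, mul_inv_cancel₀ hl, one_smul]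
    have hq : ∀ y, D.Tr ((l • 1 + D.ι η) * D.ex (D.ι y)) = l * D.Tr (w * D.ex (D.ι y)) := fun y => by
      rw [hlw, smul_mul_assoc, map_smul, smul_eq_mul]
    simp only [hq]
    have hp0 : ∀ y ∈ ball (0:E) (5 * ρ), D.Tr (w * D.ex (D.ι y)) ≠ 0 := fun y hy => by
      have := hA2 w y hw1 (by simpa using hy)
      linarith
    set p : E → ℝ := fun y => D.Tr (w * D.ex (D.ι y)) with hp
    have hpc : Continuous p := by fun_prop
    have hbc : ∀ j, Continuous (fun y => (a y * ((p y : ℂ)⁻¹) ^ (j + 1))) := by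
      intro j
      refine continuous_of_continuousOn_supp (Ω := ball 0 (5 * ρ)) isOpen_ball
        (isClosed_closedBall (x := (0:E)) (ε := ρ))
        (closedBall_subset_ball (by linarith)) ?_ (fun y hy => by simp [ha0 y hy])
      refine ContinuousOn.mul (by fun_prop) (ContinuousOn.pow
        (ContinuousOn.inv₀ (by fun_prop) ?_) _)
      intro y hy
      exact_mod_cast hp0 y hy
    have hbs : ∀ j, HasCompactSupport (fun y => (a y * ((p y : ℂ)⁻¹) ^ (j + 1))) := fun j =>
      HasCompactSupport.intro (isCompact_closedBall (0:E) ρ) (fun y hy => by simp [ha0 y hy])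
    have has : HasCompactSupport (fun y => (a y : ℂ)) :=
      HasCompactSupport.intro (isCompact_closedBall (0:E) ρ) (fun y hy => by simp [ha0 y hy])
    -- integration by parts
    have key : ∀ (j : ℕ) (Cj : ℝ), 0 ≤ Cj → (∀ t : ℝ, t ≠ 0 →
        ‖∫ y, (a y * ((D.Tr (w * D.ex (D.ι y)) : ℂ)⁻¹) ^ (j + 1)) * Complex.exp (Complex.I *
        (t * D.Tr (w * D.ex (D.ι y)) : ℝ)) ∂μ‖ ^ 2 ≤ Cj / |t| ^ N) →
        ‖∫ r, g r * ∫ y, a y * ph r (l * p y) ∂μ‖ ≤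
          (∫ r, ‖iteratedDeriv (j + 1) g r‖) * (√Cj * ((|l|⁻¹) ^ (j + 1) * (√|l| ^ N)⁻¹)) := by
      intro j Cj hCj hosc
      rw [swapGB μ hg.continuous hgs (by fun_prop) has (by fun_prop)]
      set γ : ℂ := (((2 * Real.pi * Complex.I : ℂ))⁻¹) ^ (j + 1) * ((l : ℂ)⁻¹) ^ (j + 1) with hγ
      have e1 : ∀ y, (a y : ℂ) * ∫ r, g r * ph r (l * p y) = γ *
          ((a y * ((p y : ℂ)⁻¹) ^ (j + 1)) * ∫ r, iteratedDeriv (j + 1) g r * ph r (l * p y)) := by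
        intro y
        by_cases hy : y ∈ closedBall (0:E) ρ
        · rw [ibp hg hgs (j + 1) (mul_ne_zero hl
            (hp0 y (closedBall_subset_ball (by linarith) hy))), hγ]
          push_cast
          rw [mul_inv, mul_pow]; ring
        · simp [ha0 y hy]
      simp only [e1]
      rw [integral_const_mul, ← swapGB μ (hdi _) (hds _) (hbc j) (hbs j) (by fun_prop), norm_mul]
      have hγ1 : ‖γ‖ ≤ (|l|⁻¹) ^ (j + 1) := by
        rw [hγ, norm_mul, norm_pow, norm_pow, norm_inv, norm_inv, Complex.norm_real,
          Real.norm_eq_abs]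
        have : ‖(2 * Real.pi * Complex.I : ℂ)‖⁻¹ ^ (j + 1) ≤ 1 := by
          apply pow_le_one₀ (by positivity)
          apply inv_le_one_of_one_le₀
          simp only [norm_mul, Complex.norm_I, Complex.norm_real, mul_one, Complex.norm_ofNat,
            Real.norm_eq_abs, abs_of_pos Real.pi_pos]
          linarith [Real.pi_gt_three]
        calc _ ≤ 1 * |l|⁻¹ ^ (j + 1) := by gcongr
          _ = _ := one_mul _
      have h1 := outer (j + 1) (fun r => ∫ y, (a y * ((p y : ℂ)⁻¹) ^ (j + 1)) * ph r (l * p y) ∂μ)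
        (√Cj * (√|l| ^ N)⁻¹) (fun r hr => by
          have h2 := hosc (-(2 * Real.pi * r) * l) (mul_ne_zero (hpi0 r hr) hl)
          have h3 : ‖∫ y, (a y * ((p y : ℂ)⁻¹) ^ (j + 1)) * ph r (l * p y) ∂μ‖ ^ 2 ≤
              Cj / |l| ^ N := by
            unfold ph
            simp only [← mul_assoc] at h2 ⊢
            refine h2.trans ?_
            have h5 : |l| ≤ |-(2 * Real.pi * r) * l| := by
              rw [abs_mul]
              have := hpi r hr
              nlinarith
            gcongr Cj / ?_ ^ N
          have h4 := Real.le_sqrt_of_sq_le h3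
          refine h4.trans (le_of_eq ?_)
          have h6 : |l| ^ N = (√|l| ^ N) ^ 2 := by
            rw [← pow_mul, mul_comm, pow_mul, Real.sq_sqrt (abs_nonneg l)]
          rw [Real.sqrt_div hCj, div_eq_mul_inv, h6, Real.sqrt_sq (by positivity)])
      calc _ ≤ (|l|⁻¹) ^ (j + 1) * ((∫ r, ‖iteratedDeriv (j + 1) g r‖) * (√Cj * (√|l| ^ N)⁻¹)) := by
            gcongr
        _ = _ := by ring
    have k1 := key 0 C1 hC1 (hosc1 w hw1)
    have k2 := key (N + 1) C2 hC2 (hosc2 w hw1)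
    have hs0 : 0 < s := hξ'
    have hli : |l|⁻¹ ≤ 2 * s⁻¹ := by
      rw [inv_le_iff_one_le_mul₀ hl', ← div_eq_mul_inv, div_mul_eq_mul_div, le_div_iff₀ hs0]
      linarith
    have hsq : (√|l|)⁻¹ ≤ 2 * (√s)⁻¹ := by
      rw [← Real.sqrt_inv, ← Real.sqrt_inv]
      have : (2:ℝ) * √s⁻¹ = √(4 * s⁻¹) := by
        rw [Real.sqrt_mul (by norm_num)]
        congr 1
        rw [show (4:ℝ) = 2 ^ 2 by norm_num, Real.sqrt_sq (by norm_num)]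
      rw [this]
      apply Real.sqrt_le_sqrt
      have : 0 < s⁻¹ := by positivity
      linarith
    have e3 : |l|⁻¹ = (√|l|)⁻¹ ^ 2 := by rw [inv_pow, Real.sq_sqrt (abs_nonneg _)]
    have b1 : ‖∫ r, g r * ∫ y, a y * ph r (l * p y) ∂μ‖ ≤
        √C1 * 2 ^ (2 * N + 3) * K * (√s ^ (N + 2))⁻¹ := by
      refine k1.trans ?_
      rw [zero_add]
      calc (∫ r, ‖iteratedDeriv 1 g r‖) * (√C1 * ((|l|⁻¹) ^ 1 * (√|l| ^ N)⁻¹))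
          ≤ K * (√C1 * ((√|l|)⁻¹ ^ (N + 2))) := by
            rw [e3, ← inv_pow, ← pow_mul, ← pow_add, mul_one, add_comm 2 N]
            gcongr
        _ ≤ K * (√C1 * ((2 * (√s)⁻¹) ^ (N + 2))) := by gcongr
        _ = √C1 * 2 ^ (N + 2) * K * (√s ^ (N + 2))⁻¹ := by
            rw [mul_pow, inv_pow]; ring
        _ ≤ _ := by
            have : (2:ℝ) ^ (N + 2) ≤ 2 ^ (2 * N + 3) :=
              pow_le_pow_right₀ (by norm_num) (by omega)
            gcongr √C1 * ?_ * K * _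
    have b2 : ‖∫ r, g r * ∫ y, a y * ph r (l * p y) ∂μ‖ ≤
        √C2 * 2 ^ (2 * N + 3) * K * ((√s ^ (N + 2))⁻¹ * ((δ * s) ^ (N + 1))⁻¹) := by
      refine k2.trans ?_
      calc (∫ r, ‖iteratedDeriv (N + 2) g r‖) * (√C2 * ((|l|⁻¹) ^ (N + 1 + 1) * (√|l| ^ N)⁻¹))
          ≤ (K * (δ ^ (N + 1))⁻¹) * (√C2 * ((|l|⁻¹) ^ (N + 1) * (√|l|)⁻¹ ^ (N + 2))) := by
            rw [pow_succ _ (N + 1), mul_assoc (|l|⁻¹ ^ (N + 1)), show |l|⁻¹ * (√|l| ^ N)⁻¹ =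
              (√|l|)⁻¹ ^ (N + 2) by
                rw [e3, ← inv_pow, ← pow_add, add_comm 2 N]]
            gcongr
        _ ≤ (K * (δ ^ (N + 1))⁻¹) * (√C2 * ((2 * s⁻¹) ^ (N + 1) * (2 * (√s)⁻¹) ^ (N + 2))) := by
            gcongr
        _ = _ := by
            rw [mul_pow, mul_pow, mul_pow, inv_pow, inv_pow, mul_inv,
              show 2 * N + 3 = (N + 1) + (N + 2) by ring, pow_add]; ring
    have hmul : (√s ^ (N + 2))⁻¹ * min 1 ((δ * s) ^ (N + 1))⁻¹ =
        min (√s ^ (N + 2))⁻¹ ((√s ^ (N + 2))⁻¹ * ((δ * s) ^ (N + 1))⁻¹) := by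
      rw [mul_min_of_nonneg _ _ (by positivity), mul_one]
    have hX : 0 ≤ (√s ^ (N + 2))⁻¹ * min 1 ((δ * s) ^ (N + 1))⁻¹ := by positivity
    have h5 : ‖∫ r, g r * ∫ y, a y * ph r (l * p y) ∂μ‖ ≤ (√C1 + √C2) * 2 ^ (2 * N + 3) * K *
        ((√s ^ (N + 2))⁻¹ * min 1 ((δ * s) ^ (N + 1))⁻¹) := by
      rw [hmul, mul_min_of_nonneg _ _ (by positivity)]
      refine le_min (b1.trans ?_) (b2.trans ?_)
      · gcongr
        linarith [Real.sqrt_nonneg C2]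
      · gcongr
        linarith [Real.sqrt_nonneg C1]
    refine h5.trans ?_
    gcongr
    · linarith
    · have : 0 ≤ (s ^ (N + 2))⁻¹ := by positivity
      linarith

end tr
end Landau

namespace Landau
set_option linter.unusedSectionVars false
open MeasureTheory Filter Topology Set Metric
open scoped ContDiff

/-- smooth radial cutoff -/
noncomputable def cut (α β δ r : ℝ) : ℝ :=
  Real.smoothTransition ((r - α) / δ) * Real.smoothTransition ((β - r) / δ)

lemma cut_nonneg (α β δ r : ℝ) : 0 ≤ cut α β δ r :=
  mul_nonneg (Real.smoothTransition.nonneg _) (Real.smoothTransition.nonneg _)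

lemma cut_le_one (α β δ r : ℝ) : cut α β δ r ≤ 1 :=
  mul_le_one₀ (Real.smoothTransition.le_one _) (Real.smoothTransition.nonneg _)
    (Real.smoothTransition.le_one _)

lemma cut_smooth (α β δ : ℝ) : ContDiff ℝ ∞ (cut α β δ) := by
  unfold cut
  apply ContDiff.mul <;> refine Real.smoothTransition.contDiff.comp ?_ <;> fun_prop

lemma cut_zero {α β δ r : ℝ} (hδ : 0 < δ) (hr : r ∉ Icc α β) : cut α β δ r = 0 := by
  unfold cut
  rw [mem_Icc, not_and_or] at hr
  rcases hr with hr | hr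
  · rw [Real.smoothTransition.zero_of_nonpos, zero_mul]
    apply div_nonpos_of_nonpos_of_nonneg <;> linarith
  · rw [Real.smoothTransition.zero_of_nonpos (x := (β - r) / δ), mul_zero]
    apply div_nonpos_of_nonpos_of_nonneg <;> linarith

lemma cut_one {α β δ r : ℝ} (hδ : 0 < δ) (hr : r ∈ Icc (α + δ) (β - δ)) : cut α β δ r = 1 := by
  unfold cut
  rw [Real.smoothTransition.one_of_one_le, Real.smoothTransition.one_of_one_le, one_mul]
  · rw [le_div_iff₀ hδ]; linarith [hr.2]
  · rw [le_div_iff₀ hδ]; linarith [hr.1]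

lemma S_bdd (m : ℕ) : ∃ C : ℝ, ∀ i ≤ m, ∀ x, ‖iteratedDeriv i Real.smoothTransition x‖ ≤ C := by
  have h1 : ∀ i : ℕ, ∃ C : ℝ, ∀ x, ‖iteratedDeriv i Real.smoothTransition x‖ ≤ C := by
    intro i
    have hc : Continuous (iteratedDeriv i Real.smoothTransition) :=
      (Real.smoothTransition.contDiff (n := ⊤)).continuous_iteratedDeriv i (by exact_mod_cast le_top)
    obtain ⟨C, hC⟩ := (isCompact_Icc (a := (0:ℝ)) (b := 1)).exists_bound_of_continuousOn
      hc.continuousOn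
    have hcst : ∀ (c : ℝ) (x : ℝ), ‖c‖ ≤ 1 → ‖iteratedDeriv i (fun _ : ℝ => c) x‖ ≤ 1 := by
      intro c x hcx
      rw [iteratedDeriv_const]; split_ifs <;> simp_all
    refine ⟨max C 1, fun x => ?_⟩
    by_cases hx : x ∈ Icc (0:ℝ) 1
    · exact (hC x hx).trans (le_max_left _ _)
    · refine le_trans ?_ (le_max_right _ _)
      rw [mem_Icc, not_and_or, not_le, not_le] at hx
      rcases hx with hx | hx
      · have : Real.smoothTransition =ᶠ[𝓝 x] fun _ => (0:ℝ) := by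
          filter_upwards [Iio_mem_nhds hx] with z hz
          exact Real.smoothTransition.zero_of_nonpos (le_of_lt hz)
        rw [this.iteratedDeriv_eq]; exact hcst _ _ (by simp)
      · have : Real.smoothTransition =ᶠ[𝓝 x] fun _ => (1:ℝ) := by
          filter_upwards [Ioi_mem_nhds hx] with z hz
          exact Real.smoothTransition.one_of_one_le (le_of_lt hz)
        rw [this.iteratedDeriv_eq]; exact hcst _ _ (by simp)
  choose C hC using h1
  refine ⟨∑ i ∈ Finset.range (m + 1), |C i|, fun i hi x => (hC i x).trans ((le_abs_self _).trans ?_)⟩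
  exact Finset.single_le_sum (f := fun i => |C i|) (fun _ _ => abs_nonneg _)
    (Finset.mem_range.mpr (by omega))

lemma leib {f g : ℝ → ℝ} (hf : ContDiff ℝ ∞ f) (hg : ContDiff ℝ ∞ g) {m : ℕ} {δ C C' x : ℝ}
    (hδ : 0 < δ) (h1 : ∀ i ≤ m, ‖iteratedDeriv i f x‖ ≤ C * δ⁻¹ ^ i)
    (h2 : ∀ i ≤ m, ‖iteratedDeriv i g x‖ ≤ C' * δ⁻¹ ^ i) :
    ∀ i ≤ m, ‖iteratedDeriv i (fun y => f y * g y) x‖ ≤ (2 ^ m * C * C') * δ⁻¹ ^ i := by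
  intro i hi
  have hC : 0 ≤ C := by have := (norm_nonneg _).trans (h1 0 (by omega)); simpa using this
  have hC' : 0 ≤ C' := by have := (norm_nonneg _).trans (h2 0 (by omega)); simpa using this
  have h := norm_iteratedFDeriv_mul_le hf hg x (n := i) (by exact_mod_cast le_top)
  simp only [norm_iteratedFDeriv_eq_norm_iteratedDeriv] at h
  refine h.trans ?_
  calc ∑ k ∈ Finset.range (i + 1), (i.choose k : ℝ) * ‖iteratedDeriv k f x‖ *
        ‖iteratedDeriv (i - k) g x‖
      ≤ ∑ k ∈ Finset.range (i + 1), (i.choose k : ℝ) * (C * C' * δ⁻¹ ^ i) := by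
        apply Finset.sum_le_sum
        intro k hk
        have hk' : k ≤ i := by simpa [Nat.lt_succ_iff] using hk
        have : δ⁻¹ ^ i = δ⁻¹ ^ k * δ⁻¹ ^ (i - k) := by rw [← pow_add]; congr 1; omega
        rw [this, mul_assoc]
        refine mul_le_mul_of_nonneg_left ?_ (by positivity)
        calc _ ≤ (C * δ⁻¹ ^ k) * (C' * δ⁻¹ ^ (i - k)) := by
              gcongr
              · exact h1 k (by omega)
              · exact h2 (i - k) (by omega)
          _ = _ := by ring
    _ = 2 ^ i * (C * C' * δ⁻¹ ^ i) := by
        rw [← Finset.sum_mul]; congr 1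
        exact_mod_cast Nat.sum_range_choose i
    _ ≤ 2 ^ m * (C * C' * δ⁻¹ ^ i) := by
        gcongr
        norm_num
    _ = _ := by ring

lemma pow_bdd (N m : ℕ) : ∃ C : ℝ, 0 ≤ C ∧ ∀ i ≤ m, ∀ x ∈ Icc (1/2:ℝ) (5/2),
    ‖iteratedDeriv i (fun y : ℝ => y ^ N) x‖ ≤ C := by
  have h1 : ∀ i : ℕ, ∃ C : ℝ, ∀ x ∈ Icc (1/2:ℝ) (5/2),
      ‖iteratedDeriv i (fun y : ℝ => y ^ N) x‖ ≤ C := fun i => by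
    have hc : Continuous (iteratedDeriv i (fun y : ℝ => y ^ N)) :=
      (show ContDiff ℝ ∞ (fun y : ℝ => y ^ N) by fun_prop).continuous_iteratedDeriv i
        (by exact_mod_cast le_top)
    exact isCompact_Icc.exists_bound_of_continuousOn hc.continuousOn
  choose C hC using h1
  refine ⟨∑ i ∈ Finset.range (m + 1), |C i|, Finset.sum_nonneg (fun _ _ => abs_nonneg _),
    fun i hi x hx => (hC i x hx).trans ((le_abs_self _).trans ?_)⟩
  exact Finset.single_le_sum (f := fun i => |C i|) (fun _ _ => abs_nonneg _)
    (Finset.mem_range.mpr (by omega))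

/-- the radial profile -/
noncomputable def rad (N : ℕ) (α β δ r : ℝ) : ℝ := r ^ N * cut α β δ r

lemma rad_smooth (N : ℕ) (α β δ : ℝ) : ContDiff ℝ ∞ (rad N α β δ) := by
  unfold rad
  exact ContDiff.mul (by fun_prop) (cut_smooth α β δ)

lemma rad_pt (N m : ℕ) : ∃ C : ℝ, 0 ≤ C ∧ ∀ δ α β : ℝ, 0 < δ → δ ≤ 1/2 → 1/2 ≤ α → α ≤ 1 → 2 ≤ β →
    β ≤ 5/2 → ∀ i ≤ m, ∀ r, 
      ‖iteratedDeriv i (rad N α β δ) r‖ ≤ (Icc (1/2:ℝ) (5/2)).indicator (fun _ => C) r +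
        ((Icc α (α + δ)).indicator (fun _ => C * δ⁻¹ ^ i) r +
         (Icc (β - δ) β).indicator (fun _ => C * δ⁻¹ ^ i) r) := by
  obtain ⟨CS, hCS⟩ := S_bdd m
  obtain ⟨CP, hCP0, hCP⟩ := pow_bdd N m
  have hCS0 : 0 ≤ CS := (norm_nonneg _).trans (hCS 0 (by omega) 0)
  set C : ℝ := CP + 2 ^ m * CP * (2 ^ m * CS * CS) with hC
  have hC0 : 0 ≤ C := by positivity
  refine ⟨C, hC0, fun δ α β hδ hδ2 hα hα1 hβ hβ1 i hi r => ?_⟩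
  have hnn : ∀ (s : Set ℝ) (c : ℝ), 0 ≤ c → 0 ≤ s.indicator (fun _ => c) r := fun s c hc =>
    indicator_nonneg (fun _ _ => hc) _
  have hd : 0 ≤ C * δ⁻¹ ^ i := by positivity
  have n1 := hnn (Icc (1/2:ℝ) (5/2)) C hC0
  have n2 := hnn (Icc α (α + δ)) _ hd
  have n3 := hnn (Icc (β - δ) β) _ hd
  by_cases hr : r ∈ Icc α β
  swap
  · have : rad N α β δ =ᶠ[𝓝 r] fun _ => (0:ℝ) := by
      filter_upwards [isClosed_Icc.isOpen_compl.mem_nhds hr] with z hz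
      unfold rad
      rw [cut_zero hδ hz, mul_zero]
    rw [this.iteratedDeriv_eq]
    simp only [iteratedDeriv_fun_const_zero, norm_zero]
    linarith
  have hr' : r ∈ Icc (1/2:ℝ) (5/2) := ⟨by linarith [hr.1], by linarith [hr.2]⟩
  by_cases hmid : r ∈ Ioo (α + δ) (β - δ)
  · have : rad N α β δ =ᶠ[𝓝 r] fun y => y ^ N := by
      filter_upwards [isOpen_Ioo.mem_nhds hmid] with z hz
      unfold rad
      rw [cut_one hδ ⟨hz.1.le, hz.2.le⟩, mul_one]
    rw [this.iteratedDeriv_eq, indicator_of_mem hr']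
    have h1 := hCP i hi r hr'
    have : 0 ≤ 2 ^ m * CP * (2 ^ m * CS * CS) := by positivity
    linarith
  · have hδ1 : 1 ≤ δ⁻¹ := by
      rw [one_le_inv₀ hδ]; linarith
    have s1 : ∀ i ≤ m, ‖iteratedDeriv i (fun r => Real.smoothTransition ((r - α) / δ)) r‖ ≤
        CS * δ⁻¹ ^ i := by
      intro i hi
      have e : (fun r => Real.smoothTransition ((r - α) / δ)) =
          fun r => (fun z => Real.smoothTransition (δ⁻¹ * z)) (r - α) := by
        ext r; congr 1; rw [div_eq_inv_mul]
      have L1 := iteratedDeriv_comp_sub_const i (fun z : ℝ => Real.smoothTransition (δ⁻¹ * z)) α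
      rw [e, L1, iteratedDeriv_comp_const_mul Real.smoothTransition.contDiff]
      simp only
      rw [norm_mul, norm_pow, Real.norm_of_nonneg (by positivity : 0 ≤ δ⁻¹), mul_comm]
      gcongr
      exact hCS i hi _
    have s2 : ∀ i ≤ m, ‖iteratedDeriv i (fun r => Real.smoothTransition ((β - r) / δ)) r‖ ≤
        CS * δ⁻¹ ^ i := by
      intro i hi
      have e : (fun r => Real.smoothTransition ((β - r) / δ)) =
          fun r => (fun z => Real.smoothTransition (δ⁻¹ * z)) (β - r) := by
        ext r; congr 1; rw [div_eq_inv_mul]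
      have L2 := iteratedDeriv_comp_const_sub i (fun z : ℝ => Real.smoothTransition (δ⁻¹ * z)) β
      rw [e, L2, iteratedDeriv_comp_const_mul Real.smoothTransition.contDiff]
      simp only [smul_eq_mul]
      rw [norm_mul, norm_mul, norm_pow, norm_pow, norm_neg, norm_one, one_pow, one_mul,
        Real.norm_of_nonneg (by positivity : 0 ≤ δ⁻¹), mul_comm]
      gcongr
      exact hCS i hi _
    have sm1 : ContDiff ℝ ∞ (fun r => Real.smoothTransition ((r - α) / δ)) :=
      Real.smoothTransition.contDiff.comp (by fun_prop)
    have sm2 : ContDiff ℝ ∞ (fun r => Real.smoothTransition ((β - r) / δ)) :=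
      Real.smoothTransition.contDiff.comp (by fun_prop)
    have s3 := leib sm1 sm2 hδ s1 s2
    have s4 := leib (f := fun y : ℝ => y ^ N) (by fun_prop) (sm1.mul sm2) hδ (C := CP)
      (fun i hi => (hCP i hi r hr').trans (by
        have := one_le_pow₀ hδ1 (n := i); nlinarith)) s3 i hi
    have s5 : ‖iteratedDeriv i (rad N α β δ) r‖ ≤ C * δ⁻¹ ^ i := by
      refine le_trans s4 ?_
      gcongr
      linarith
    rw [mem_Ioo, not_and_or, not_lt, not_lt] at hmid
    rcases hmid with h | h
    · rw [indicator_of_mem (show r ∈ Icc α (α + δ) from ⟨hr.1, h⟩)]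
      linarith
    · rw [indicator_of_mem (show r ∈ Icc (β - δ) β from ⟨h, hr.2⟩)]
      linarith

lemma rad_bounds (N m : ℕ) : ∃ K : ℝ, 0 ≤ K ∧ ∀ δ α β : ℝ, 0 < δ → δ ≤ 1/2 → 1/2 ≤ α → α ≤ 1 →
    2 ≤ β → β ≤ 5/2 → 
    (∫ r, ‖((rad N α β δ r : ℝ) : ℂ)‖ ≤ K) ∧
    ∀ i ≤ m, 1 ≤ i → ∫ r, ‖iteratedDeriv i (fun r => ((rad N α β δ r : ℝ) : ℂ)) r‖ ≤
      K * δ⁻¹ ^ (i - 1) := by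
  obtain ⟨C, hC, h⟩ := rad_pt N m
  refine ⟨4 * C, by positivity, fun δ α β hδ hδ2 hα hα1 hβ hβ1 => ?_⟩
  have hδ1 : 1 ≤ δ⁻¹ := by
    rw [one_le_inv₀ hδ]; linarith
  have ii : ∀ (a b c : ℝ), Integrable ((Icc a b).indicator (fun _ => c)) volume := fun a b c =>
    (integrable_indicator_iff measurableSet_Icc).mpr (by simp)
  have iv : ∀ (a b c : ℝ), a ≤ b → ∫ r, (Icc a b).indicator (fun _ => c) r = (b - a) * c := by
    intro a b c hab
    rw [integral_indicator measurableSet_Icc]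
    simp [hab]
  have main : ∀ i ≤ m, ∫ r, ‖iteratedDeriv i (rad N α β δ) r‖ ≤ 2 * C + 2 * (δ * (C * δ⁻¹ ^ i)) := by
    intro i hi
    refine (integral_mono_of_nonneg (Eventually.of_forall fun r => norm_nonneg _)
      ((ii _ _ _).add ((ii _ _ _).add (ii _ _ _)))
      (Eventually.of_forall fun r => h δ α β hδ hδ2 hα hα1 hβ hβ1 i hi r)).trans (le_of_eq ?_)
    rw [integral_add' (ii _ _ _) ((ii _ _ _).add (ii _ _ _)), integral_add' (ii _ _ _) (ii _ _ _),
      iv _ _ _ (by norm_num), iv _ _ _ (by linarith), iv _ _ _ (by linarith)]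
    ring
  constructor
  · have := main 0 (by omega)
    simp only [Complex.norm_real]
    simp only [iteratedDeriv_zero, pow_zero, mul_one] at this
    nlinarith
  · intro i hi hi1
    have e : ∀ r, ‖iteratedDeriv i (fun r => ((rad N α β δ r : ℝ) : ℂ)) r‖ =
        ‖iteratedDeriv i (rad N α β δ) r‖ := fun r => by
      rw [← norm_iteratedFDeriv_eq_norm_iteratedDeriv, ← norm_iteratedFDeriv_eq_norm_iteratedDeriv]
      exact Complex.ofRealLI.norm_iteratedFDeriv_comp_left
        ((rad_smooth N α β δ).contDiffAt (x := r)) (i := i) (by exact_mod_cast le_top)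
    simp only [e]
    refine (main i hi).trans ?_
    obtain ⟨k, rfl⟩ : ∃ k, i = k + 1 := ⟨i - 1, by omega⟩
    have e2 : δ * (C * δ⁻¹ ^ (k + 1)) = C * δ⁻¹ ^ k := by
      rw [pow_succ]; field_simp
    rw [e2, Nat.add_sub_cancel]
    have := one_le_pow₀ hδ1 (n := k)
    nlinarith

lemma rad_integral (N : ℕ) : ∃ K : ℝ, 0 ≤ K ∧ ∀ δ α β : ℝ, 0 < δ → δ ≤ 1/2 → 1 - δ ≤ α → α ≤ 1 →
    2 ≤ β → β ≤ 2 + δ → |(∫ r, rad N α β δ r) - (2 ^ (N + 1) - 1) / (N + 1)| ≤ K * δ := by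
  refine ⟨4 * (5/2) ^ N, by positivity, fun δ α β hδ hδ2 hα hα1 hβ hβ1 => ?_⟩
  have ii : ∀ (a b c : ℝ), Integrable ((Icc a b).indicator (fun _ => c)) volume := fun a b c =>
    (integrable_indicator_iff measurableSet_Icc).mpr (by simp)
  have iv : ∀ (a b c : ℝ), a ≤ b → ∫ r, (Icc a b).indicator (fun _ => c) r = (b - a) * c := by
    intro a b c hab
    rw [integral_indicator measurableSet_Icc]
    simp [hab]
  have e1 : ∫ r, (Icc (1:ℝ) 2).indicator (fun r => r ^ N) r = (2 ^ (N + 1) - 1) / (N + 1) := by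
    rw [integral_indicator measurableSet_Icc, integral_Icc_eq_integral_Ioc,
      ← intervalIntegral.integral_of_le (by norm_num), integral_pow]
    simp
  have i1 : Integrable (fun r => (Icc (1:ℝ) 2).indicator (fun r => r ^ N) r) volume :=
    (integrable_indicator_iff measurableSet_Icc).mpr
      (continuousOn_id.pow N |>.integrableOn_compact isCompact_Icc)
  have i2 : Integrable (rad N α β δ) volume := by
    apply (rad_smooth N α β δ).continuous.integrable_of_hasCompactSupport
    refine HasCompactSupport.intro (isCompact_Icc (a := α) (b := β)) (fun r hr => ?_)
    unfold rad; rw [cut_zero hδ hr, mul_zero]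
  rw [← e1, ← integral_sub i2 i1, ← Real.norm_eq_abs]
  have hb := norm_integral_le_of_norm_le (μ := volume)
    (f := fun r => rad N α β δ r - (Icc (1:ℝ) 2).indicator (fun r => r ^ N) r)
    ((ii (1 - δ) (1 + δ) ((5/2)^N)).add (ii (2 - δ) (2 + δ) ((5/2)^N)))
    (Eventually.of_forall fun r => ?_)
  · refine hb.trans (le_of_eq ?_)
    simp only [Pi.add_apply]
    rw [integral_add (ii _ _ _) (ii _ _ _), iv _ _ _ (by linarith), iv _ _ _ (by linarith)]
    ring
  · simp only [Pi.add_apply]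
    have hnn : ∀ (s : Set ℝ), 0 ≤ s.indicator (fun _ => ((5:ℝ)/2)^N) r := fun s =>
      indicator_nonneg (fun _ _ => by positivity) _
    have n1 := hnn (Icc (1 - δ) (1 + δ))
    have n2 := hnn (Icc (2 - δ) (2 + δ))
    have gen : r ∈ Icc (1/2:ℝ) (5/2) →
        ‖rad N α β δ r - (Icc (1:ℝ) 2).indicator (fun r => r ^ N) r‖ ≤ (5/2)^N := by
      intro hr
      have h1 : r ^ N ≤ (5/2) ^ N := by
        have := hr.1
        gcongr
        exact hr.2
      have h0 : 0 ≤ r ^ N := by have := hr.1; positivity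
      have h2 := cut_nonneg α β δ r
      have h3 := cut_le_one α β δ r
      have h4 : rad N α β δ r ≤ r ^ N := by unfold rad; nlinarith
      have h5 : 0 ≤ rad N α β δ r := by unfold rad; positivity
      rw [Real.norm_eq_abs, abs_le]
      by_cases hm : r ∈ Icc (1:ℝ) 2
      · rw [indicator_of_mem hm]; constructor <;> linarith
      · rw [indicator_of_notMem hm]; constructor <;> linarith
    by_cases h1 : r ∈ Icc (1 - δ) (1 + δ)
    · rw [indicator_of_mem h1]
      have := gen ⟨by linarith [h1.1], by linarith [h1.2]⟩
      linarith
    by_cases h2 : r ∈ Icc (2 - δ) (2 + δ)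
    · rw [indicator_of_mem h2]
      have := gen ⟨by linarith [h2.1], by linarith [h2.2]⟩
      linarith
    have hz : rad N α β δ r - (Icc (1:ℝ) 2).indicator (fun r => r ^ N) r = 0 := by
      rw [mem_Icc, not_and_or, not_le, not_le] at h1 h2
      rcases h1 with h1 | h1
      · rw [indicator_of_notMem (fun hm => by linarith [hm.1])]
        unfold rad
        rw [cut_zero hδ (fun hm => by linarith [hm.1])]; simp
      · rcases h2 with h2 | h2
        · rw [indicator_of_mem (show r ∈ Icc (1:ℝ) 2 from ⟨by linarith, by linarith⟩)]
          unfold rad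
          rw [cut_one hδ ⟨by linarith, by linarith⟩]; simp
        · rw [indicator_of_notMem (fun hm => by linarith [hm.2])]
          unfold rad
          rw [cut_zero hδ (fun hm => by linarith [hm.2])]; simp
    rw [hz, norm_zero]; linarith

end Landau

namespace Landau
set_option linter.unusedSectionVars false
open MeasureTheory Filter Topology Set Metric
open scoped ContDiff

/-- The mixed space `ℝ^I × ℂ^J`. -/
abbrev MS (I J : Type*) := (I → ℝ) × (J → ℂ)

section
variable {I J : Type*} [Fintype I] [Fintype J]

/-- trace -/
noncomputable def tr : MS I J →L[ℝ] ℝ :=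
  (∑ i : I, (ContinuousLinearMap.proj (R := ℝ) (φ := fun _ : I => ℝ) i).comp (ContinuousLinearMap.fst ℝ _ _)) +
  (2:ℝ) • ∑ j : J, Complex.reCLM.comp
    ((ContinuousLinearMap.proj (R := ℝ) (φ := fun _ : J => ℂ) j).comp (ContinuousLinearMap.snd ℝ _ _))

lemma tr_apply (z : MS I J) : tr z = ∑ i, z.1 i + 2 * ∑ j, (z.2 j).re := by
  simp [tr]

/-- conjugation -/
noncomputable def cj (z : MS I J) : MS I J := (z.1, fun j => (starRingEnd ℂ) (z.2 j))

/-- componentwise exponential -/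
noncomputable def mex (z : MS I J) : MS I J := (fun i => Real.exp (z.1 i), fun j => Complex.exp (z.2 j))

/-- norm -/
noncomputable def nm (z : MS I J) : ℝ := (∏ i, |z.1 i|) * ∏ j, ‖z.2 j‖ ^ 2

/-- degree -/
def dg (I J : Type*) [Fintype I] [Fintype J] : ℕ := Fintype.card I + 2 * Fintype.card J

lemma tr_one : tr (1 : MS I J) = dg I J := by
  simp [tr_apply, dg]

lemma norm_le_ms (z : MS I J) {r : ℝ} (hr : 0 ≤ r) (h1 : ∀ i, |z.1 i| ≤ r) (h2 : ∀ j, ‖z.2 j‖ ≤ r) :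
    ‖z‖ ≤ r := by
  rw [Prod.norm_def]
  exact max_le ((pi_norm_le_iff_of_nonneg hr).mpr h1) ((pi_norm_le_iff_of_nonneg hr).mpr h2)

lemma le_norm1 (z : MS I J) (i : I) : |z.1 i| ≤ ‖z‖ := (norm_le_pi_norm z.1 i).trans (norm_fst_le z)
lemma le_norm2 (z : MS I J) (j : J) : ‖z.2 j‖ ≤ ‖z‖ := (norm_le_pi_norm z.2 j).trans (norm_snd_le z)

lemma dg_pos [h : Nonempty (I ⊕ J)] : 0 < dg I J := by
  unfold dg
  rcases h with ⟨i | j⟩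
  · have := Fintype.card_pos_iff.mpr ⟨i⟩; omega
  · have := Fintype.card_pos_iff.mpr ⟨j⟩; omega

instance normOneClassMS [h : Nonempty (I ⊕ J)] : NormOneClass (MS I J) := by
  constructor
  apply le_antisymm
  · exact norm_le_ms _ (by norm_num) (by simp) (by simp)
  · rcases h with ⟨i | j⟩
    · simpa using le_norm1 (1 : MS I J) i
    · simpa using le_norm2 (1 : MS I J) j

lemma tr_cj (z : MS I J) : tr (cj z) = tr z := by simp [tr_apply, cj]
lemma norm_cj (z : MS I J) : ‖cj z‖ = ‖z‖ := by
  have : ∀ z : MS I J, ‖cj z‖ ≤ ‖z‖ := fun z => norm_le_ms _ (norm_nonneg _) (le_norm1 z) (fun j => by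
    simpa [cj] using le_norm2 z j)
  apply le_antisymm (this z)
  have h := this (cj z)
  have e : cj (cj z) = z := by ext <;> simp [cj]
  rwa [e] at h

lemma tr_pos (z : MS I J) : ‖z‖ ^ 2 ≤ tr (z * cj z) := by
  have e : tr (z * cj z) = ∑ i, (z.1 i)^2 + 2 * ∑ j, ‖z.2 j‖^2 := by
    simp only [tr_apply, cj, Prod.fst_mul, Prod.snd_mul, Pi.mul_apply, Complex.mul_conj,
      Complex.ofReal_re, Complex.normSq_eq_norm_sq, pow_two]
  have n1 : 0 ≤ ∑ i, (z.1 i)^2 := Finset.sum_nonneg fun _ _ => sq_nonneg _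
  have n2 : 0 ≤ ∑ j, ‖z.2 j‖^2 := Finset.sum_nonneg fun _ _ => sq_nonneg _
  have : ‖z‖ ≤ √(tr (z * cj z)) := by
    apply norm_le_ms _ (Real.sqrt_nonneg _)
    · intro i
      apply Real.le_sqrt_of_sq_le
      have := Finset.single_le_sum (f := fun i => (z.1 i)^2) (fun _ _ => sq_nonneg _) (Finset.mem_univ i)
      rw [sq_abs, e]; linarith
    · intro j
      apply Real.le_sqrt_of_sq_le
      have := Finset.single_le_sum (f := fun j => ‖z.2 j‖^2) (fun _ _ => sq_nonneg _) (Finset.mem_univ j)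
      rw [e]; linarith
  calc ‖z‖^2 ≤ (√(tr (z * cj z)))^2 := by gcongr
    _ = _ := Real.sq_sqrt (by rw [e]; positivity)

lemma mex_add (x y : MS I J) : mex (x + y) = mex x * mex y := by
  ext <;> simp [mex, Real.exp_add, Complex.exp_add]

lemma mex_zero : mex (0 : MS I J) = 1 := by
  ext <;> simp [mex]

lemma mex_deriv (x : MS I J) :
    HasFDerivAt (mex (I := I) (J := J)) (ContinuousLinearMap.mul ℝ (MS I J) (mex x)) x := by
  have h1 : HasFDerivAt (fun z : MS I J => fun i => Real.exp (z.1 i))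
      ((ContinuousLinearMap.fst ℝ _ _).comp (ContinuousLinearMap.mul ℝ (MS I J) (mex x))) x := by
    rw [hasFDerivAt_pi']
    intro i
    have := ((Real.hasDerivAt_exp (x.1 i)).hasFDerivAt.comp x
      ((ContinuousLinearMap.proj (R := ℝ) (φ := fun _ : I => ℝ) i).comp
        (ContinuousLinearMap.fst ℝ _ (J → ℂ))).hasFDerivAt)
    convert! this using 1
    ext z <;> simp [mex, mul_comm]
  have h2 : HasFDerivAt (fun z : MS I J => fun j => Complex.exp (z.2 j))
      ((ContinuousLinearMap.snd ℝ _ _).comp (ContinuousLinearMap.mul ℝ (MS I J) (mex x))) x := by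
    rw [hasFDerivAt_pi']
    intro j
    have := (((Complex.hasDerivAt_exp (x.2 j)).hasFDerivAt.restrictScalars ℝ).comp x
      ((ContinuousLinearMap.proj (R := ℝ) (φ := fun _ : J => ℂ) j).comp
        (ContinuousLinearMap.snd ℝ (I → ℝ) _)).hasFDerivAt)
    convert! this using 1
    ext z <;> simp [mex, mul_comm]
  have := h1.prodMk h2
  convert! this using 1

lemma mex_smooth : ContDiff ℝ ∞ (mex (I := I) (J := J)) := by
  unfold mex
  apply ContDiff.prodMk
  · rw [contDiff_pi]; intro i; 
    exact Real.contDiff_exp.comp (by fun_prop)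
  · rw [contDiff_pi]; intro i; 
    exact ((Complex.contDiff_exp (𝕜 := ℂ)).restrict_scalars ℝ).comp (by fun_prop)

lemma nm_mex (z : MS I J) : nm (mex z) = Real.exp (tr z) := by
  simp only [nm, mex, Real.abs_exp, Complex.norm_exp, tr_apply, Real.exp_add, Real.exp_sum]
  congr 1
  rw [Finset.mul_sum, Real.exp_sum]
  simp [two_mul, pow_two, Real.exp_add]

lemma nm_mul (z w : MS I J) : nm (z * w) = nm z * nm w := by
  simp only [nm, Prod.fst_mul, Prod.snd_mul, Pi.mul_apply, abs_mul, norm_mul, mul_pow,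
    Finset.prod_mul_distrib]
  ring

lemma nm_one : nm (1 : MS I J) = 1 := by simp [nm]

lemma nm_nonneg (z : MS I J) : 0 ≤ nm z := by unfold nm; positivity

lemma nm_smul (r : ℝ) (hr : 0 ≤ r) (z : MS I J) : nm (r • z) = r ^ (dg I J) * nm z := by
  simp only [nm, dg, Prod.smul_fst, Prod.smul_snd, Pi.smul_apply, smul_eq_mul, abs_mul, abs_of_nonneg hr,
    norm_smul, Real.norm_eq_abs, mul_pow, Finset.prod_mul_distrib, Finset.prod_const, Finset.card_univ,
    pow_add, pow_mul]
  ring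

lemma nm_continuous : Continuous (nm (I := I) (J := J)) := by
  unfold nm; fun_prop

lemma nm_le (z : MS I J) : nm z ≤ ‖z‖ ^ dg I J := by
  unfold nm dg
  rw [pow_add, pow_mul]
  gcongr
  · exact (Finset.prod_le_prod (fun i _ => abs_nonneg _) (fun i _ => le_norm1 z i)).trans (by simp)
  · exact (Finset.prod_le_prod (fun i _ => by positivity) 
      (fun j _ => pow_le_pow_left₀ (norm_nonneg _) (le_norm2 z j) 2)).trans (by simp)

/-- trace zero hyperplane -/
noncomputable abbrev HE (I J : Type*) [Fintype I] [Fintype J] : Submodule ℝ (MS I J) := LinearMap.ker (tr (I := I) (J := J)).toLinearMap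

lemma mem_HE {z : MS I J} : z ∈ HE I J ↔ tr z = 0 := by simp [HE]

/-- projection to the hyperplane -/
noncomputable def prj (z : MS I J) : MS I J := z - (tr z / dg I J) • 1

lemma prj_mem [Nonempty (I ⊕ J)] (z : MS I J) : prj z ∈ HE I J := by
  rw [mem_HE, prj, map_sub, map_smul, tr_one]
  have : (dg I J : ℝ) ≠ 0 := by exact_mod_cast (dg_pos (I := I) (J := J)).ne'
  simp; field_simp; simp

/-- the trace data of the mixed space -/
noncomputable def trD (I J : Type*) [Fintype I] [Fintype J] [Nonempty (I ⊕ J)] : TrData (MS I J) (HE I J) where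
  Tr := tr
  ι := (HE I J).subtypeL
  τ := fun y => ⟨cj y, by rw [mem_HE, tr_cj]; exact mem_HE.mp y.2⟩
  ex := mex
  norm_ι := fun y => rfl
  norm_τ := fun y => (norm_cj (y : MS I J)).le
  pos := fun y => tr_pos (y : MS I J)
  Tr_ι := fun y => mem_HE.mp y.2
  decomp := fun ξ => ⟨tr ξ / dg I J, ⟨prj ξ, prj_mem ξ⟩, by simp [prj]⟩
  one_le := by rw [tr_one]; exact_mod_cast dg_pos (I := I) (J := J)
  ex_zero := mex_zero
  ex_add := mex_add
  ex_deriv := mex_deriv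
  ex_smooth := mex_smooth

lemma finrank_MS : Module.finrank ℝ (MS I J) = dg I J := by
  simp [dg, Module.finrank_pi_fintype, mul_comm]

lemma finrank_HE [Nonempty (I ⊕ J)] : Module.finrank ℝ (HE I J) + 1 = dg I J := by
  rw [← finrank_MS (I := I) (J := J), add_comm]
  have h := LinearMap.finrank_range_add_finrank_ker (tr (I := I) (J := J)).toLinearMap
  rw [← h]; congr 1
  have hs : LinearMap.range (tr (I := I) (J := J)).toLinearMap = ⊤ := by
    rw [LinearMap.range_eq_top]
    intro x
    refine ⟨(x / dg I J) • 1, ?_⟩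
    have : (dg I J : ℝ) ≠ 0 := by exact_mod_cast (dg_pos (I := I) (J := J)).ne'
    simp [tr_one]; field_simp
  rw [hs]; simp

/-- determinant of multiplication -/
lemma det_mul (a : MS I J) : |(ContinuousLinearMap.mul ℝ (MS I J) a).det| = nm a := by
  have e : ((ContinuousLinearMap.mul ℝ (MS I J) a : MS I J →L[ℝ] MS I J) : MS I J →ₗ[ℝ] MS I J) =
      LinearMap.prodMap (LinearMap.pi fun i => (LinearMap.mulLeft ℝ (a.1 i)).comp (LinearMap.proj i))
        (LinearMap.pi fun j => (LinearMap.mulLeft ℝ (a.2 j)).comp (LinearMap.proj j)) := by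
    ext <;> simp
  rw [ContinuousLinearMap.det, e, LinearMap.det_prodMap, LinearMap.det_pi, LinearMap.det_pi, abs_mul,
    Finset.abs_prod, Finset.abs_prod, nm]
  congr 1
  · congr 1; ext i; simp
  · congr 1; ext j
    have : LinearMap.det (LinearMap.mulLeft ℝ (a.2 j)) = Algebra.norm ℝ (a.2 j) := rfl
    rw [this, Algebra.norm_complex_apply, Complex.normSq_eq_norm_sq, abs_of_nonneg (by positivity)]

end
end Landau

namespace Landau
set_option linter.unusedSectionVars false
open MeasureTheory Filter Topology Set Metric
open scoped ContDiff

section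
variable {I J : Type*} [Fintype I] [Fintype J]

/-- componentwise logarithm -/
noncomputable def mlog (z : MS I J) : MS I J := (fun i => Real.log (z.1 i), fun j => Complex.log (z.2 j))

/-- domain of the logarithm -/
def US (I J : Type*) : Set (MS I J) := {v | (∀ i, 0 < v.1 i) ∧ ∀ j, v.2 j ∈ Complex.slitPlane}

/-- image of the logarithm -/
def OS (I J : Type*) : Set (MS I J) := {z | ∀ j, |(z.2 j).im| < Real.pi}

lemma isOpen_US : IsOpen (US I J) := by
  have : US I J = (⋂ i, {v : MS I J | 0 < v.1 i}) ∩ ⋂ j, {v : MS I J | v.2 j ∈ Complex.slitPlane} := by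
    ext v; simp [US]
  rw [this]
  refine (isOpen_iInter_of_finite fun i => isOpen_lt (by fun_prop) (by fun_prop)).inter
    (isOpen_iInter_of_finite fun j => Complex.isOpen_slitPlane.preimage (by fun_prop))

lemma isOpen_OS : IsOpen (OS I J) := by
  have : OS I J = ⋂ j, {v : MS I J | |(v.2 j).im| < Real.pi} := by
    ext v; simp [OS]
  rw [this]
  refine isOpen_iInter_of_finite fun i => isOpen_lt (by fun_prop) (by fun_prop)

lemma mex_mlog {v : MS I J} (hv : v ∈ US I J) : mex (mlog v) = v := by
  ext i
  · simp [mex, mlog, Real.exp_log (hv.1 i)]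
  · simp [mex, mlog, Complex.exp_log (Complex.slitPlane_ne_zero (hv.2 i))]

lemma mlog_mex {z : MS I J} (hz : z ∈ OS I J) : mlog (mex z) = z := by
  ext i
  · simp [mex, mlog]
  · have := abs_lt.mp (hz i)
    simp [mex, mlog, Complex.log_exp this.1 this.2.le]

lemma mex_mem {z : MS I J} (hz : z ∈ OS I J) : mex z ∈ US I J := by
  refine ⟨fun i => Real.exp_pos _, fun j => ?_⟩
  have h := abs_lt.mp (hz j)
  rw [Complex.mem_slitPlane_iff_arg]
  refine ⟨?_, Complex.exp_ne_zero _⟩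
  have e : Complex.arg (Complex.exp (z.2 j)) = (z.2 j).im := by
    rw [← Complex.log_im, Complex.log_exp h.1 h.2.le]
  show Complex.arg (Complex.exp (z.2 j)) ≠ _
  rw [e]; exact h.2.ne

lemma mlog_mem {v : MS I J} (hv : v ∈ US I J) : mlog v ∈ OS I J := by
  intro j
  have := Complex.mem_slitPlane_iff_arg.mp (hv.2 j)
  simp only [mlog, Complex.log_im]
  rw [abs_lt]
  exact ⟨Complex.neg_pi_lt_arg _, lt_of_le_of_ne (Complex.arg_le_pi _) this.1⟩

lemma mlog_cont : ContinuousOn (mlog (I := I) (J := J)) (US I J) := by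
  unfold mlog
  apply ContinuousOn.prodMk
  · rw [continuousOn_pi]; intro i
    apply ContinuousOn.log (by fun_prop)
    intro v hv; exact (hv.1 i).ne'
  · rw [continuousOn_pi]; intro j
    apply ContinuousOn.clog (by fun_prop)
    intro v hv; exact hv.2 j

lemma nm_pos_US {v : MS I J} (hv : v ∈ US I J) : 0 < nm v := by
  rw [← mex_mlog hv, nm_mex]; exact Real.exp_pos _

/-- radius -/
noncomputable def rd (v : MS I J) : ℝ := nm v ^ (1 / (dg I J : ℝ))

lemma rd_continuous : Continuous (rd (I := I) (J := J)) := by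
  unfold rd
  exact nm_continuous.rpow_const (fun _ => Or.inr (by positivity))

variable [Nonempty (I ⊕ J)]

lemma dg_ne : (dg I J : ℝ) ≠ 0 := by exact_mod_cast (dg_pos (I := I) (J := J)).ne'

lemma rd_mex (z : MS I J) : rd (mex z) = Real.exp (tr z / dg I J) := by
  unfold rd
  rw [nm_mex, ← Real.exp_mul]; congr 1; ring

lemma rd_mul (z w : MS I J) : rd (z * w) = rd z * rd w := by
  unfold rd
  rw [nm_mul, Real.mul_rpow (nm_nonneg _) (nm_nonneg _)]

lemma rd_smul {r : ℝ} (hr : 0 ≤ r) (z : MS I J) : rd (r • z) = r * rd z := by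
  unfold rd
  rw [nm_smul r hr, Real.mul_rpow (by positivity) (nm_nonneg _), ← Real.rpow_natCast, ← Real.rpow_mul hr,
    mul_one_div_cancel dg_ne, Real.rpow_one]

lemma rd_nonneg (z : MS I J) : 0 ≤ rd z := Real.rpow_nonneg (nm_nonneg _) _

lemma rd_pow (z : MS I J) : rd z ^ dg I J = nm z := by
  unfold rd
  rw [← Real.rpow_natCast, ← Real.rpow_mul (nm_nonneg _), one_div, inv_mul_cancel₀ dg_ne, Real.rpow_one]

lemma rd_one : rd (1 : MS I J) = 1 := by simp [rd, nm_one]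

/-- projection as a map to the hyperplane -/
noncomputable def prjE (z : MS I J) : HE I J := ⟨prj z, prj_mem z⟩

lemma prjE_cont : Continuous (prjE (I := I) (J := J)) := by
  unfold prjE prj
  apply Continuous.subtype_mk
  have := (tr (I := I) (J := J)).continuous
  fun_prop

lemma prjE_add_smul (z : MS I J) (s : ℝ) : prjE (z + s • 1) = prjE z := by
  apply Subtype.ext
  simp only [prjE, prj, map_add, map_smul, tr_one, smul_eq_mul]
  have := dg_ne (I := I) (J := J)
  rw [add_div, mul_div_assoc, div_self this, mul_one, add_smul]
  abel

lemma prjE_coe (y : HE I J) : prjE (y : MS I J) = y := by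
  apply Subtype.ext
  simp [prjE, prj, mem_HE.mp y.2]

/-- splitting of the mixed space -/
noncomputable def splitE (I J : Type*) [Fintype I] [Fintype J] [Nonempty (I ⊕ J)] :
    (HE I J × ℝ) ≃L[ℝ] MS I J :=
  LinearEquiv.toContinuousLinearEquiv
  { toFun := fun p => (p.1 : MS I J) + p.2 • 1
    invFun := fun z => (prjE z, tr z / dg I J)
    map_add' := fun p q => by simp [add_smul]; abel
    map_smul' := fun c p => by simp [smul_smul]
    left_inv := fun p => by
      have := dg_ne (I := I) (J := J)
      ext1
      · simp only [prjE_add_smul, prjE_coe]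
      · simp only [map_add, map_smul, tr_one, mem_HE.mp p.1.2, smul_eq_mul]
        field_simp; simp
    right_inv := fun z => by simp [prjE, prj] }

lemma splitE_apply (y : HE I J) (s : ℝ) : splitE I J (y, s) = (y : MS I J) + s • 1 := rfl

lemma splitE_symm (z : MS I J) : splitE I J (prjE z, tr z / dg I J) = z :=
  (splitE I J).right_inv z

open Classical in
/-- the homogeneous function -/
noncomputable def ff (a : HE I J → ℝ) (v : MS I J) : ℝ := if v ∈ US I J then a (prjE (mlog v)) else 0

lemma ff_smul (a : HE I J → ℝ) {r : ℝ} (hr : 0 < r) (v : MS I J) : ff a (r • v) = ff a v := by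
  have h : r • v ∈ US I J ↔ v ∈ US I J := by
    simp only [US, mem_ofPred_eq, Prod.smul_fst, Prod.smul_snd, Pi.smul_apply, smul_eq_mul,
      mul_pos_iff_of_pos_left hr, Complex.real_smul, Complex.mem_slitPlane_iff, Complex.re_ofReal_mul,
      Complex.im_ofReal_mul, ne_eq, mul_eq_zero, hr.ne', false_or]
  unfold ff
  by_cases hv : v ∈ US I J
  · rw [if_pos hv, if_pos (h.mpr hv)]
    have : mlog (r • v) = mlog v + (Real.log r) • 1 := by
      ext i
      · simp [mlog, Real.log_mul hr.ne' (hv.1 i).ne', add_comm]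
      · simp [mlog, Complex.log_ofReal_mul hr (Complex.slitPlane_ne_zero (hv.2 i)), add_comm]
    rw [this, prjE_add_smul]
  · rw [if_neg hv, if_neg (fun hh => hv (h.mp hh))]

lemma ff_mex (a : HE I J → ℝ) {z : MS I J} (hz : z ∈ OS I J) : ff a (mex z) = a (prjE z) := by
  rw [ff, if_pos (mex_mem hz), mlog_mex hz]

/-- test function -/
noncomputable def GG (a : HE I J → ℝ) (W : ℝ → ℝ) (v : MS I J) : ℝ := ff a v * W (rd v)

/-- the support -/
noncomputable def BB (I J : Type*) [Fintype I] [Fintype J] [Nonempty (I ⊕ J)] : Set (MS I J) :=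
  mex '' (splitE I J '' (closedBall 0 1 ×ˢ Icc (Real.log (1/2)) (Real.log (5/2))))

lemma BB_compact : IsCompact (BB I J) :=
  (((isCompact_closedBall _ _).prod isCompact_Icc).image (splitE I J).continuous).image mex_smooth.continuous

lemma OS_of_prj {z : MS I J} (hz : prjE z ∈ closedBall (0 : HE I J) 1) : z ∈ OS I J := by
  intro j
  have h1 : ‖(prjE z : MS I J)‖ ≤ 1 := by simpa using hz
  have h2 := (le_norm2 (prjE z : MS I J) j).trans h1
  have h3 := (Complex.abs_im_le_norm _).trans h2
  simp [prjE, prj] at h3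
  linarith [Real.pi_gt_three]

lemma BB_sub : BB I J ⊆ US I J := by
  rintro _ ⟨_, ⟨⟨y, s⟩, ⟨hy, hs⟩, rfl⟩, rfl⟩
  apply mex_mem
  apply OS_of_prj
  rw [splitE_apply, prjE_add_smul, prjE_coe]; exact hy

lemma GG_zero {a : HE I J → ℝ} {W : ℝ → ℝ} (ha : ∀ y, y ∉ closedBall (0 : HE I J) 1 → a y = 0)
    (hW : ∀ r, r ∉ Icc (1/2:ℝ) (5/2) → W r = 0) (v : MS I J) (hv : v ∉ BB I J) : GG a W v = 0 := by
  by_contra h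
  unfold GG at h
  have h1 := left_ne_zero_of_mul h
  have h2 := right_ne_zero_of_mul h
  apply hv
  have hU : v ∈ US I J := by
    by_contra hh; exact h1 (if_neg hh)
  rw [ff, if_pos hU] at h1
  have h3 : prjE (mlog v) ∈ closedBall (0 : HE I J) 1 := by
    by_contra hh; exact h1 (ha _ hh)
  have h4 : rd v ∈ Icc (1/2:ℝ) (5/2) := by
    by_contra hh; exact h2 (hW _ hh)
  refine ⟨mlog v, ⟨(prjE (mlog v), tr (mlog v) / dg I J), ⟨h3, ?_⟩, splitE_symm _⟩, mex_mlog hU⟩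
  rw [← mex_mlog hU, rd_mex] at h4
  exact ⟨(Real.log_le_iff_le_exp (by norm_num)).mpr h4.1, (Real.le_log_iff_exp_le (by norm_num)).mpr h4.2⟩

lemma GG_cont {a : HE I J → ℝ} {W : ℝ → ℝ} (ha : ∀ y, y ∉ closedBall (0 : HE I J) 1 → a y = 0)
    (hW : ∀ r, r ∉ Icc (1/2:ℝ) (5/2) → W r = 0) (hac : Continuous a) (hWc : Continuous W) :
    Continuous (GG a W) := by
  have h : Continuous (fun v => (GG a W v : ℂ)) := by
    refine continuous_of_continuousOn_supp (isOpen_US (I := I) (J := J)) BB_compact.isClosed BB_sub ?_ 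
      (fun y hy => by rw [GG_zero ha hW y hy]; simp)
    have : ContinuousOn (fun v : MS I J => ((a (prjE (mlog v)) * W (rd v) : ℝ) : ℂ)) (US I J) := by
      refine Complex.continuous_ofReal.comp_continuousOn ?_
      exact ((hac.comp prjE_cont).comp_continuousOn mlog_cont).mul (hWc.comp rd_continuous).continuousOn
    refine this.congr (fun v hv => ?_)
    simp [GG, ff, if_pos hv]
  have h2 := Complex.continuous_re.comp h
  simpa [Function.comp_def] using h2

lemma GG_supp {a : HE I J → ℝ} {W : ℝ → ℝ} (ha : ∀ y, y ∉ closedBall (0 : HE I J) 1 → a y = 0)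
    (hW : ∀ r, r ∉ Icc (1/2:ℝ) (5/2) → W r = 0) : HasCompactSupport (GG a W) :=
  HasCompactSupport.intro BB_compact (GG_zero ha hW)

end
end Landau

namespace Landau
set_option linter.unusedSectionVars false
open MeasureTheory Filter Topology Set Metric
open scoped ContDiff

section
variable {I J : Type*} [Fintype I] [Fintype J] [Nonempty (I ⊕ J)]

instance haarMS {I J : Type*} [Fintype I] [Fintype J] : (volume : Measure (MS I J)).IsAddHaarMeasure :=
  Measure.prod.instIsAddHaarMeasure volume volume

lemma int_mex {F : MS I J → ℂ} (hF : ∀ v, v ∉ US I J → F v = 0) :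
    ∫ v, F v = ∫ z in OS I J, (Real.exp (tr z) : ℂ) * F (mex z) := by
  have him : mex '' OS I J = US I J := by
    ext v; constructor
    · rintro ⟨z, hz, rfl⟩; exact mex_mem hz
    · intro hv; exact ⟨mlog v, mlog_mem hv, mex_mlog hv⟩
  rw [← setIntegral_eq_integral_of_forall_compl_eq_zero (s := US I J) hF, ← him,
    integral_image_eq_integral_abs_det_fderiv_smul volume isOpen_OS.measurableSet
      (fun z hz => (mex_deriv z).hasFDerivWithinAt)
      (fun z hz w hw h => by rw [← mlog_mex hz, ← mlog_mex hw, h])]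
  congr 1; ext z
  rw [det_mul, nm_mex]; simp

lemma int_split (μ : Measure (HE I J)) [μ.IsAddHaarMeasure] :
    ∃ c : ℝ, 0 < c ∧ ∀ H : MS I J → ℂ, ∫ z, H z = c * ∫ p : HE I J × ℝ, H (splitE I J p) ∂(μ.prod volume) := by
  have h0 : (μ.prod (volume : Measure ℝ)).IsAddHaarMeasure := Measure.prod.instIsAddHaarMeasure μ volume
  have h1 : (Measure.map (splitE I J) (μ.prod volume)).IsAddHaarMeasure :=
    (splitE I J).isAddHaarMeasure_map _
  have h2 := Measure.isAddLeftInvariant_eq_smul (volume : Measure (MS I J)) (Measure.map (splitE I J) (μ.prod volume))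
  refine ⟨Measure.addHaarScalarFactor (volume : Measure (MS I J)) (Measure.map (splitE I J) (μ.prod volume)),
    ?_, fun H => ?_⟩
  · exact_mod_cast Measure.addHaarScalarFactor_pos_of_isAddHaarMeasure _ _
  · conv_lhs => rw [h2]
    have he : MeasurableEmbedding (splitE I J) := (splitE I J).toHomeomorph.measurableEmbedding
    rw [integral_smul_nnreal_measure, he.integral_map]
    rfl

lemma int_exp {Φ : ℝ → ℂ} (n : ℕ) (h0 : ∀ r ≤ 0, Φ r = 0) :
    ∫ s : ℝ, (Real.exp s : ℂ) ^ (n + 1) * Φ (Real.exp s) = ∫ r : ℝ, (r:ℂ) ^ n * Φ r := by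
  rw [← setIntegral_eq_integral_of_forall_compl_eq_zero (s := Ioi (0:ℝ)) (f := fun r : ℝ => (r:ℂ) ^ n * Φ r)
    (fun r hr => by rw [h0 r (by simpa using hr), mul_zero])]
  have : Ioi (0:ℝ) = Real.exp '' univ := by simp [Real.range_exp]
  rw [this, integral_image_eq_integral_abs_deriv_smul MeasurableSet.univ
    (fun x _ => (Real.hasDerivAt_exp x).hasDerivWithinAt) Real.exp_injective.injOn]
  simp only [setIntegral_univ, Real.abs_exp, Complex.real_smul]
  congr 1; ext s; ring

theorem GG_hat (μ : Measure (HE I J)) [μ.IsAddHaarMeasure] : ∃ c : ℝ, 0 < c ∧ 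
    ∀ (a : HE I J → ℝ) (W : ℝ → ℝ), (∀ y, y ∉ closedBall (0 : HE I J) 1 → a y = 0) → 
    (∀ r, r ∉ Icc (1/2:ℝ) (5/2) → W r = 0) → Continuous a → Continuous W → ∀ ξ : MS I J,
    ∫ v, (GG a W v : ℂ) * ph 1 (tr (ξ * v)) = 
      c * ∫ r : ℝ, ((r ^ (dg I J - 1) * W r : ℝ) : ℂ) * ∫ y, a y * ph r (tr (ξ * mex (y : MS I J))) ∂μ := by
  obtain ⟨c, hc, h⟩ := int_split μ
  refine ⟨c, hc, fun a W ha hW hac hWc ξ => ?_⟩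
  have hn := dg_ne (I := I) (J := J)
  obtain ⟨n, hdg⟩ : ∃ n, dg I J = n + 1 := ⟨dg I J - 1, by have := dg_pos (I := I) (J := J); omega⟩
  have htr := (tr (I := I) (J := J)).continuous
  rw [int_mex (fun v hv => by rw [GG, ff, if_neg hv]; simp)]
  set H : MS I J → ℂ := fun z => (Real.exp (tr z) : ℂ) * ((a (prjE z) * W (Real.exp (tr z / dg I J)) : ℝ) * 
    ph 1 (tr (ξ * mex z))) with hH
  have e1 : ∫ z in OS I J, (Real.exp (tr z) : ℂ) * ((GG a W (mex z) : ℂ) * ph 1 (tr (ξ * mex z))) = 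
      ∫ z, H z := by
    rw [← setIntegral_eq_integral_of_forall_compl_eq_zero (s := OS I J) (f := H)]
    · refine setIntegral_congr_fun isOpen_OS.measurableSet (fun z hz => ?_)
      simp only [hH, GG, ff_mex a hz, rd_mex]
    · intro z hz
      have : a (prjE z) = 0 := ha _ (fun hh => hz (OS_of_prj hh))
      simp [hH, this]
  rw [e1, h H]
  congr 1
  have e2 : ∀ (y : HE I J) (s : ℝ), H (splitE I J (y, s)) = 
      (Real.exp s : ℂ) ^ (n + 1) * (W (Real.exp s) * (a y * ph (Real.exp s) (tr (ξ * mex (y : MS I J))))) := by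
    intro y s
    have t1 : tr (splitE I J (y, s)) = dg I J * s := by
      rw [splitE_apply, map_add, map_smul, tr_one, mem_HE.mp y.2]; simp [mul_comm]
    have t2 : mex (splitE I J (y, s)) = Real.exp s • mex (y : MS I J) := by
      rw [splitE_apply, mex_add, mul_comm]
      ext i <;> simp [mex]
    simp only [hH]
    rw [t1, t2, splitE_apply, prjE_add_smul, prjE_coe, mul_div_cancel_left₀ _ hn, mul_smul_comm, map_smul,
      ← Complex.ofReal_pow, ← Real.exp_nat_mul, ← hdg]
    have : ph 1 (Real.exp s • tr (ξ * mex (y : MS I J))) = ph (Real.exp s) (tr (ξ * mex (y : MS I J))) := by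
      unfold ph; congr 3; simp; ring
    rw [this]; push_cast; ring
  have hHc : Continuous H := by
    have h1 := prjE_cont (I := I) (J := J)
    have h2 := (mex_smooth (I := I) (J := J)).continuous
    have h3 : Continuous (fun z : MS I J => ph 1 (tr (ξ * mex z))) := 
      continuous_ph continuous_const (htr.comp (by fun_prop))
    simp only [hH]
    fun_prop
  have hIntg : Integrable (fun p => H (splitE I J p)) (μ.prod volume) := by
    apply (hHc.comp (splitE I J).continuous).integrable_of_hasCompactSupport
    refine HasCompactSupport.intro ((isCompact_closedBall (0 : HE I J) 1).prod 
      (isCompact_Icc (a := Real.log (1/2)) (b := Real.log (5/2)))) ?_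
    rintro ⟨y, s⟩ hp
    simp only [Function.comp_apply]
    rw [e2]
    by_cases hy : y ∈ closedBall (0 : HE I J) 1
    · have hs : Real.exp s ∉ Icc (1/2:ℝ) (5/2) := fun hh => hp ⟨hy, 
        (Real.log_le_iff_le_exp (by norm_num)).mpr hh.1, (Real.le_log_iff_exp_le (by norm_num)).mpr hh.2⟩
      rw [hW _ hs]; simp
    · rw [ha _ hy]; simp
  rw [integral_prod_symm _ hIntg]
  simp only [e2]
  simp only [MeasureTheory.integral_const_mul]
  rw [int_exp (Φ := fun r => W r * ∫ y, a y * ph r (tr (ξ * mex (y : MS I J))) ∂μ) n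
    (fun r hr => by rw [hW r (fun hh => by linarith [hh.1])]; simp)]
  rw [hdg, Nat.add_sub_cancel]
  congr 1; ext r; push_cast; ring

end
end Landau

namespace Landau
set_option linter.unusedSectionVars false
open MeasureTheory Filter Topology Set Metric
open scoped ContDiff

section
variable (I J : Type*) [Fintype I] [Fintype J] [Nonempty (I ⊕ J)]

lemma ph_zero (r : ℝ) : ph r 0 = 1 := by simp [ph]

theorem test_function (h2 : 2 ≤ dg I J) : ∃ (a : HE I J → ℝ) (C0 m0 : ℝ), Continuous a ∧ (∀ y, 0 ≤ a y) ∧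
    0 < a 0 ∧ (∀ y, y ∉ closedBall (0 : HE I J) 1 → a y = 0) ∧ 0 ≤ C0 ∧
    ∀ δ α β : ℝ, 0 < δ → δ ≤ 1/2 → 1 - δ ≤ α → α ≤ 1 → 2 ≤ β → β ≤ 2 + δ →
      |(∫ v, GG a (cut α β δ) v) - m0| ≤ C0 * δ ∧
      ∀ ξ : MS I J, ξ ≠ 0 → ‖∫ v, (GG a (cut α β δ) v : ℂ) * ph 1 (tr (ξ * v))‖ ≤
        C0 * ((‖ξ‖ ^ (dg I J + 1))⁻¹ + (√‖ξ‖ ^ (dg I J + 1))⁻¹ * min 1 ((δ * ‖ξ‖) ^ dg I J)⁻¹) := by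
  have hfr := finrank_HE (I := I) (J := J)
  set N := Module.finrank ℝ (HE I J) with hN
  have hnt : Nontrivial (HE I J) := Module.nontrivial_of_finrank_pos (R := ℝ) (by omega)
  let μ : Measure (HE I J) := Measure.addHaar
  obtain ⟨ρ, hρ, hmain⟩ := (trD I J).ghat μ
  let ρ' := min ρ 1
  have hρ' : 0 < ρ' := lt_min hρ one_pos
  let b : ContDiffBump (0 : HE I J) := ⟨ρ' / 2, ρ', by positivity, by linarith⟩
  have hb0 : ∀ r, ρ' ≤ r → ∀ y, y ∉ closedBall (0 : HE I J) r → b y = 0 := fun r hr y hy => by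
    apply b.zero_of_le_dist
    simp only [mem_closedBall, not_le] at hy
    exact hr.trans hy.le
  obtain ⟨C, hC, hC2⟩ := hmain b b.contDiff (hb0 ρ (min_le_left _ _))
  obtain ⟨c, hc, hhat⟩ := GG_hat μ (I := I) (J := J)
  obtain ⟨K1, hK1, hr1⟩ := rad_bounds N (N + 2)
  obtain ⟨K2, hK2, hr2⟩ := rad_integral N
  have hb1 := hb0 1 (min_le_right _ _)
  have hA : 0 ≤ ∫ y, b y ∂μ := integral_nonneg fun y => b.nonneg
  have hcut0 : ∀ δ α β : ℝ, 0 < δ → 1/2 ≤ α → β ≤ 5/2 → ∀ r, r ∉ Icc (1/2:ℝ) (5/2) → cut α β δ r = 0 := by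
    intro δ α β hδ hα hβ r hr
    exact cut_zero hδ (fun h => hr ⟨hα.trans h.1, h.2.trans hβ⟩)
  refine ⟨b, c * (∫ y, b y ∂μ) * K2 + c * (C * K1), c * ((∫ y, b y ∂μ) * ((2 ^ (N + 1) - 1) / (N + 1))), 
    b.continuous, fun y => b.nonneg, ?_, hb1, by positivity, ?_⟩
  · have := b.one_of_mem_closedBall (x := 0) (by simp [b]; positivity)
    rw [this]; norm_num
  intro δ α β hδ hδ2 hα hα1 hβ hβ1
  have hα' : 1/2 ≤ α := by linarith
  have hβ' : β ≤ 5/2 := by linarith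
  have hh := hhat b (cut α β δ) hb1 (hcut0 δ α β hδ hα' hβ') b.continuous (cut_smooth α β δ).continuous
  have hdg1 : dg I J - 1 = N := by omega
  have hrad : ∀ r : ℝ, ((r ^ (dg I J - 1) * cut α β δ r : ℝ) : ℂ) = (rad N α β δ r : ℝ) := by
    intro r; rw [hdg1]; rfl
  simp only [hrad] at hh
  constructor
  · have h0 := hh 0
    simp only [zero_mul, map_zero, ph_zero, mul_one] at h0
    rw [MeasureTheory.integral_mul_const, integral_complex_ofReal, integral_complex_ofReal,
      integral_complex_ofReal] at h0
    have h0' : ∫ v, GG b (cut α β δ) v = c * ((∫ r, rad N α β δ r) * ∫ y, b y ∂μ) := by exact_mod_cast h0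
    have h3 := hr2 δ α β hδ hδ2 hα hα1 hβ hβ1
    rw [h0', show c * ((∫ r, rad N α β δ r) * ∫ y, b y ∂μ) - c * ((∫ y, b y ∂μ) * ((2 ^ (N + 1) - 1) / (N + 1))) = 
      c * (∫ y, b y ∂μ) * ((∫ r, rad N α β δ r) - (2 ^ (N + 1) - 1) / (N + 1)) by ring, abs_mul, 
      abs_of_nonneg (by positivity)]
    calc _ ≤ c * (∫ y, b y ∂μ) * (K2 * δ) := by gcongr
      _ ≤ _ := by
        have : 0 ≤ c * (C * K1) * δ := by positivity
        nlinarith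
  · intro ξ hξ
    obtain ⟨q1, q2⟩ := hr1 δ α β hδ hδ2 hα' hα1 hβ hβ'
    have hg := hC2 δ K1 (fun r => ((rad N α β δ r : ℝ) : ℂ)) hδ
      (Complex.ofRealCLM.contDiff.comp (rad_smooth N α β δ))
      (fun r hr => by unfold rad; rw [hcut0 δ α β hδ hα' hβ' r hr]; simp) q1 
      (by simpa using q2 1 (by omega) le_rfl)
      (by have := q2 (N + 2) le_rfl (by omega)
          rw [inv_pow] at this; exact this) ξ hξ
    rw [hh ξ, norm_mul, Complex.norm_real, Real.norm_of_nonneg hc.le]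
    change ‖∫ r, _ * ∫ y, b y * ph r (tr (ξ * mex (y : MS I J))) ∂μ‖ ≤ _ at hg
    rw [← hfr]
    refine (mul_le_mul_of_nonneg_left hg hc.le).trans ?_
    rw [← mul_assoc]
    refine mul_le_mul_of_nonneg_right ?_ (by positivity)
    have : 0 ≤ c * (∫ y, b y ∂μ) * K2 := by positivity
    linarith

end
end Landau

namespace Landau
set_option linter.unusedSectionVars false
open MeasureTheory Filter Topology Set Metric
open scoped ContDiff

section
variable {d : Type*} [Fintype d]

/-- integer vectors as real vectors -/
def zc (k : d → ℤ) : d → ℝ := fun i => (k i : ℝ)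

lemma zc_add (k l : d → ℤ) : zc (k + l) = zc k + zc l := by ext i; simp [zc]

lemma zc_norm_le {k : d → ℤ} {n : ℕ} (h : ‖zc k‖ ≤ n) [DecidableEq d] : 
    k ∈ Fintype.piFinset (fun _ : d => Finset.Icc (-(n:ℤ)) n) := by
  rw [Fintype.mem_piFinset]
  intro i
  have := (norm_le_pi_norm (zc k) i).trans h
  rw [Real.norm_eq_abs, zc, abs_le] at this
  rw [Finset.mem_Icc]
  exact ⟨by exact_mod_cast this.1, by exact_mod_cast this.2⟩

/-- half open cube -/
def cube (d : Type*) : Set (d → ℝ) := {x : d → ℝ | ∀ i, x i ∈ Ioc ((0 : d → ℝ) i) ((0 : d → ℝ) i + 1)}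

lemma cube_meas : MeasurableSet (cube d) := MeasurableSet.univ_pi' (fun i => measurableSet_Ioc)

lemma cube_norm {x : d → ℝ} (hx : x ∈ cube d) : ‖x‖ ≤ 1 := by
  rw [pi_norm_le_iff_of_nonneg (by norm_num)]
  intro i
  have := hx i
  simp only [Pi.zero_apply, zero_add] at this
  rw [Real.norm_eq_abs, abs_le]; exact ⟨by linarith [this.1], this.2⟩

/-- translated cube -/
def cubek (k : d → ℤ) : Set (d → ℝ) := {x | x - zc k ∈ cube d}

lemma cubek_iff {k : d → ℤ} {x : d → ℝ} : x ∈ cubek k ↔ ∀ i, k i = ⌈x i⌉ - 1 := by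
  simp only [cubek, cube, mem_ofPred_eq, Pi.sub_apply, Pi.zero_apply, zc, mem_Ioc]
  refine forall_congr' fun i => ?_
  rw [eq_sub_iff_add_eq, eq_comm, Int.ceil_eq_iff]
  push_cast
  constructor
  · rintro ⟨h1, h2⟩; constructor <;> linarith
  · rintro ⟨h1, h2⟩; constructor <;> linarith

lemma cubek_union : ⋃ k : d → ℤ, cubek k = univ := by
  rw [eq_univ_iff_forall]
  intro x
  exact mem_iUnion.mpr ⟨fun i => ⌈x i⌉ - 1, cubek_iff.mpr fun i => rfl⟩

lemma cubek_disj : Pairwise (Function.onFun Disjoint (cubek (d := d))) := by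
  intro k l hkl
  rw [Function.onFun, Set.disjoint_left]
  intro x hk hl
  apply hkl
  ext i
  rw [cubek_iff.mp hk i, cubek_iff.mp hl i]

lemma cubek_meas (k : d → ℤ) : MeasurableSet (cubek k) := cube_meas.preimage (by fun_prop)

variable {F : (d → ℝ) → ℂ} 

lemma exists_supp_bound (hs : HasCompactSupport F) : ∃ M : ℕ, ∀ t, (M:ℝ) < ‖t‖ → F t = 0 := by
  obtain ⟨M, hM⟩ := hs.isCompact.isBounded.exists_norm_le
  obtain ⟨n, hn⟩ := exists_nat_ge M
  refine ⟨n, fun t ht => ?_⟩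
  by_contra h
  have := hM t (subset_tsupport _ h)
  linarith

lemma unfold_int (hF : Continuous F) (hs : HasCompactSupport F) :
    ∫ t, F t = ∫ t in cube d, ∑' k : d → ℤ, F (t + zc k) := by
  classical
  obtain ⟨M, hM⟩ := exists_supp_bound hs
  have hIntg : Integrable F := hF.integrable_of_hasCompactSupport hs
  set S := Fintype.piFinset (fun _ : d => Finset.Icc (-((M + 1 : ℕ):ℤ)) (M + 1 : ℕ))
  have hS : ∀ k ∉ S, ∀ t ∈ cube d, F (t + zc k) = 0 := by
    intro k hk t ht
    apply hM
    by_contra h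
    apply hk
    apply zc_norm_le
    have h1 := norm_sub_norm_le (zc k) (-t)
    rw [norm_neg, sub_neg_eq_add, add_comm (zc k)] at h1
    have h2 := cube_norm ht
    push_cast; push Not at h; linarith
  have e1 : ∀ k, ∫ t in cubek k, F t = ∫ t in cube d, F (t + zc k) := by
    intro k
    rw [← integral_indicator (cubek_meas k), ← integral_indicator cube_meas,
      ← integral_add_right_eq_self _ (zc k)]
    congr 1; ext t
    simp only [indicator, cubek, mem_ofPred_eq, add_sub_cancel_right]
  rw [← setIntegral_univ, ← cubek_union, integral_iUnion cubek_meas cubek_disj hIntg.integrableOn]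
  simp only [e1]
  rw [tsum_eq_sum (s := S) (fun k hk => by
    rw [setIntegral_congr_fun cube_meas (fun t ht => hS k hk t ht)]; simp)]
  rw [setIntegral_congr_fun cube_meas (fun t ht => tsum_eq_sum (s := S) (fun k hk => hS k hk t ht))]
  rw [integral_finsetSum]
  intro k _
  exact (hIntg.comp_add_right (zc k)).integrableOn

/-- periodization -/
noncomputable def per (F : (d → ℝ) → ℂ) (t : d → ℝ) : ℂ := ∑' k : d → ℤ, F (t + zc k)

lemma per_periodic (t : d → ℝ) (k : d → ℤ) : per F (t + zc k) = per F t := by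
  unfold per
  rw [← (Equiv.addLeft k).tsum_eq (fun l => F (t + zc l))]
  congr 1; ext l
  simp [zc_add, add_assoc]

lemma per_cont (hF : Continuous F) (hs : HasCompactSupport F) : Continuous (per F) := by
  classical
  obtain ⟨M, hM⟩ := exists_supp_bound hs
  rw [continuous_iff_continuousAt]
  intro t0
  obtain ⟨n, hn⟩ := exists_nat_ge (‖t0‖ + 1)
  have : per F =ᶠ[𝓝 t0] fun t => ∑ k ∈ Fintype.piFinset (fun _ : d => Finset.Icc (-((M + n : ℕ):ℤ)) (M + n : ℕ)),
      F (t + zc k) := by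
    filter_upwards [ball_mem_nhds t0 one_pos] with t ht
    unfold per
    apply tsum_eq_sum
    intro k hk
    apply hM
    by_contra h
    apply hk
    apply zc_norm_le
    have h1 := norm_sub_norm_le (zc k) (-t)
    rw [norm_neg, sub_neg_eq_add, add_comm (zc k)] at h1
    have h2 : ‖t‖ ≤ ‖t0‖ + 1 := by
      have h3 := norm_sub_norm_le t t0
      rw [mem_ball, dist_eq_norm] at ht
      linarith
    push_cast; push Not at h; linarith
  refine ContinuousAt.congr ?_ this.symm
  fun_prop

/-- quotient map to the torus -/
def qt (t : d → ℝ) : UnitAddTorus d := fun i => (t i : UnitAddCircle)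

lemma qt_quot : IsOpenQuotientMap (qt (d := d)) := by
  refine ⟨?_, ?_, ?_⟩
  · intro x
    choose f hf using fun i => QuotientAddGroup.mk_surjective (x i)
    exact ⟨f, funext hf⟩
  · unfold qt
    exact continuous_pi fun i => (AddCircle.continuous_mk' (1:ℝ)).comp (continuous_apply i)
  · exact IsOpenMap.piMap (fun i => QuotientAddGroup.isOpenMap_coe) (by
      exact Filter.Eventually.of_forall (fun i => QuotientAddGroup.mk_surjective))

lemma mF_eval (n : d → ℤ) (t : d → ℝ) : UnitAddTorus.mFourier (-n) (qt t) = ph 1 (∑ i, n i * t i) := by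
  show ∏ i, fourier ((-n) i) ((t i : UnitAddCircle)) = _
  simp only [fourier_coe_apply]
  rw [← Complex.exp_sum, ph]
  congr 1
  push_cast
  rw [Finset.mul_sum, Finset.mul_sum]
  apply Finset.sum_congr rfl
  intro i _
  simp; ring

theorem poisson (hF : Continuous F) (hs : HasCompactSupport F)
    (hsum : Summable (fun n : d → ℤ => ∫ t, ph 1 (∑ i, n i * t i) * F t)) :
    HasSum (fun n : d → ℤ => ∫ t, ph 1 (∑ i, n i * t i) * F t) (∑' k : d → ℤ, F (zc k)) := by
  have hq := qt_quot (d := d)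
  let g : UnitAddTorus d → ℂ := fun x => per F (Function.surjInv hq.surjective x)
  have hg : ∀ t, g (qt t) = per F t := by
    intro t
    have h1 : qt (Function.surjInv hq.surjective (qt t)) = qt t := Function.surjInv_eq _ _
    set s := Function.surjInv hq.surjective (qt t) with hsd
    have h2 : ∀ i, ∃ m : ℤ, s i = t i + m := by
      intro i
      have h3 := congrFun h1 i
      have h3' : ((s i : ℝ) : UnitAddCircle) = ((t i : ℝ) : UnitAddCircle) := h3
      rw [← sub_eq_zero, ← AddCircle.coe_sub, AddCircle.coe_eq_zero_iff] at h3'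
      obtain ⟨m, hm⟩ := h3'
      refine ⟨m, ?_⟩
      rw [zsmul_eq_mul, mul_one] at hm
      linarith
    choose m hm using h2
    have : s = t + zc m := by ext i; exact hm i
    show per F s = _
    rw [this, per_periodic]
  have hgc : Continuous g := by
    rw [hq.isQuotientMap.continuous_iff]
    have : g ∘ qt = per F := funext hg
    rw [this]; exact per_cont hF hs
  have hco : ∀ n, UnitAddTorus.mFourierCoeff g n = ∫ t, ph 1 (∑ i, n i * t i) * F t := by
    intro n
    rw [UnitAddTorus.mFourierCoeff_eq_integral g n 0]
    have hc : Continuous (fun t : d → ℝ => ph 1 (∑ i, n i * t i) * F t) :=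
      (continuous_ph continuous_const (by fun_prop)).mul hF
    rw [unfold_int hc hs.mul_left]
    refine setIntegral_congr_fun cube_meas (fun t ht => ?_)
    show UnitAddTorus.mFourier (-n) (qt t) • g (qt t) = _
    rw [hg, per, smul_eq_mul, ← tsum_mul_left]
    congr 1; ext k
    rw [← mF_eval]
    have : qt (t + zc k) = qt t := by
      ext i
      show ((t i + zc k i : ℝ) : UnitAddCircle) = ((t i : ℝ) : UnitAddCircle)
      rw [← sub_eq_zero, ← AddCircle.coe_sub, AddCircle.coe_eq_zero_iff]
      exact ⟨k i, by simp [zc]⟩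
    rw [this]
  have := UnitAddTorus.hasSum_mFourier_series_apply_of_summable (f := ⟨g, hgc⟩) (by
    convert hsum using 1; ext n; exact hco n) (qt 0)
  convert! this using 1
  · ext n
    have h2 := hco n
    have h1 : UnitAddTorus.mFourier n (qt 0) = 1 := by
      have := mF_eval (-n) 0
      rw [neg_neg] at this; rw [this]; simp [ph]
    rw [h1, smul_eq_mul, mul_one]; exact h2.symm
  · show _ = g (qt 0)
    rw [hg, per]; simp
end
end Landau

namespace Landau
set_option linter.unusedSectionVars false
open MeasureTheory Filter Topology Set Metric
open scoped ContDiff ENNReal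

/-- decay profile -/
noncomputable def bd (n : ℕ) (δ s : ℝ) : ℝ := (s ^ (n + 1))⁻¹ + (√s ^ (n + 1))⁻¹ * min 1 ((δ * s) ^ n)⁻¹

lemma bd_anti {n : ℕ} {δ s t : ℝ} (hδ : 0 < δ) (hs : 0 < s) (hst : s ≤ t) : bd n δ t ≤ bd n δ s := by
  unfold bd
  have := Real.sqrt_pos.2 hs
  have h1 : 0 < t := hs.trans_le hst
  gcongr

lemma bd_nonneg {n : ℕ} {δ s : ℝ} (hδ : 0 < δ) (hs : 0 ≤ s) : 0 ≤ bd n δ s := by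
  unfold bd
  positivity

section
variable {d : Type*} [Fintype d]

/-- sup norm as a natural number -/
def nn (m : d → ℤ) : ℕ := Finset.univ.sup fun i => (m i).natAbs

lemma nn_le {m : d → ℤ} {k : ℕ} : nn m ≤ k ↔ ∀ i, |m i| ≤ k := by
  unfold nn
  rw [Finset.sup_le_iff]
  simp only [Finset.mem_univ, true_implies]
  refine forall_congr' fun i => ?_
  rw [Int.abs_eq_natAbs]
  omega

lemma nn_norm (m : d → ℤ) : ‖zc m‖ = nn m := by
  apply le_antisymm
  · rw [pi_norm_le_iff_of_nonneg (by positivity)]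
    intro i
    have := nn_le.1 (le_refl (nn m)) i
    rw [Real.norm_eq_abs, zc]
    exact_mod_cast this
  · have : nn m ≤ ⌊‖zc m‖⌋₊ := by
      rw [nn_le]
      intro i
      have h := norm_le_pi_norm (zc m) i
      rw [Real.norm_eq_abs, zc] at h
      have h1 : |m i| = ((m i).natAbs : ℤ) := Int.abs_eq_natAbs _
      rw [h1]
      have h2 : ((m i).natAbs : ℝ) ≤ ‖zc m‖ := by
        rw [Nat.cast_natAbs]; push_cast; exact h
      exact_mod_cast Nat.le_floor h2
    calc (nn m : ℝ) ≤ ⌊‖zc m‖⌋₊ := by exact_mod_cast this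
      _ ≤ _ := Nat.floor_le (norm_nonneg _)

lemma nn_zero {m : d → ℤ} (h : nn m = 0) : m = 0 := by
  have := nn_le.1 h.le
  ext i
  have := this i
  simpa using this

lemma pow_diff (a b : ℕ) (hab : b ≤ a) (n : ℕ) : a ^ (n+1) ≤ b ^ (n+1) + (n + 1) * (a - b) * a ^ n := by
  obtain ⟨c, rfl⟩ := Nat.exists_eq_add_of_le hab
  rw [Nat.add_sub_cancel_left]
  induction n with
  | zero => simp
  | succ n ih =>
    have h1 : b * b ^ (n+1) ≤ b ^ (n+2) := by rw [pow_succ' b (n+1)]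
    have h2 : b ^ (n+1) ≤ (b+c)^(n+1) := Nat.pow_le_pow_left (by omega) _
    calc (b+c)^(n+1+1) = b * (b+c)^(n+1) + c * (b+c)^(n+1) := by ring
      _ ≤ b * (b ^ (n + 1) + (n + 1) * c * (b + c) ^ n) + c * (b+c)^(n+1) := by gcongr
      _ ≤ b ^ (n+1+1) + (n+1) * c * ((b+c) * (b+c)^n) + c * (b+c)^(n+1) := by
        have : b * (b+c)^n ≤ (b+c) * (b+c)^n := Nat.mul_le_mul_right _ (by omega)
        nlinarith [Nat.mul_le_mul_left ((n+1)*c) this]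
      _ = _ := by ring

lemma shell (k : ℕ) (n : ℕ) (hn : Fintype.card d = n + 1) :
    ({m : d → ℤ | nn m = k + 1}).encard ≤ (((n + 1) * 2 * 3 ^ n * (k+1) ^ n : ℕ) : ℕ∞) := by
  classical
  let P := fun j : ℕ => Fintype.piFinset (fun _ : d => Finset.Icc (-(j:ℤ)) j)
  have hP : ∀ j m, m ∈ P j ↔ nn m ≤ j := by
    intro j m
    rw [nn_le, Fintype.mem_piFinset]
    simp only [Finset.mem_Icc, abs_le]
  have hc : ∀ j, (P j).card = (2 * j + 1) ^ (n + 1) := by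
    intro j
    show (Fintype.piFinset (fun _ : d => Finset.Icc (-(j:ℤ)) j)).card = _
    rw [Fintype.card_piFinset]
    simp [hn]
    omega
  have : {m : d → ℤ | nn m = k + 1} = ((P (k+1) \ P k : Finset (d → ℤ)) : Set (d → ℤ)) := by
    ext m
    rw [Finset.mem_coe, Finset.mem_sdiff, hP, hP, mem_ofPred_eq]
    omega
  rw [this, Set.encard_coe_eq_coe_finsetCard]
  norm_cast
  have hsub : P k ⊆ P (k+1) := fun m => by rw [hP, hP]; omega
  rw [Finset.card_sdiff_of_subset hsub, hc, hc]
  have h1 := pow_diff (2 * (k+1) + 1) (2*k+1) (by omega) n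
  have h2 : (2 * (k+1) + 1)^n ≤ 3 ^ n * (k+1)^n := by
    rw [← mul_pow]; exact Nat.pow_le_pow_left (by omega) _
  have h3 : 2 * (k+1) + 1 - (2*k+1) = 2 := by omega
  rw [h3] at h1
  have h4 := Nat.mul_le_mul_left ((n+1)*2) h2
  rw [← mul_assoc] at h4
  omega

lemma shell_sum (n : ℕ) (hn : Fintype.card d = n + 1) (φ : ℕ → ℝ≥0∞) :
    ∑' m : d → ℤ, (if m = 0 then 0 else φ (nn m)) ≤
      ∑' k : ℕ, (((n + 1) * 2 * 3 ^ n * (k+1) ^ n : ℕ) : ℝ≥0∞) * φ (k+1) := by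
  classical
  rw [← (Equiv.sigmaFiberEquiv (nn (d := d))).tsum_eq, ENNReal.tsum_sigma']
  rw [tsum_eq_zero_add' ENNReal.summable]
  have h0 : (∑' b : { x : d → ℤ // nn x = 0 }, if (Equiv.sigmaFiberEquiv nn) ⟨0, b⟩ = 0 then 0
      else φ (nn ((Equiv.sigmaFiberEquiv nn) ⟨0, b⟩))) = 0 := by
    rw [ENNReal.tsum_eq_zero]
    intro b
    rw [if_pos]
    exact nn_zero b.2
  rw [h0, zero_add]
  refine ENNReal.tsum_le_tsum fun k => ?_
  calc _ ≤ ∑' b : { x : d → ℤ // nn x = k + 1 }, φ (k+1) := by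
        refine ENNReal.tsum_le_tsum fun b => ?_
        split_ifs
        · simp
        · show φ (nn b.1) ≤ _
          rw [b.2]
    _ ≤ _ := by
        rw [ENNReal.tsum_const]
        gcongr
        have := shell (d := d) k n hn
        have h2 : ENat.card { x : d → ℤ // nn x = k + 1 } ≤ (((n + 1) * 2 * 3 ^ n * (k+1) ^ n : ℕ) : ℕ∞) := this
        exact_mod_cast (ENat.toENNReal_le.2 h2)

lemma term1 {R : ℝ} (hR : 0 < R) (n k : ℕ) : R ^ (n+1) * (k+1:ℝ)^n * ((R * (k+1:ℝ))^(n+2))⁻¹ ≤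
    2 * R⁻¹ * ((1 - 1/((k+1:ℕ)+1:ℝ)) - (1 - 1/((k:ℕ)+1:ℝ))) := by
  have hk : (0:ℝ) < k + 1 := by positivity
  have e1 : R ^ (n+1) * (k+1:ℝ)^n * ((R * (k+1:ℝ))^(n+2))⁻¹ = R⁻¹ * ((k+1:ℝ)^2)⁻¹ := by
    rw [mul_pow]
    field_simp
    ring
  have e2 : ((1 - 1/((k+1:ℕ)+1:ℝ)) - (1 - 1/((k:ℕ)+1:ℝ))) = ((k+1:ℝ) * (k+2))⁻¹ := by
    push_cast
    field_simp
    ring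
  rw [e1, e2, mul_comm 2, mul_assoc]
  gcongr
  rw [inv_eq_one_div, inv_eq_one_div, mul_one_div, div_le_div_iff₀ (by positivity) (by positivity)]
  nlinarith

lemma term_aux {s : ℝ} (hs : 0 < s) {n : ℕ} (hn : 1 ≤ n) :
    s^n/s^2 * min 1 ((s^2)^(n+1))⁻¹ ≤ 4/(s*(1+s)^2) := by
  rcases le_total s 1 with h | h
  · calc _ ≤ s^n/s^2 * 1 := by gcongr; exact min_le_left _ _
      _ ≤ s^1/s^2 := by rw [mul_one]; gcongr 1; exact pow_le_pow_of_le_one hs.le h hn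
      _ ≤ _ := by
        rw [div_le_div_iff₀ (by positivity) (by positivity)]
        have : (1+s)^2 ≤ 4 := by nlinarith
        nlinarith [mul_le_mul_of_nonneg_left this (sq_nonneg s)]
  · calc _ ≤ s^n/s^2 * ((s^2)^(n+1))⁻¹ := by gcongr; exact min_le_right _ _
      _ = 1/(s^3 * s^(n+1)) := by
        field_simp
        ring
      _ ≤ 1/(s^3 * 1) := by
        gcongr
        exact one_le_pow₀ h
      _ ≤ _ := by
        rw [div_le_div_iff₀ (by positivity) (by positivity)]
        have : (1+s)^2 ≤ 4*s^2 := by nlinarith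
        nlinarith [mul_le_mul_of_nonneg_left this hs.le]

/-- bounded increasing function -/
noncomputable def gs (δ R : ℝ) (k : ℕ) : ℝ := √(δ * R * k) / (1 + √(δ * R * k))

lemma term2 {R δ : ℝ} (hR : 0 < R) (hδ : 0 < δ) {n : ℕ} (hn : 1 ≤ n) (k : ℕ) :
    R ^ (n+1) * (k+1:ℝ)^n * ((√(R * (k+1:ℝ))^(n+2))⁻¹ * min 1 ((δ * (R * (k+1:ℝ)))^(n+1))⁻¹) ≤
    8 * (√δ^n)⁻¹ * (gs δ R (k+1) - gs δ R k) := by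
  have hk : (0:ℝ) < k + 1 := by positivity
  unfold gs
  push_cast
  set s := √(δ * R * (k+1)) with hs
  set a := √(δ * R * k) with ha
  set D := √δ with hD
  have hD0 : 0 < D := Real.sqrt_pos.2 hδ
  have hs0 : 0 < s := Real.sqrt_pos.2 (by positivity)
  have ha0 : 0 ≤ a := Real.sqrt_nonneg _
  have hs2 : s^2 = δ * R * (k+1) := Real.sq_sqrt (by positivity)
  have ha2 : a^2 = δ * R * k := Real.sq_sqrt (by positivity)
  have hD2 : D^2 = δ := Real.sq_sqrt hδ.le
  have has : a ≤ s := Real.sqrt_le_sqrt (by gcongr; linarith)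
  have e1 : √(R * (k+1:ℝ)) = s / D := by
    rw [eq_div_iff hD0.ne', hs, hD, ← Real.sqrt_mul (by positivity)]
    congr 1; ring
  have e2 : δ * (R * (k+1:ℝ)) = s^2 := by rw [hs2]; ring
  have e3 : R ^ (n+1) * (k+1:ℝ)^n = R * (s^2/D^2)^n := by
    rw [pow_succ' R, mul_assoc, ← mul_pow]
    congr 2
    rw [hs2, hD2]; field_simp
  rw [e1, e2, e3]
  have e4 : R * (s^2/D^2)^n * (((s/D)^(n+2))⁻¹ * min 1 ((s^2)^(n+1))⁻¹) =
      R * D^2 * (D^n)⁻¹ * (s^n/s^2 * min 1 ((s^2)^(n+1))⁻¹) := by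
    rw [← mul_assoc, ← mul_assoc]
    congr 1
    rw [div_pow, div_pow]
    field_simp
    ring
  rw [e4]
  have e5 : s / (1+s) - a/(1+a) = (s-a)/((1+s)*(1+a)) := by
    field_simp; ring
  rw [e5]
  have h6 : (s-a)/((1+s)^2) ≤ (s-a)/((1+s)*(1+a)) := by
    have : 0 ≤ s - a := by linarith
    gcongr
    nlinarith
  have h7 : R * D^2 * (4/(s*(1+s)^2)) ≤ 8 * ((s-a)/((1+s)^2)) := by
    have : R * D^2 ≤ 2 * s * (s - a) := by rw [hD2]; nlinarith
    rw [← mul_div_assoc, ← mul_div_assoc, div_le_div_iff₀ (by positivity) (by positivity)]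
    have h8 : 0 ≤ (1+s)^2 := by positivity
    nlinarith [mul_le_mul_of_nonneg_right this h8]
  calc _ ≤ R * D^2 * (D^n)⁻¹ * (4/(s*(1+s)^2)) := by
        gcongr; exact term_aux hs0 hn
    _ = (D^n)⁻¹ * (R * D^2 * (4/(s*(1+s)^2))) := by ring
    _ ≤ (D^n)⁻¹ * (8 * ((s-a)/((1+s)*(1+a)))) := by
        exact mul_le_mul_of_nonneg_left (h7.trans (by gcongr)) (by positivity)
    _ = _ := by ring

theorem lat_bound (n : ℕ) (hd : Fintype.card d = n + 1) (hn : 1 ≤ n) : ∃ C : ℝ, 0 ≤ C ∧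
    ∀ δ R : ℝ, 0 < δ → 0 < R → ∀ f : (d → ℤ) → ℂ,
    (∀ m, m ≠ 0 → ‖f m‖ ≤ R^(n+1) * bd (n+1) δ (R * ‖zc m‖)) →
    Summable f ∧ ‖∑' m, f m - f 0‖ ≤ C * (R⁻¹ + (√δ^n)⁻¹) := by
  classical
  set c : ℕ := (n + 1) * 2 * 3 ^ n with hc
  refine ⟨8 * c, by positivity, ?_⟩
  intro δ R hδ hR f hf
  set S : ℝ := 8 * c * (R⁻¹ + (√δ^n)⁻¹) with hS
  have hS0 : 0 ≤ S := by positivity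
  let f0 : (d → ℤ) → ℂ := fun m => if m = 0 then 0 else f m
  have h1 : ∑' m, ENNReal.ofReal ‖f0 m‖ ≤ ENNReal.ofReal S := by
    let H : ℕ → ℝ := fun k => 2 * R⁻¹ * (1 - 1/((k:ℕ)+1:ℝ)) + 8 * (√δ^n)⁻¹ * gs δ R k
    calc _ ≤ ∑' m : d → ℤ, (if m = 0 then 0 else ENNReal.ofReal (R^(n+1) * bd (n+1) δ (R * (nn m : ℝ)))) := by
          refine ENNReal.tsum_le_tsum fun m => ?_
          show ENNReal.ofReal ‖if m = 0 then 0 else f m‖ ≤ _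
          split_ifs with h
          · simp
          · rw [← nn_norm]; exact ENNReal.ofReal_le_ofReal (hf m h)
      _ ≤ _ := shell_sum n hd (fun k => ENNReal.ofReal (R^(n+1) * bd (n+1) δ (R * (k : ℝ))))
      _ ≤ ENNReal.ofReal S := by
        rw [ENNReal.tsum_eq_iSup_nat]
        refine iSup_le fun M => ?_
        have ht : ∀ k : ℕ, (((n + 1) * 2 * 3 ^ n * (k+1) ^ n : ℕ) : ℝ) * (R^(n+1) * bd (n+1) δ (R * ((k+1 : ℕ) : ℝ)))
            ≤ c * (H (k+1) - H k) := by
          intro k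
          have t1 := term1 hR n k
          have t2 := term2 hR hδ hn k
          have hc' : (((n + 1) * 2 * 3 ^ n * (k+1) ^ n : ℕ) : ℝ) = c * (k+1:ℝ)^n := by
            rw [hc]; push_cast; ring
          rw [hc', mul_assoc]
          refine mul_le_mul_of_nonneg_left ?_ (by positivity)
          unfold bd
          have e : H (k+1) - H k = 2 * R⁻¹ * ((1 - 1/((k+1:ℕ)+1:ℝ)) - (1 - 1/((k:ℕ)+1:ℝ))) +
              8 * (√δ^n)⁻¹ * (gs δ R (k+1) - gs δ R k) := by
            simp only [H]; ring
          rw [e]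
          refine le_trans (le_of_eq ?_) (add_le_add t1 t2)
          push_cast
          ring
        calc _ = ∑ k ∈ Finset.range M, ENNReal.ofReal ((((n + 1) * 2 * 3 ^ n * (k+1) ^ n : ℕ) : ℝ) * (R^(n+1) * bd (n+1) δ (R * ((k+1 : ℕ) : ℝ)))) := by
              refine Finset.sum_congr rfl fun k _ => ?_
              rw [ENNReal.ofReal_mul (Nat.cast_nonneg _), ENNReal.ofReal_natCast]
          _ = ENNReal.ofReal (∑ k ∈ Finset.range M, (((n + 1) * 2 * 3 ^ n * (k+1) ^ n : ℕ) : ℝ) * (R^(n+1) * bd (n+1) δ (R * ((k+1 : ℕ) : ℝ)))) := by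
              rw [ENNReal.ofReal_sum_of_nonneg]
              intro k _
              have := bd_nonneg (n := n+1) (s := R * ((k+1 : ℕ) : ℝ)) hδ (by positivity)
              positivity
          _ ≤ _ := by
              apply ENNReal.ofReal_le_ofReal
              calc _ ≤ ∑ k ∈ Finset.range M, c * (H (k+1) - H k) := Finset.sum_le_sum fun k _ => ht k
                _ = c * (H M - H 0) := by rw [← Finset.mul_sum, Finset.sum_range_sub]
                _ ≤ c * (2 * R⁻¹ + 8 * (√δ^n)⁻¹) := by
                  gcongr
                  have h0 : H 0 = 0 := by simp [H, gs]
                  rw [h0, sub_zero]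
                  have g1 : gs δ R M ≤ 1 := by
                    unfold gs
                    have := Real.sqrt_nonneg (δ * R * M)
                    rw [div_le_one (by positivity)]; linarith
                  have g2 : (1 - 1/((M:ℕ)+1:ℝ)) ≤ 1 := by
                    have : 0 ≤ 1/((M:ℕ)+1:ℝ) := by positivity
                    linarith
                  calc H M ≤ 2 * R⁻¹ * 1 + 8 * (√δ^n)⁻¹ * 1 := by
                        simp only [H]; gcongr
                    _ = _ := by ring
                _ ≤ S := by
                  rw [hS]
                  have : (0:ℝ) ≤ c * R⁻¹ := by positivity
                  nlinarith
  have h2 : Summable fun m => ‖f0 m‖ := by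
    have := ENNReal.summable_toReal (ne_top_of_le_ne_top ENNReal.ofReal_ne_top h1)
    refine this.congr fun m => ?_
    rw [ENNReal.toReal_ofReal (norm_nonneg _)]
  have h3 : Summable f0 := h2.of_norm
  have h4 : f = fun m => f0 m + (if m = 0 then f 0 else 0) := by
    ext m; by_cases h : m = 0 <;> simp [f0, h]
  have h5 : HasSum (fun m : d → ℤ => (if m = 0 then f 0 else 0)) (f 0) := hasSum_ite_eq _ _
  have h6 : HasSum f (∑' m, f0 m + f 0) := by
    have := h3.hasSum.add h5
    rw [← h4] at this
    exact this
  refine ⟨h6.summable, ?_⟩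
  rw [h6.tsum_eq, add_sub_cancel_right]
  refine (norm_tsum_le_tsum_norm h2).trans ?_
  rw [← ENNReal.ofReal_le_ofReal_iff hS0, ENNReal.ofReal_tsum_of_nonneg (fun _ => norm_nonneg _) h2]
  exact h1

end
end Landau

namespace Landau
set_option linter.unusedSectionVars false
open MeasureTheory Filter Topology Set Metric
open scoped ContDiff ENNReal

section
variable {I J : Type*} [Fintype I] [Fintype J] [Nonempty (I ⊕ J)]

lemma exists_inv {a : MS I J} (ha : nm a ≠ 0) : ∃ b : MS I J, a * b = 1 := by
  refine ⟨(fun i => (a.1 i)⁻¹, fun j => (a.2 j)⁻¹), ?_⟩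
  unfold nm at ha
  have h1 := left_ne_zero_of_mul ha
  have h2 := right_ne_zero_of_mul ha
  rw [Finset.prod_ne_zero_iff] at h1 h2
  ext i
  · have := h1 i (Finset.mem_univ i)
    simp only [Prod.fst_mul, Pi.mul_apply, Prod.fst_one, Pi.one_apply]
    exact mul_inv_cancel₀ (abs_ne_zero.1 this)
  · have := h2 i (Finset.mem_univ i)
    simp only [Prod.snd_mul, Pi.mul_apply, Prod.snd_one, Pi.one_apply]
    exact mul_inv_cancel₀ (norm_ne_zero_iff.1 (by simpa using this))

lemma int_mul {E : Type*} [NormedAddCommGroup E] [NormedSpace ℝ E] {a : MS I J} (ha : nm a ≠ 0) (g : MS I J → E) :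
    ∫ v, g v = nm a • ∫ v, g (a * v) := by
  obtain ⟨b, hb⟩ := exists_inv ha
  have him : (fun v => a * v) '' univ = univ := by
    rw [image_univ, range_eq_univ]
    intro v; exact ⟨b * v, by simp only [← mul_assoc, hb, one_mul]⟩
  have hf : (fun v => a * v) = ⇑(ContinuousLinearMap.mul ℝ (MS I J) a) := rfl
  rw [← setIntegral_univ, ← him, hf,
    integral_image_eq_integral_abs_det_fderiv_smul volume MeasurableSet.univ
      (f' := fun _ => ContinuousLinearMap.mul ℝ (MS I J) a)
      (fun z hz => (ContinuousLinearMap.mul ℝ (MS I J) a).hasFDerivWithinAt)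
      (fun z hz w hw h => by
        have h' : a * z = a * w := h
        calc z = b * (a * z) := by rw [← mul_assoc, mul_comm b, hb, one_mul]
          _ = w := by rw [h', ← mul_assoc, mul_comm b, hb, one_mul])]
  simp only [det_mul, setIntegral_univ]
  rw [integral_smul]
  rfl

variable {ι : Type*} [Fintype ι]

lemma int_basis (b : Module.Basis ι ℝ (MS I J)) :
    ∃ c : ℝ, 0 < c ∧ ∀ H : MS I J → ℂ, ∫ t : ι → ℝ, H (b.equivFun.symm t) = c * ∫ v, H v := by
  let e : (ι → ℝ) ≃L[ℝ] MS I J := b.equivFun.symm.toContinuousLinearEquiv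
  have h1 : (Measure.map e (volume : Measure (ι → ℝ))).IsAddHaarMeasure := e.isAddHaarMeasure_map _
  have h2 := Measure.isAddLeftInvariant_eq_smul (Measure.map e volume) (volume : Measure (MS I J))
  refine ⟨Measure.addHaarScalarFactor (Measure.map e volume) (volume : Measure (MS I J)), ?_, fun H => ?_⟩
  · exact_mod_cast Measure.addHaarScalarFactor_pos_of_isAddHaarMeasure _ _
  · have he : MeasurableEmbedding e := e.toHomeomorph.measurableEmbedding
    have h3 := he.integral_map (μ := volume) H
    rw [h2, integral_smul_nnreal_measure] at h3
    exact h3.symm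

/-- dual vectors with respect to the trace form -/
lemma exists_dual (b : Module.Basis ι ℝ (MS I J)) : ∃ (E : (ι → ℝ) →ₗ[ℝ] MS I J) (c : ℝ), 0 < c ∧
    (∀ u, c * ‖u‖ ≤ ‖E u‖) ∧ ∀ u t, tr (E u * b.equivFun.symm t) = ∑ i, u i * t i := by
  let T : MS I J →ₗ[ℝ] (ι → ℝ) :=
    { toFun := fun ζ i => tr (ζ * b i)
      map_add' := fun x y => by ext i; simp [add_mul]
      map_smul' := fun r x => by ext i; simp }
  have hT : ∀ ζ t, tr (ζ * b.equivFun.symm t) = ∑ i, T ζ i * t i := by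
    intro ζ t
    rw [Module.Basis.equivFun_symm_apply, Finset.mul_sum, map_sum]
    refine Finset.sum_congr rfl fun i _ => ?_
    rw [mul_smul_comm, map_smul, smul_eq_mul, mul_comm]
    rfl
  have hinj : Function.Injective T := by
    rw [← LinearMap.ker_eq_bot, LinearMap.ker_eq_bot']
    intro ζ hζ
    have h1 := hT ζ (b.equivFun (cj ζ))
    rw [LinearEquiv.symm_apply_apply, hζ] at h1
    have h2 := tr_pos ζ
    rw [h1] at h2
    simp only [Pi.zero_apply, zero_mul, Finset.sum_const_zero] at h2
    have : ‖ζ‖ = 0 := by nlinarith [norm_nonneg ζ]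
    exact norm_eq_zero.1 this
  have hdim : Module.finrank ℝ (MS I J) = Module.finrank ℝ (ι → ℝ) := b.equivFun.finrank_eq
  let T' : MS I J ≃ₗ[ℝ] (ι → ℝ) := T.linearEquivOfInjective hinj hdim
  obtain ⟨K, hK, hA⟩ := LinearMap.exists_antilipschitzWith T'.symm.toLinearMap (by
    rw [LinearMap.ker_eq_bot]; exact T'.symm.injective)
  have hK' : (0:ℝ) < K := by exact_mod_cast hK
  refine ⟨T'.symm.toLinearMap, (K:ℝ)⁻¹, by positivity, ?_, ?_⟩
  · intro u
    have := hA.le_mul_dist u 0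
    rw [map_zero, dist_zero_right, dist_zero_right] at this
    rwa [inv_mul_le_iff₀ hK']
  · intro u t
    have h1 := hT (T'.symm u) t
    have h2 : T (T'.symm u) = u := T'.apply_symm_apply u
    rw [h2] at h1
    exact h1

/-- hypotheses on the test function -/
def TestFn (a : HE I J → ℝ) (C0 m0 : ℝ) : Prop := Continuous a ∧ (∀ y, 0 ≤ a y) ∧
    0 < a 0 ∧ (∀ y, y ∉ closedBall (0 : HE I J) 1 → a y = 0) ∧ 0 ≤ C0 ∧
    ∀ δ α β : ℝ, 0 < δ → δ ≤ 1/2 → 1 - δ ≤ α → α ≤ 1 → 2 ≤ β → β ≤ 2 + δ →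
      |(∫ v, GG a (cut α β δ) v) - m0| ≤ C0 * δ ∧
      ∀ ξ : MS I J, ξ ≠ 0 → ‖∫ v, (GG a (cut α β δ) v : ℂ) * ph 1 (tr (ξ * v))‖ ≤
        C0 * ((‖ξ‖ ^ (dg I J + 1))⁻¹ + (√‖ξ‖ ^ (dg I J + 1))⁻¹ * min 1 ((δ * ‖ξ‖) ^ dg I J)⁻¹)

lemma cut_supp {δ α β : ℝ} (h1 : 0 < δ) (h2 : δ ≤ 1/2) (h3 : 1 - δ ≤ α) (h4 : β ≤ 2 + δ) (r : ℝ)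
    (hr : r ∉ Icc (1/2:ℝ) (5/2)) : cut α β δ r = 0 :=
  cut_zero h1 fun h => hr ⟨by linarith [h.1], by linarith [h.2]⟩

theorem lat_main {a : HE I J → ℝ} {C0 m0 : ℝ} (hd2 : 2 ≤ dg I J) (h : TestFn a C0 m0)
    (b : Module.Basis ι ℝ (MS I J)) : ∃ c : ℝ, 0 < c ∧ ∀ M : ℝ, 0 < M → ∃ C : ℝ, 0 ≤ C ∧
    ∀ δ α β R : ℝ, ∀ x : MS I J, 0 < δ → δ ≤ 1/2 → 1 - δ ≤ α → α ≤ 1 → 2 ≤ β → β ≤ 2 + δ → 0 < R →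
      nm x ≠ 0 → ‖x‖ ≤ M * rd x →
      (Summable fun k : ι → ℤ => GG a (cut α β δ) ((R * rd x)⁻¹ • (b.equivFun.symm (zc k) * x))) ∧
      |∑' k : ι → ℤ, GG a (cut α β δ) ((R * rd x)⁻¹ • (b.equivFun.symm (zc k) * x)) - c * m0 * R ^ dg I J|
        ≤ C * (R ^ dg I J * δ + R⁻¹ + (√δ ^ (dg I J - 1))⁻¹) := by
  classical
  obtain ⟨n, hdg⟩ : ∃ n, dg I J = n + 1 := ⟨dg I J - 1, by omega⟩
  have hn1 : 1 ≤ n := by omega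
  have hcard : Fintype.card ι = n + 1 := by
    rw [← hdg, ← finrank_MS, Module.finrank_eq_card_basis b]
  obtain ⟨c, hc, hcb⟩ := int_basis b
  obtain ⟨E, e0, he0, hE, htr⟩ := exists_dual b
  obtain ⟨CL, hCL, hlat⟩ := lat_bound (d := ι) n hcard hn1
  obtain ⟨hac, hapos, ha0, ha, hC0, hmain⟩ := h
  rw [hdg] at hmain ⊢
  refine ⟨c, hc, fun M hM => ?_⟩
  set κ := e0 / M with hκ
  have hκ0 : 0 < κ := by positivity
  set A := c * (C0 + 1) * (κ^(n+1))⁻¹ with hA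
  have hA0 : 0 < A := by positivity
  refine ⟨c * C0 + A * CL * (κ⁻¹ + 1), by positivity, ?_⟩
  intro δ α β R x hδ hδ2 hα hα1 hβ hβ2 hR hx hxM
  have hW := cut_supp hδ hδ2 hα hβ2
  have hWc : Continuous (cut α β δ) := (cut_smooth α β δ).continuous
  have hGc := GG_cont ha hW hac hWc
  have hGs := GG_supp ha hW (a := a) (W := cut α β δ)
  obtain ⟨hm0, hft⟩ := hmain δ α β hδ hδ2 hα hα1 hβ hβ2
  have hrd : 0 < rd x := by
    refine lt_of_le_of_ne (rd_nonneg x) fun h0 => hx ?_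
    rw [← rd_pow x, ← h0, hdg]; simp
  set y : MS I J := (R * rd x)⁻¹ • x with hy
  have hnmy : nm y = (R^(n+1))⁻¹ := by
    rw [hy, nm_smul _ (by positivity), ← rd_pow x, ← mul_pow, hdg, mul_inv, mul_assoc,
      inv_mul_cancel₀ hrd.ne', mul_one, inv_pow]
  have hnmy0 : nm y ≠ 0 := by rw [hnmy]; positivity
  have hyn : ‖y‖ ≤ M / R := by
    rw [hy, norm_smul, Real.norm_eq_abs, abs_of_pos (by positivity)]
    calc _ ≤ (R * rd x)⁻¹ * (M * rd x) := by gcongr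
      _ = M / R := by field_simp
  obtain ⟨y', hyy⟩ := exists_inv hnmy0
  let F : (ι → ℝ) → ℂ := fun t => (GG a (cut α β δ) (y * b.equivFun.symm t) : ℂ)
  have hFk : ∀ k : ι → ℤ, F (zc k) = (GG a (cut α β δ) ((R * rd x)⁻¹ • (b.equivFun.symm (zc k) * x)) : ℂ) := by
    intro k
    simp only [F]
    congr 2
    rw [hy, smul_mul_assoc, mul_comm x]
  let L : (ι → ℝ) →ₗ[ℝ] MS I J := (LinearMap.mul ℝ (MS I J) y).comp b.equivFun.symm.toLinearMap
  have hLi : Function.Injective L := by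
    intro s t hst
    have h1 : y * b.equivFun.symm s = y * b.equivFun.symm t := hst
    apply b.equivFun.symm.injective
    calc b.equivFun.symm s = y' * (y * b.equivFun.symm s) := by rw [← mul_assoc, mul_comm y', hyy, one_mul]
      _ = _ := by rw [h1, ← mul_assoc, mul_comm y', hyy, one_mul]
  have hLc : IsClosedEmbedding L := LinearMap.isClosedEmbedding_of_injective (LinearMap.ker_eq_bot.2 hLi)
  have hFc : Continuous F := Complex.continuous_ofReal.comp (hGc.comp hLc.continuous)
  have hFs : HasCompactSupport F := by
    have h1 : HasCompactSupport fun v => (GG a (cut α β δ) v : ℂ) := hGs.comp_left Complex.ofReal_zero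
    exact h1.comp_isClosedEmbedding hLc
  -- Fourier coefficients
  have hco : ∀ m : ι → ℤ, ∫ t, ph 1 (∑ i, m i * t i) * F t =
      c * (R^(n+1) * ∫ v, (GG a (cut α β δ) v : ℂ) * ph 1 (tr ((E (zc m) * y') * v))) := by
    intro m
    have h1 : ∀ t, ph 1 (∑ i, m i * t i) * F t =
        (fun v => ph 1 (tr (E (zc m) * v)) * (GG a (cut α β δ) (y * v) : ℂ)) (b.equivFun.symm t) := by
      intro t
      simp only [F]
      rw [htr]
      rfl
    rw [integral_congr_ae (Eventually.of_forall h1)]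
    refine (hcb (fun v => ph 1 (tr (E (zc m) * v)) * (GG a (cut α β δ) (y * v) : ℂ))).trans ?_
    congr 1
    rw [int_mul hnmy0 (fun v => (GG a (cut α β δ) v : ℂ) * ph 1 (tr ((E (zc m) * y') * v))), hnmy,
      Complex.real_smul, ← mul_assoc]
    push_cast
    rw [mul_inv_cancel₀ (by exact_mod_cast (pow_pos hR _).ne'), one_mul]
    congr 1; ext v
    rw [mul_comm]
    congr 3
    rw [mul_assoc, ← mul_assoc y', mul_comm y', hyy, one_mul]
  have hbound : ∀ m : ι → ℤ, m ≠ 0 → ‖∫ t, ph 1 (∑ i, m i * t i) * F t‖ ≤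
      A * ((κ * R)^(n+1) * bd (n+1) δ (κ * R * ‖zc m‖)) := by
    intro m hm
    have hzm : 0 < ‖zc m‖ := by
      rw [nn_norm]
      have : nn m ≠ 0 := fun h => hm (nn_zero h)
      positivity
    set ξ := E (zc m) * y' with hξ
    have h1 : κ * R * ‖zc m‖ ≤ ‖ξ‖ := by
      have h2 : E (zc m) = ξ * y := by rw [hξ, mul_assoc, mul_comm y', hyy, mul_one]
      have h3 := (hE (zc m)).trans (h2 ▸ norm_mul_le ξ y)
      have h4 : e0 * ‖zc m‖ ≤ ‖ξ‖ * (M / R) := h3.trans (by gcongr)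
      rw [hκ]
      have : κ * R * ‖zc m‖ = (e0 * ‖zc m‖) * (R / M) := by rw [hκ]; ring
      rw [← hκ, this]
      calc _ ≤ ‖ξ‖ * (M / R) * (R / M) := by gcongr
        _ = ‖ξ‖ := by field_simp
    have hpos : 0 < κ * R * ‖zc m‖ := by positivity
    have hξ0 : ξ ≠ 0 := norm_pos_iff.1 (hpos.trans_le h1)
    have h5 := hft ξ hξ0
    have h6 := bd_anti (n := n+1) hδ hpos h1
    have hb0 := bd_nonneg (n := n+1) hδ hpos.le
    rw [hco, norm_mul, norm_mul, norm_pow, Complex.norm_real, Complex.norm_real, Real.norm_eq_abs, Real.norm_eq_abs,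
      abs_of_pos hc, abs_of_pos hR]
    calc _ ≤ c * (R^(n+1) * (C0 * bd (n+1) δ ‖ξ‖)) := by gcongr; exact h5
      _ ≤ c * (R^(n+1) * ((C0 + 1) * bd (n+1) δ (κ * R * ‖zc m‖))) := by
        gcongr
        · exact bd_nonneg hδ (norm_nonneg _)
        · linarith
      _ = _ := by
        rw [hA, mul_pow]
        field_simp
  have hb2 : ∀ m : ι → ℤ, m ≠ 0 → ‖(A⁻¹ : ℂ) * ∫ t, ph 1 (∑ i, m i * t i) * F t‖ ≤
      (κ * R)^(n+1) * bd (n+1) δ (κ * R * ‖zc m‖) := by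
    intro m hm
    rw [norm_mul, norm_inv, Complex.norm_real, Real.norm_eq_abs, abs_of_pos hA0, inv_mul_le_iff₀ hA0]
    exact hbound m hm
  obtain ⟨hs1, hs2⟩ := hlat δ (κ * R) hδ (by positivity) _ hb2
  have hA0' : (A : ℂ) ≠ 0 := by exact_mod_cast hA0.ne'
  have hs3 : Summable fun m : ι → ℤ => ∫ t, ph 1 (∑ i, m i * t i) * F t := by
    have := hs1.mul_left (A : ℂ)
    refine this.congr fun m => ?_
    rw [mul_inv_cancel_left₀ hA0']
  have hP := poisson hFc hFs hs3
  rw [tsum_mul_left, ← mul_sub, norm_mul, norm_inv, Complex.norm_real, Real.norm_eq_abs, abs_of_pos hA0, inv_mul_le_iff₀ hA0,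
    hP.tsum_eq, hco 0] at hs2
  have hz : E (zc (0 : ι → ℤ)) = 0 := by
    have : zc (0 : ι → ℤ) = 0 := by ext i; simp [zc]
    rw [this, map_zero]
  simp only [hz, zero_mul, map_zero, ph_zero, mul_one] at hs2
  simp_rw [hFk] at hs2
  rw [← Complex.ofReal_tsum, integral_complex_ofReal] at hs2
  have hs4 : |∑' k : ι → ℤ, GG a (cut α β δ) ((R * rd x)⁻¹ • (b.equivFun.symm (zc k) * x)) -
      c * (R^(n+1) * ∫ v, GG a (cut α β δ) v)| ≤ A * (CL * ((κ * R)⁻¹ + (√δ ^ n)⁻¹)) := by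
    rw [← Real.norm_eq_abs, ← Complex.norm_real]
    refine le_trans (le_of_eq ?_) hs2
    congr 1
    push_cast
    rfl
  have hs5 : |c * (R^(n+1) * ∫ v, GG a (cut α β δ) v) - c * m0 * R^(n+1)| ≤ c * R^(n+1) * (C0 * δ) := by
    have : c * (R^(n+1) * ∫ v, GG a (cut α β δ) v) - c * m0 * R^(n+1) =
      (c * R^(n+1)) * ((∫ v, GG a (cut α β δ) v) - m0) := by ring
    rw [this, abs_mul, abs_of_pos (by positivity)]
    gcongr
  have hsm : Summable fun k : ι → ℤ => GG a (cut α β δ) ((R * rd x)⁻¹ • (b.equivFun.symm (zc k) * x)) := by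
    obtain ⟨N, hN⟩ := exists_supp_bound hFs
    refine summable_of_ne_finset_zero (s := Fintype.piFinset (fun _ : ι => Finset.Icc (-((N : ℕ):ℤ)) (N : ℕ))) ?_
    intro k hk
    have h1 : F (zc k) = 0 := by
      apply hN
      by_contra hh
      exact hk (zc_norm_le (le_of_not_gt hh))
    rw [hFk] at h1
    exact_mod_cast h1
  refine ⟨hsm, (abs_sub_le _ _ _).trans ((add_le_add hs4 hs5).trans ?_)⟩
  rw [Nat.add_sub_cancel]
  have q1 : 0 ≤ R^(n+1) * δ := by positivity
  have q2 : 0 ≤ R⁻¹ := by positivity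
  have q3 : 0 ≤ (√δ ^ n)⁻¹ := by positivity
  have q4 : 0 ≤ A * CL := by positivity
  have q5 : 0 ≤ κ⁻¹ := by positivity
  have q6 : 0 ≤ c * C0 := by positivity
  have e1 : A * (CL * ((κ * R)⁻¹ + (√δ ^ n)⁻¹)) + c * R ^ (n + 1) * (C0 * δ) =
    A * CL * κ⁻¹ * R⁻¹ + A * CL * (√δ ^ n)⁻¹ + c * C0 * (R^(n+1) * δ) := by
    rw [mul_inv]; ring
  rw [e1]
  have p1 := mul_nonneg q6 q2
  have p2 := mul_nonneg q6 q3
  have p3 := mul_nonneg (mul_nonneg q4 q5) q1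
  have p4 := mul_nonneg (mul_nonneg q4 q5) q3
  have p5 := mul_nonneg q4 q1
  have p6 := mul_nonneg q4 q2
  nlinarith

end
end Landau

namespace Landau
set_option linter.unusedSectionVars false
open MeasureTheory Filter Topology Set Metric
open scoped ContDiff ENNReal

section
variable {I J : Type*} [Fintype I] [Fintype J] [Nonempty (I ⊕ J)]

lemma lint_mul {a : MS I J} (ha : nm a = 1) (g : MS I J → ℝ≥0∞) :
    ∫⁻ v, g (a * v) = ∫⁻ v, g v := by
  obtain ⟨b, hb⟩ := exists_inv (a := a) (by rw [ha]; norm_num)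
  have him : (fun v => a * v) '' univ = univ := by
    rw [image_univ, range_eq_univ]
    intro v; exact ⟨b * v, by simp only [← mul_assoc, hb, one_mul]⟩
  have hf : (fun v => a * v) = ⇑(ContinuousLinearMap.mul ℝ (MS I J) a) := rfl
  conv_rhs => rw [← setLIntegral_univ, ← him, hf]
  rw [lintegral_image_eq_lintegral_abs_det_fderiv_mul volume MeasurableSet.univ
      (f' := fun _ => ContinuousLinearMap.mul ℝ (MS I J) a)
      (fun z hz => (ContinuousLinearMap.mul ℝ (MS I J) a).hasFDerivWithinAt)
      (fun z hz w hw h => by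
        have h' : a * z = a * w := h
        calc z = b * (a * z) := by rw [← mul_assoc, mul_comm b, hb, one_mul]
          _ = w := by rw [h', ← mul_assoc, mul_comm b, hb, one_mul])]
  simp only [det_mul, setLIntegral_univ, ha, ENNReal.ofReal_one, one_mul]
  rfl

variable {U : Type*} [Group U] [Countable U]

theorem unfolding (ρ : U →* MS I J) (hρ : ∀ u, nm (ρ u) = 1) {C : Set (MS I J)} (hC : MeasurableSet C)
    {w : ℝ≥0∞} (hw0 : w ≠ 0) (hwt : w ≠ ⊤)
    (hCw : ∀ x, nm x ≠ 0 → ∑' u, C.indicator 1 (ρ u * x) = w) {L : Set (MS I J)}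
    (hLn : ∀ v ∈ L, nm v ≠ 0) (hL : ∀ u, ∀ v ∈ L, ρ u * v ∈ L) {φ ψ f : MS I J → ℝ≥0∞}
    (hφ : ∀ u x, φ (ρ u * x) = φ x) (hψ : ∀ u x, ψ (ρ u * x) = ψ x) (hψ0 : ∀ x, nm x = 0 → ψ x = 0)
    (hψm : Measurable ψ) (hfm : Measurable f) :
    ∑' α : L, C.indicator 1 (α : MS I J) * (φ α * ∫⁻ x, f (α * x) * ψ x) =
      ∑' β : L, φ β * ∫⁻ x, C.indicator 1 x * (f (β * x) * ψ x) := by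
  have hmul : ∀ a : MS I J, Measurable fun x => a * x := fun a => (continuous_const_mul a).measurable
  have hCm : Measurable (C.indicator (1 : MS I J → ℝ≥0∞)) := measurable_one.indicator hC
  have hinv : ∀ u : U, ρ u * ρ u⁻¹ = 1 := fun u => by rw [← map_mul, mul_inv_cancel, map_one]
  have hinv' : ∀ u : U, ρ u⁻¹ * ρ u = 1 := fun u => by rw [← map_mul, inv_mul_cancel, map_one]
  -- step 1
  have h1 : ∀ α : MS I J, w * ∫⁻ x, f (α * x) * ψ x =
      ∑' u : U, ∫⁻ x, C.indicator 1 x * (f (ρ u⁻¹ * α * x) * ψ x) := by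
    intro α
    rw [← lintegral_const_mul' _ _ hwt]
    calc _ = ∫⁻ x, ∑' u : U, C.indicator 1 (ρ u * x) * (f (α * x) * ψ x) := by
          congr 1; ext x
          rw [ENNReal.tsum_mul_right]
          by_cases hx : nm x = 0
          · rw [hψ0 x hx]; simp
          · rw [hCw x hx]
      _ = ∑' u : U, ∫⁻ x, C.indicator 1 (ρ u * x) * (f (α * x) * ψ x) := by
          rw [lintegral_tsum]
          intro u
          exact ((hCm.comp (hmul _)).mul ((hfm.comp (hmul _)).mul hψm)).aemeasurable
      _ = _ := by
          congr 1; ext u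
          rw [← lint_mul (hρ u) (fun x => C.indicator 1 x * (f (ρ u⁻¹ * α * x) * ψ x))]
          congr 1; ext x
          have e1 : ρ u⁻¹ * α * (ρ u * x) = α * x := by
            calc _ = (ρ u⁻¹ * ρ u) * (α * x) := by ring
              _ = _ := by rw [hinv', one_mul]
          rw [hψ, e1]
  rw [← ENNReal.mul_right_inj hw0 hwt, ← ENNReal.tsum_mul_left, ← ENNReal.tsum_mul_left]
  calc _ = ∑' α : L, ∑' u : U, C.indicator 1 (α : MS I J) * (φ α * ∫⁻ x, C.indicator 1 x * (f (ρ u⁻¹ * α * x) * ψ x)) := by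
        congr 1; ext α
        rw [ENNReal.tsum_mul_left, ENNReal.tsum_mul_left, ← h1]
        ring
    _ = ∑' u : U, ∑' α : L, C.indicator 1 (α : MS I J) * (φ α * ∫⁻ x, C.indicator 1 x * (f (ρ u⁻¹ * α * x) * ψ x)) :=
        ENNReal.tsum_comm
    _ = ∑' u : U, ∑' β : L, C.indicator 1 (ρ u * (β : MS I J)) * (φ β * ∫⁻ x, C.indicator 1 x * (f (β * x) * ψ x)) := by
        congr 1; ext u
        let e : L ≃ L :=
          { toFun := fun v => ⟨ρ u * v, hL u v v.2⟩
            invFun := fun v => ⟨ρ u⁻¹ * v, hL u⁻¹ v v.2⟩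
            left_inv := fun v => by ext1; simp only [← mul_assoc, hinv', one_mul]
            right_inv := fun v => by ext1; simp only [← mul_assoc, hinv, one_mul] }
        rw [← e.tsum_eq]
        congr 1; ext β
        show C.indicator 1 (ρ u * (β : MS I J)) * (φ (ρ u * (β : MS I J)) * ∫⁻ x, C.indicator 1 x * (f (ρ u⁻¹ * (ρ u * β) * x) * ψ x)) = _
        rw [hφ, ← mul_assoc (ρ u⁻¹), hinv', one_mul]
    _ = ∑' β : L, ∑' u : U, C.indicator 1 (ρ u * (β : MS I J)) * (φ β * ∫⁻ x, C.indicator 1 x * (f (β * x) * ψ x)) :=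
        ENNReal.tsum_comm
    _ = _ := by
        congr 1; ext β
        rw [ENNReal.tsum_mul_right, hCw _ (hLn _ β.2)]

end
end Landau

namespace Landau
set_option linter.unusedSectionVars false
open MeasureTheory Filter Topology Set Metric
open scoped ContDiff ENNReal

section
variable {I J : Type*} [Fintype I] [Fintype J] [Nonempty (I ⊕ J)]

lemma ff_nonneg {a : HE I J → ℝ} (ha : ∀ y, 0 ≤ a y) (v : MS I J) : 0 ≤ ff a v := by
  unfold ff; split_ifs
  · exact ha _
  · exact le_rfl

lemma ff_meas {a : HE I J → ℝ} (ha : Continuous a) : Measurable (ff a) := by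
  classical
  have h1 : ContinuousOn (fun v : MS I J => a (prjE (mlog v))) (US I J) :=
    (ha.comp prjE_cont).comp_continuousOn mlog_cont
  have := h1.measurable_piecewise (g := fun _ => 0) continuousOn_const (isOpen_US (I := I) (J := J)).measurableSet
  convert! this using 1

lemma rd_pos {x : MS I J} (hx : nm x ≠ 0) : 0 < rd x := by
  refine lt_of_le_of_ne (rd_nonneg x) fun h0 => hx ?_
  rw [← rd_pow x, ← h0, zero_pow (dg_pos (I := I) (J := J)).ne']

/-- the weight -/
noncomputable def hh : ℝ → ℝ := cut 1 2 (1/4)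

lemma hh_cont : Continuous hh := (cut_smooth _ _ _).continuous
lemma hh_le_one (r : ℝ) : hh r ≤ 1 := cut_le_one _ _ _ _
lemma hh_zero (r : ℝ) (hr : r ∉ Icc (1:ℝ) 2) : hh r = 0 := cut_zero (by norm_num) hr
lemma hh_zero' (r : ℝ) (hr : r ∉ Icc (1/2:ℝ) (5/2)) : hh r = 0 :=
  hh_zero r fun h => hr ⟨by linarith [h.1], by linarith [h.2]⟩

lemma GG_hh_pos {a : HE I J → ℝ} (hac : Continuous a) (hapos : ∀ y, 0 ≤ a y) (ha0 : 0 < a 0)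
    (ha : ∀ y, y ∉ closedBall (0 : HE I J) 1 → a y = 0) : 0 < ∫ v, GG a hh v := by
  refine (GG_cont ha hh_zero' hac hh_cont).integral_pos_of_hasCompactSupport_nonneg_nonzero
    (GG_supp ha hh_zero') (fun v => mul_nonneg (ff_nonneg hapos v) (cut_nonneg _ _ _ _)) (x := (3/2:ℝ) • (1 : MS I J)) ?_
  have h1 : ff a (1 : MS I J) = a 0 := by
    have := ff_mex a (z := (0 : MS I J)) (fun j => by simpa using Real.pi_pos)
    rw [mex_zero] at this
    rw [this]
    congr 1
    simpa using prjE_coe (0 : HE I J)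
  rw [GG, ff_smul a (by norm_num), rd_smul (by norm_num), rd_one, h1]
  have : hh (3/2 * 1) = 1 := cut_one (by norm_num) (by constructor <;> norm_num)
  rw [this]
  simpa using ha0.ne'

lemma cf_const {a : HE I J → ℝ} (hapos : ∀ y, 0 ≤ a y) {α : MS I J} (hα : nm α ≠ 0) :
    ∫⁻ x, ENNReal.ofReal (ff a (α * x)) * ENNReal.ofReal (hh (rd x)) = ∫⁻ x, ENNReal.ofReal (GG a hh x) := by
  have hr := rd_pos hα
  set y : MS I J := (rd α)⁻¹ • α with hy
  have hy1 : nm y = 1 := by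
    rw [hy, nm_smul _ (by positivity), ← rd_pow α, ← mul_pow, inv_mul_cancel₀ hr.ne', one_pow]
  have hry : rd y = 1 := by rw [rd, hy1, Real.one_rpow]
  rw [← lint_mul hy1 (fun x => ENNReal.ofReal (GG a hh x))]
  congr 1; ext x
  rw [GG, rd_mul, hry, one_mul, ENNReal.ofReal_mul (ff_nonneg hapos _), hy, smul_mul_assoc, ff_smul a (by positivity)]

/-- a fundamental cone for a group of units -/
structure ConeData (U : Type*) [Group U] (I J : Type*) [Fintype I] [Fintype J] [Nonempty (I ⊕ J)] where
  ρ : U →* MS I J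
  hρ : ∀ u, nm (ρ u) = 1
  C : Set (MS I J)
  hC : MeasurableSet C
  w : ℝ≥0∞
  hw0 : w ≠ 0
  hwt : w ≠ ⊤
  hCw : ∀ x, nm x ≠ 0 → ∑' u, C.indicator 1 (ρ u * x) = w
  hCn : ∀ x ∈ C, nm x ≠ 0
  M : ℝ
  hM0 : 0 < M
  hM : ∀ x ∈ C, ‖x‖ ≤ M * rd x

variable {ι : Type*} [Fintype ι]

/-- nonzero lattice vectors -/
def LL (b : Module.Basis ι ℝ (MS I J)) : Set (MS I J) := {v | v ≠ 0 ∧ ∃ k : ι → ℤ, b.equivFun.symm (zc k) = v}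

lemma LL_tsum (b : Module.Basis ι ℝ (MS I J)) (g : MS I J → ℝ≥0∞) (h0 : g 0 = 0) :
    ∑' v : LL b, g v = ∑' k : ι → ℤ, g (b.equivFun.symm (zc k)) := by
  have hinj : Function.Injective (fun k : ι → ℤ => b.equivFun.symm (zc k)) := by
    intro k l h
    have := b.equivFun.symm.injective h
    ext i
    have := congrFun this i
    simpa [zc] using this
  rw [← tsum_range g hinj, tsum_subtype, tsum_subtype]
  congr 1; ext v
  by_cases hv : v = 0
  · rw [hv]
    simp [indicator, h0]
  · by_cases hk : ∃ k : ι → ℤ, b.equivFun.symm (zc k) = v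
    · rw [indicator_of_mem (show v ∈ LL b from ⟨hv, hk⟩), indicator_of_mem (show v ∈ range _ from hk)]
    · rw [indicator_of_notMem (fun h : v ∈ LL b => hk h.2), indicator_of_notMem (show v ∉ range _ from fun h => hk h)]

variable {U : Type*} [Group U] [Countable U]

theorem cone_smooth {a : HE I J → ℝ} {C0 m0 : ℝ} (hd2 : 2 ≤ dg I J) (h : TestFn a C0 m0)
    (D : ConeData U I J) (b : Module.Basis ι ℝ (MS I J)) (hLn : ∀ v ∈ LL b, nm v ≠ 0)
    (hL : ∀ u, ∀ v ∈ LL b, D.ρ u * v ∈ LL b) : ∃ c C : ℝ, 0 ≤ C ∧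
    ∀ δ α β R : ℝ, 0 < δ → δ ≤ 1/2 → 1 - δ ≤ α → α ≤ 1 → 2 ≤ β → β ≤ 2 + δ → 0 < R →
      ∑' v : LL b, D.C.indicator 1 (v : MS I J) * ENNReal.ofReal (cut α β δ (rd (v : MS I J) / R)) ≤
        ENNReal.ofReal (c * R ^ dg I J + C * (R ^ dg I J * δ + R⁻¹ + (√δ ^ (dg I J - 1))⁻¹)) ∧
      ENNReal.ofReal (c * R ^ dg I J - C * (R ^ dg I J * δ + R⁻¹ + (√δ ^ (dg I J - 1))⁻¹)) ≤ 
        ∑' v : LL b, D.C.indicator 1 (v : MS I J) * ENNReal.ofReal (cut α β δ (rd (v : MS I J) / R)) := by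
  obtain ⟨cb, hcb, hlm⟩ := lat_main hd2 h b
  obtain ⟨C1, hC1, hlm⟩ := hlm D.M D.hM0
  obtain ⟨hac, hapos, ha0, ha, hC0, -⟩ := h
  set I0 := ∫ v, GG a hh v with hI0
  have hI0p : 0 < I0 := GG_hh_pos hac hapos ha0 ha
  have hcf : ∫⁻ x, ENNReal.ofReal (GG a hh x) = ENNReal.ofReal I0 := by
    rw [hI0, ofReal_integral_eq_lintegral_ofReal]
    · exact (GG_cont ha hh_zero' hac hh_cont).integrable_of_hasCompactSupport (GG_supp ha hh_zero')
    · exact Eventually.of_forall fun v => mul_nonneg (ff_nonneg hapos v) (cut_nonneg _ _ _ _)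
  set V : ℝ≥0∞ := ∫⁻ x, D.C.indicator 1 x * ENNReal.ofReal (hh (rd x)) with hV
  have hVt : V ≠ ⊤ := by
    have h1 : V ≤ ∫⁻ x, (closedBall (0 : MS I J) (D.M * 2)).indicator 1 x := by
      refine lintegral_mono fun x => ?_
      by_cases hx : x ∈ D.C
      · by_cases hr : rd x ∈ Icc (1:ℝ) 2
        · have h2 : x ∈ closedBall (0 : MS I J) (D.M * 2) := by
            rw [mem_closedBall_zero_iff]
            refine (D.hM x hx).trans ?_
            have := D.hM0
            gcongr; exact hr.2
          rw [indicator_of_mem hx, indicator_of_mem h2]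
          simpa using hh_le_one _
        · rw [hh_zero _ hr]; simp
      · rw [indicator_of_notMem hx]; simp
    refine ne_top_of_le_ne_top ?_ h1
    rw [lintegral_indicator_one measurableSet_closedBall]
    exact measure_closedBall_lt_top.ne
  refine ⟨V.toReal / I0 * (cb * m0), V.toReal / I0 * C1, by positivity, ?_⟩
  intro δ α β R hδ hδ2 hα hα1 hβ hβ2 hR
  have hlm := fun x => hlm δ α β R x hδ hδ2 hα hα1 hβ hβ2 hR
  set E := R ^ dg I J * δ + R⁻¹ + (√δ ^ (dg I J - 1))⁻¹ with hE
  set A := cb * m0 * R ^ dg I J with hA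
  set T := ∑' v : LL b, D.C.indicator 1 (v : MS I J) * ENNReal.ofReal (cut α β δ (rd (v : MS I J) / R)) with hT
  have hrρ : ∀ u (x : MS I J), rd (D.ρ u * x) = rd x := fun u x => by
    have h1 : rd (D.ρ u) = 1 := by rw [rd, D.hρ, Real.one_rpow]
    rw [rd_mul, h1, one_mul]
  have hψ0 : ∀ x : MS I J, nm x = 0 → ENNReal.ofReal (hh (rd x)) = 0 := by
    intro x hx
    have : rd x = 0 := by
      rw [rd, hx, Real.zero_rpow]
      have := dg_ne (I := I) (J := J)
      positivity
    rw [this, hh_zero 0 (by simp), ENNReal.ofReal_zero]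
  have hψm : Measurable fun x : MS I J => ENNReal.ofReal (hh (rd x)) :=
    ENNReal.measurable_ofReal.comp (hh_cont.comp rd_continuous).measurable
  have hfm : Measurable fun x : MS I J => ENNReal.ofReal (ff a x) := ENNReal.measurable_ofReal.comp (ff_meas hac)
  have hun := unfolding D.ρ D.hρ D.hC D.hw0 D.hwt D.hCw hLn hL
    (φ := fun x => ENNReal.ofReal (cut α β δ (rd x / R))) (ψ := fun x => ENNReal.ofReal (hh (rd x)))
    (f := fun x => ENNReal.ofReal (ff a x)) (fun u x => by simp only [hrρ]) (fun u x => by simp only [hrρ]) hψ0 hψm hfm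
  have hl : ∑' v : LL b, D.C.indicator 1 (v : MS I J) * (ENNReal.ofReal (cut α β δ (rd (v : MS I J) / R)) * 
      ∫⁻ x, ENNReal.ofReal (ff a (v * x)) * ENNReal.ofReal (hh (rd x))) = T * ENNReal.ofReal I0 := by
    rw [hT, ← ENNReal.tsum_mul_right]
    congr 1; ext v
    rw [cf_const hapos (hLn v v.2), hcf, mul_assoc]
  have hmul : ∀ a : MS I J, Measurable fun x => a * x := fun a => (continuous_const_mul a).measurable
  have hCm : Measurable (D.C.indicator (1 : MS I J → ℝ≥0∞)) := measurable_one.indicator D.hC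
  have hcount : Countable (LL b) := by
    have : (range fun k : ι → ℤ => b.equivFun.symm (zc k)).Countable := countable_range _
    exact (this.mono (fun v hv => hv.2)).to_subtype
  have hr : ∑' v : LL b, ENNReal.ofReal (cut α β δ (rd (v : MS I J) / R)) * 
      ∫⁻ x, D.C.indicator 1 x * (ENNReal.ofReal (ff a (v * x)) * ENNReal.ofReal (hh (rd x))) = 
      ∫⁻ x, D.C.indicator 1 x * ENNReal.ofReal (hh (rd x)) * 
        ENNReal.ofReal (∑' k : ι → ℤ, GG a (cut α β δ) ((R * rd x)⁻¹ • (b.equivFun.symm (zc k) * x))) := by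
    simp_rw [← lintegral_const_mul' _ _ ENNReal.ofReal_ne_top]
    rw [← lintegral_tsum]
    swap
    · intro v
      exact (measurable_const.mul (hCm.mul ((hfm.comp (hmul _)).mul hψm))).aemeasurable
    congr 1; ext x
    by_cases hx : x ∈ D.C
    · have hxn := D.hCn x hx
      have hrx := rd_pos hxn
      obtain ⟨hs, -⟩ := hlm x hxn (D.hM x hx)
      have hnn : ∀ k : ι → ℤ, 0 ≤ GG a (cut α β δ) ((R * rd x)⁻¹ • (b.equivFun.symm (zc k) * x)) :=
        fun k => mul_nonneg (ff_nonneg hapos _) (cut_nonneg _ _ _ _)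
      rw [ENNReal.ofReal_tsum_of_nonneg hnn hs, ← ENNReal.tsum_mul_left,
        LL_tsum b (fun v => ENNReal.ofReal (cut α β δ (rd (v : MS I J) / R)) * 
          (D.C.indicator 1 x * (ENNReal.ofReal (ff a (v * x)) * ENNReal.ofReal (hh (rd x)))))]
      · congr 1; ext k
        rw [GG, ff_smul a (by positivity), rd_smul (by positivity), rd_mul, ENNReal.ofReal_mul (ff_nonneg hapos _)]
        have : (R * rd x)⁻¹ * (rd (b.equivFun.symm (zc k)) * rd x) = rd (b.equivFun.symm (zc k)) / R := by
          field_simp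
        rw [this]; ring
      · have : rd (0 : MS I J) = 0 := by
          have h1 := rd_smul (le_refl (0:ℝ)) (0 : MS I J)
          simpa using h1
        rw [this, zero_div, cut_zero hδ (fun hh => by linarith [hh.1])]; simp
    · simp [indicator_of_notMem hx]
  rw [hl, hr] at hun
  have hup : T * ENNReal.ofReal I0 ≤ V * ENNReal.ofReal (A + C1 * E) := by
    rw [hun, hV, ← lintegral_mul_const' _ _ ENNReal.ofReal_ne_top]
    refine lintegral_mono fun x => ?_
    by_cases hx : x ∈ D.C
    · obtain ⟨-, hb⟩ := hlm x (D.hCn x hx) (D.hM x hx)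
      gcongr
      linarith [(abs_le.1 hb).2]
    · simp [indicator_of_notMem hx]
  have hlow : V * ENNReal.ofReal (A - C1 * E) ≤ T * ENNReal.ofReal I0 := by
    rw [hun, hV, ← lintegral_mul_const' _ _ ENNReal.ofReal_ne_top]
    refine lintegral_mono fun x => ?_
    by_cases hx : x ∈ D.C
    · obtain ⟨-, hb⟩ := hlm x (D.hCn x hx) (D.hM x hx)
      gcongr
      linarith [(abs_le.1 hb).1]
    · simp [indicator_of_notMem hx]
  have hVe : V = ENNReal.ofReal V.toReal := (ENNReal.ofReal_toReal hVt).symm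
  have hIp : ENNReal.ofReal I0 ≠ 0 := by simpa using hI0p
  constructor
  · rw [← ENNReal.mul_le_mul_iff_left hIp ENNReal.ofReal_ne_top]
    refine hup.trans (le_of_eq ?_)
    rw [hVe, ← ENNReal.ofReal_mul ENNReal.toReal_nonneg, ← ENNReal.ofReal_mul' hI0p.le]
    congr 1
    rw [ENNReal.toReal_ofReal ENNReal.toReal_nonneg, hA]
    field_simp
  · rw [← ENNReal.mul_le_mul_iff_left hIp ENNReal.ofReal_ne_top]
    refine le_trans (le_of_eq ?_) hlow
    rw [hVe, ← ENNReal.ofReal_mul ENNReal.toReal_nonneg, ← ENNReal.ofReal_mul' hI0p.le]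
    congr 1
    rw [ENNReal.toReal_ofReal ENNReal.toReal_nonneg, hA]
    field_simp

end
end Landau

namespace Landau
set_option linter.unusedSectionVars false
open MeasureTheory Filter Topology Set Metric
open scoped ContDiff ENNReal

/-- telescoping -/
lemma telescope {f : ℝ → ℝ} {q θ A D : ℝ} (hq : 1 < q) (hθ : 0 < θ) (hA : 0 ≤ A)
    (h1 : ∀ s, 1 ≤ s → |f (q * s) - f s| ≤ A * s ^ θ) (h2 : ∀ s, 1 ≤ s → s ≤ q → |f s| ≤ D) :
    ∃ C, 0 ≤ C ∧ ∀ s, 1 ≤ s → |f s| ≤ C * s ^ θ := by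
  have hqθ : 1 < q ^ θ := Real.one_lt_rpow hq hθ
  set C := max D (A / (q ^ θ - 1)) with hC
  have hC0 : 0 ≤ C := le_max_of_le_right (div_nonneg hA (by linarith))
  have hCA : A ≤ C * (q ^ θ - 1) := by
    have : A / (q ^ θ - 1) ≤ C := le_max_right _ _
    rwa [div_le_iff₀ (by linarith)] at this
  refine ⟨C, hC0, ?_⟩
  have key : ∀ k : ℕ, ∀ s, 1 ≤ s → s ≤ q ^ (k + 1) → |f s| ≤ C * s ^ θ := by
    intro k
    induction k with
    | zero =>
      intro s hs hs2
      have h3 : (1:ℝ) ≤ s ^ θ := Real.one_le_rpow hs hθ.le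
      have h4 := h2 s hs (by simpa using hs2)
      have h5 : D ≤ C := le_max_left _ _
      nlinarith
    | succ k ih =>
      intro s hs hs2
      by_cases hsq : s ≤ q
      · refine ih s hs (hsq.trans ?_)
        exact le_self_pow₀ hq.le (by omega)
      · push Not at hsq
        have hq0 : 0 < q := by linarith
        set t := s / q with ht
        have hst : s = q * t := by rw [ht]; field_simp
        have ht1 : 1 ≤ t := by rw [ht, le_div_iff₀ hq0]; linarith
        have ht2 : t ≤ q ^ (k + 1) := by
          rw [ht, div_le_iff₀ hq0]; calc s ≤ _ := hs2
            _ = _ := by ring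
        have h3 := ih t ht1 ht2
        have h4 := h1 t ht1
        rw [hst, Real.mul_rpow hq0.le (by linarith)]
        have h5 : 0 ≤ t ^ θ := Real.rpow_nonneg (by linarith) _
        have h6 : |f (q * t)| ≤ |f (q*t) - f t| + |f t| := by
          have := abs_add_le (f (q*t) - f t) (f t)
          simpa using this
        nlinarith
  intro s hs
  obtain ⟨k, hk⟩ := pow_unbounded_of_one_lt s hq
  exact key k s hs (hk.le.trans (pow_le_pow_right₀ hq.le (by omega)))

lemma cut_left {α β δ : ℝ} (hδ : 0 < δ) : cut α β δ α = 0 := by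
  have h1 : Tendsto (cut α β δ) (𝓝[<] α) (𝓝 (cut α β δ α)) :=
    ((cut_smooth α β δ).continuous.tendsto α).mono_left nhdsWithin_le_nhds
  have h2 : Tendsto (cut α β δ) (𝓝[<] α) (𝓝 0) := by
    refine tendsto_const_nhds.congr' ?_
    filter_upwards [self_mem_nhdsWithin] with r hr
    exact (cut_zero hδ (fun h => absurd h.1 (not_le.2 hr))).symm
  exact tendsto_nhds_unique h1 h2

section
variable {I J : Type*} [Fintype I] [Fintype J] [Nonempty (I ⊕ J)]
variable {ι : Type*} [Fintype ι]
variable {U : Type*} [Group U] [Countable U]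

/-- lattice vectors in the cone of bounded norm -/
def AS (D : ConeData U I J) (b : Module.Basis ι ℝ (MS I J)) (s : ℝ) : Set (MS I J) :=
  {v | v ∈ LL b ∧ v ∈ D.C ∧ nm v ≤ s}

lemma AS_finite (D : ConeData U I J) (b : Module.Basis ι ℝ (MS I J)) (s : ℝ) : (AS D b s).Finite := by
  classical
  let e : MS I J ≃L[ℝ] (ι → ℝ) := b.equivFun.toContinuousLinearEquiv
  set B := ‖(e : MS I J →L[ℝ] (ι → ℝ))‖ * (D.M * s ^ (1 / (dg I J : ℝ)))
  obtain ⟨n, hn⟩ := exists_nat_ge B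
  refine (((Fintype.piFinset (fun _ : ι => Finset.Icc (-(n:ℤ)) n)).finite_toSet).image
    (fun k : ι → ℤ => b.equivFun.symm (zc k))).subset ?_
  rintro v ⟨⟨hv0, k, hk⟩, hvC, hvs⟩
  refine ⟨k, ?_, hk⟩
  refine zc_norm_le (le_trans ?_ hn)
  have h1 : zc k = e v := by
    rw [← hk]; exact (b.equivFun.apply_symm_apply _).symm
  rw [h1]
  refine ((e : MS I J →L[ℝ] (ι → ℝ)).le_opNorm v).trans ?_
  have := D.hM0
  refine mul_le_mul_of_nonneg_left ((D.hM v hvC).trans ?_) (norm_nonneg _)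
  refine mul_le_mul_of_nonneg_left ?_ this.le
  exact Real.rpow_le_rpow (nm_nonneg v) hvs (by positivity)

lemma tsum_ind (L F : Set (MS I J)) (hF : F.Finite) (hFL : F ⊆ L) :
    ∑' v : L, F.indicator (1 : MS I J → ℝ≥0∞) (v : MS I J) = ENNReal.ofReal (F.ncard : ℝ) := by
  rw [tsum_subtype L (F.indicator (1 : MS I J → ℝ≥0∞)), indicator_indicator, inter_eq_right.2 hFL, ← tsum_subtype F]
  simp only [Pi.one_apply, ENNReal.tsum_set_const, mul_one]
  rw [← hF.cast_ncard_eq]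
  simp

theorem cone_diff (hd2 : 2 ≤ dg I J) (D : ConeData U I J) (b : Module.Basis ι ℝ (MS I J))
    (hLn : ∀ v ∈ LL b, nm v ≠ 0)
    (hL : ∀ u, ∀ v ∈ LL b, D.ρ u * v ∈ LL b) : ∃ c C : ℝ, 0 ≤ C ∧ ∀ s, 1 ≤ s →
      |((AS D b (2 ^ dg I J * s)).ncard : ℝ) - (AS D b s).ncard - c * s| ≤
        C * s ^ (((dg I J : ℝ) - 1) / (dg I J + 1)) := by
  obtain ⟨a, C0, m0, h⟩ := test_function I J hd2
  obtain ⟨c, C, hC, hcs⟩ := cone_smooth (a := a) (C0 := C0) (m0 := m0) hd2 h D b hLn hL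
  set d := dg I J with hd
  set θ : ℝ := ((d : ℝ) - 1) / (d + 1) with hθ
  have hd2' : (2:ℝ) ≤ d := by exact_mod_cast hd2
  have hθ0 : 0 < θ := div_pos (by linarith) (by linarith)
  refine ⟨max c 0, C * (1/2 + 1 + 2 ^ (((d:ℝ) - 1)/2)), by positivity, fun s hs => ?_⟩
  set R := s ^ (1 / (d:ℝ)) with hR
  have hs0 : 0 < s := by linarith
  have hR0 : 0 < R := by positivity
  have hR1 : 1 ≤ R := Real.one_le_rpow hs (by positivity)
  have hRd : R ^ d = s := by
    rw [hR, ← Real.rpow_natCast, ← Real.rpow_mul hs0.le, one_div_mul_cancel (by linarith), Real.rpow_one]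
  set δ := (1/2) * s ^ (-(2 / ((d:ℝ) + 1))) with hδ
  have hδ0 : 0 < δ := by positivity
  have hδ2 : δ ≤ 1/2 := by
    have : s ^ (-(2 / ((d:ℝ) + 1))) ≤ 1 := Real.rpow_le_one_of_one_le_of_nonpos hs
      (by have : 0 ≤ 2 / ((d:ℝ) + 1) := by positivity
          linarith)
    linarith
  have hsθ : 1 ≤ s ^ θ := Real.one_le_rpow hs hθ0.le
  have hErr : R ^ d * δ + R⁻¹ + (√δ ^ (d - 1))⁻¹ ≤ (1/2 + 1 + 2 ^ (((d:ℝ) - 1)/2)) * s ^ θ := by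
    have e1 : R ^ d * δ = 1/2 * s ^ θ := by
      rw [hRd, hδ]
      have : s ^ θ = s * s ^ (-(2 / ((d:ℝ) + 1))) := by
        nth_rewrite 2 [← Real.rpow_one s]
        rw [← Real.rpow_add hs0]; congr 1; rw [hθ]; field_simp; ring
      rw [this]; ring
    have e2 : R⁻¹ ≤ s ^ θ := (inv_le_one_of_one_le₀ hR1).trans hsθ
    have e3 : (√δ ^ (d - 1))⁻¹ = 2 ^ (((d:ℝ) - 1)/2) * s ^ θ := by
      rw [Real.sqrt_eq_rpow, ← Real.rpow_natCast, ← Real.rpow_mul hδ0.le, Nat.cast_sub (by omega), Nat.cast_one,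
        ← Real.rpow_neg hδ0.le, hδ, Real.mul_rpow (by norm_num) (by positivity), ← Real.rpow_mul hs0.le,
        one_div, Real.inv_rpow (by norm_num), ← Real.rpow_neg (by norm_num)]
      congr 2
      · ring
      · rw [hθ]; field_simp
    rw [e1, e3]; linarith
  set Err := R ^ d * δ + R⁻¹ + (√δ ^ (d - 1))⁻¹ with hErrd
  set F := AS D b (2 ^ d * s) \ AS D b s with hF
  have hsub : AS D b s ⊆ AS D b (2 ^ d * s) := fun v hv => ⟨hv.1, hv.2.1, hv.2.2.trans (by
    have : (1:ℝ) ≤ 2 ^ d := one_le_pow₀ (by norm_num)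
    nlinarith)⟩
  have hFf : F.Finite := (AS_finite D b _).subset sdiff_subset
  have hFL : F ⊆ LL b := fun v hv => hv.1.1
  have hcard : (F.ncard : ℝ) = (AS D b (2 ^ d * s)).ncard - (AS D b s).ncard := by
    rw [hF, ncard_sdiff hsub (AS_finite D b s), Nat.cast_sub (ncard_le_ncard hsub (AS_finite D b _))]
  have hiff : ∀ v : MS I J, v ∈ F ↔ v ∈ LL b ∧ v ∈ D.C ∧ 1 < rd v / R ∧ rd v / R ≤ 2 := by
    intro v
    have i1 : rd v / R ≤ 2 ↔ nm v ≤ 2 ^ d * s := by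
      rw [div_le_iff₀ hR0, ← rd_pow v, ← hRd, ← mul_pow, pow_le_pow_iff_left₀ (rd_nonneg v) (by positivity) (by omega)]
    have i2 : 1 < rd v / R ↔ ¬ nm v ≤ s := by
      rw [lt_div_iff₀ hR0, not_le, ← rd_pow v, one_mul, ← hRd, pow_lt_pow_iff_left₀ hR0.le (rd_nonneg v) (by omega)]
    rw [i1, i2]
    simp only [hF, AS, Set.mem_sdiff, mem_ofPred_eq]
    tauto
  have hlow := (hcs δ 1 2 R hδ0 hδ2 (by linarith) le_rfl le_rfl (by linarith) hR0).2
  have hup := (hcs δ (1-δ) (2+δ) R hδ0 hδ2 le_rfl (by linarith) (by linarith) le_rfl hR0).1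
  have hlow2 : ENNReal.ofReal (c * R ^ d - C * Err) ≤ ENNReal.ofReal (F.ncard : ℝ) := by
    rw [← tsum_ind (LL b) F hFf hFL]
    refine hlow.trans (ENNReal.tsum_le_tsum fun v => ?_)
    by_cases hv : (v : MS I J) ∈ F
    · rw [indicator_of_mem hv, indicator_of_mem (hFL hv |> fun _ => ((hiff v).1 hv).2.1)]
      simpa using cut_le_one _ _ _ _
    · by_cases hvC : (v : MS I J) ∈ D.C
      · have : cut 1 2 δ (rd (v : MS I J) / R) = 0 := by
          by_cases h1 : rd (v : MS I J) / R = 1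
          · rw [h1, cut_left hδ0]
          · refine cut_zero hδ0 fun h2 => hv ((hiff v).2 ⟨v.2, hvC, lt_of_le_of_ne h2.1 (Ne.symm h1), h2.2⟩)
        rw [this]; simp
      · simp [indicator_of_notMem hvC]
  have hup2 : ENNReal.ofReal (F.ncard : ℝ) ≤ ENNReal.ofReal (c * R ^ d + C * Err) := by
    rw [← tsum_ind (LL b) F hFf hFL]
    refine le_trans (ENNReal.tsum_le_tsum fun v => ?_) hup
    by_cases hv : (v : MS I J) ∈ F
    · obtain ⟨-, h2, h3, h4⟩ := (hiff v).1 hv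
      rw [indicator_of_mem hv, indicator_of_mem h2, cut_one hδ0 ⟨by linarith, by linarith⟩]
      simp
    · simp [indicator_of_notMem hv]
  have hN0 : (0:ℝ) ≤ F.ncard := by positivity
  have hRd0 : 0 ≤ R ^ d := by positivity
  have hE0 : 0 ≤ C * Err := mul_nonneg hC (by positivity)
  have k1 : max c 0 * R ^ d - C * Err ≤ F.ncard := by
    rcases le_total c 0 with hc | hc
    · rw [max_eq_right hc]; linarith
    · rw [max_eq_left hc]; exact (ENNReal.ofReal_le_ofReal_iff hN0).1 hlow2
  have hErr' : C * Err ≤ C * ((1/2 + 1 + 2 ^ (((d:ℝ) - 1)/2)) * s ^ θ) := mul_le_mul_of_nonneg_left hErr hC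
  have k2 : (F.ncard : ℝ) ≤ max c 0 * R ^ d + C * Err := by
    have hp : 0 ≤ max c 0 * R ^ d + C * Err := add_nonneg (mul_nonneg (le_max_right _ _) hRd0) hE0
    refine (ENNReal.ofReal_le_ofReal_iff hp).1 (hup2.trans (ENNReal.ofReal_le_ofReal ?_))
    have := mul_le_mul_of_nonneg_right (le_max_left c 0) hRd0
    linarith
  rw [← hcard, abs_le]
  rw [hRd] at k1 k2
  constructor <;> linarith

theorem cone_count (hd2 : 2 ≤ dg I J) (D : ConeData U I J) (b : Module.Basis ι ℝ (MS I J))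
    (hLn : ∀ v ∈ LL b, nm v ≠ 0)
    (hL : ∀ u, ∀ v ∈ LL b, D.ρ u * v ∈ LL b) : ∃ c C : ℝ, 0 ≤ C ∧ ∀ s, 1 ≤ s →
      |((AS D b s).ncard : ℝ) - c * s| ≤ C * s ^ (((dg I J : ℝ) - 1) / (dg I J + 1)) := by
  obtain ⟨c, C, hC, h⟩ := cone_diff hd2 D b hLn hL
  have hd2' : (2:ℝ) ≤ dg I J := by exact_mod_cast hd2
  have hθ0 : 0 < ((dg I J : ℝ) - 1) / (dg I J + 1) := div_pos (by linarith) (by linarith)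
  have hq : (1:ℝ) < 2 ^ dg I J := one_lt_pow₀ (by norm_num) (by omega)
  set q : ℝ := 2 ^ dg I J with hqd
  set c' := c / (q - 1) with hc'
  have hcc : c' * q - c' = c := by
    have : q - 1 ≠ 0 := by linarith
    rw [hc']; field_simp
  obtain ⟨C', hC', h'⟩ := telescope (f := fun s => ((AS D b s).ncard : ℝ) - c' * s) (q := q) (A := C)
    (D := (AS D b q).ncard + |c'| * q) hq hθ0 hC (fun s hs => by
      convert h s hs using 2
      linear_combination (-s) * hcc) (fun s hs hs2 => by
      have h1 : ((AS D b s).ncard : ℝ) ≤ (AS D b q).ncard := by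
        have h0 : AS D b s ⊆ AS D b q := fun v hv => ⟨hv.1, hv.2.1, hv.2.2.trans hs2⟩
        exact_mod_cast ncard_le_ncard h0 (AS_finite D b q)
      have h2 : |c' * s| ≤ |c'| * q := by
        rw [abs_mul, abs_of_nonneg (by linarith : 0 ≤ s)]
        exact mul_le_mul_of_nonneg_left hs2 (abs_nonneg _)
      refine (abs_sub _ _).trans ?_
      rw [abs_of_nonneg (by positivity : (0:ℝ) ≤ (AS D b s).ncard)]
      linarith)
  exact ⟨c', C', hC', h'⟩

end
end Landau

namespace Landau
set_option linter.unusedSectionVars false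
open MeasureTheory Filter Topology Set Metric
open scoped ContDiff ENNReal

section
open NumberField NumberField.InfinitePlace NumberField.mixedEmbedding NumberField.mixedEmbedding.fundamentalCone
open scoped Classical
variable (K : Type*) [Field K] [NumberField K]

/-- real places -/
abbrev RP := {w : InfinitePlace K // IsReal w}
/-- complex places -/
abbrev CP := {w : InfinitePlace K // IsComplex w}

instance neRC : Nonempty (RP K ⊕ CP K) := by
  obtain ⟨w⟩ : Nonempty (InfinitePlace K) := inferInstance
  rcases isReal_or_isComplex w with h | h
  · exact ⟨Sum.inl ⟨w, h⟩⟩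
  · exact ⟨Sum.inr ⟨w, h⟩⟩

lemma nm_eq (x : mixedSpace K) : nm (I := RP K) (J := CP K) x = mixedEmbedding.norm x := by
  rw [mixedEmbedding.norm_apply, InfinitePlace.prod_eq_prod_mul_prod, nm]
  congr 1
  · refine Finset.prod_congr rfl fun w _ => ?_
    rw [normAtPlace_apply_of_isReal w.2, mult_isReal, pow_one, Real.norm_eq_abs]
  · refine Finset.prod_congr rfl fun w _ => ?_
    rw [normAtPlace_apply_of_isComplex w.2, mult_isComplex]

lemma dg_eq : dg (RP K) (CP K) = Module.finrank ℚ K := by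
  rw [← finrank_MS, ← mixedEmbedding.finrank]

instance countableUnits : Countable (𝓞 K)ˣ := by
  have : Countable (𝓞 K) := ((RingOfIntegers.basis K).equivFun.toEquiv.injective).countable
  exact Units.val_injective.countable

lemma exists_cone_bound : ∃ M : ℝ, 0 < M ∧ ∀ x ∈ fundamentalCone K, ‖(x : MS (RP K) (CP K))‖ ≤ M * rd (I := RP K) (J := CP K) x := by
  obtain ⟨M, hM⟩ := (isBounded_normLeOne K).exists_norm_le
  refine ⟨max M 1, by positivity, fun x hx => ?_⟩
  have hn : nm (I := RP K) (J := CP K) x ≠ 0 := by rw [nm_eq]; exact (norm_pos_of_mem hx).ne'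
  have hr := rd_pos hn
  have h1 : (rd (I := RP K) (J := CP K) x)⁻¹ • x ∈ normLeOne K := by
    refine ⟨(smul_mem_iff_mem (by positivity)).2 hx, ?_⟩
    show mixedEmbedding.norm _ ≤ 1
    rw [← nm_eq, nm_smul _ (by positivity), ← rd_pow, ← mul_pow, inv_mul_cancel₀ hr.ne', one_pow]
  have h2 := hM _ h1
  rw [_root_.norm_smul, norm_inv, Real.norm_eq_abs, abs_of_pos hr, inv_mul_le_iff₀ hr] at h2
  calc _ ≤ _ := h2
    _ ≤ _ := by rw [mul_comm]; gcongr; exact le_max_left _ _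

/-- the fundamental cone data -/
noncomputable def nfCone : ConeData (𝓞 K)ˣ (RP K) (CP K) where
  ρ := ((mixedEmbedding K).comp (algebraMap (𝓞 K) K)).toMonoidHom.comp (Units.coeHom (𝓞 K))
  hρ u := by
    rw [nm_eq]; exact norm_unit u
  C := fundamentalCone K
  hC := measurableSet_fundamentalCone K
  w := Units.torsionOrder K
  hw0 := by simpa using Units.torsionOrder_ne_zero K
  hwt := by simp
  hCw x hx := by
    rw [nm_eq] at hx
    obtain ⟨u0, hu0⟩ := exists_unit_smul_mem hx
    rw [← (Equiv.mulRight u0).tsum_eq]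
    have h1 : ∀ u : (𝓞 K)ˣ, (fundamentalCone K).indicator (1 : mixedSpace K → ℝ≥0∞)
        (mixedEmbedding K ((u * u0 : (𝓞 K)ˣ) : 𝓞 K) * x) = (Units.torsion K : Set (𝓞 K)ˣ).indicator 1 u := by
      intro u
      have h2 : mixedEmbedding K ((u * u0 : (𝓞 K)ˣ) : 𝓞 K) * x = u • (u0 • x) := by
        simp [unitSMul_smul, mul_assoc]
      rw [h2]
      have h3 := unit_smul_mem_iff_mem_torsion hu0 u
      by_cases hu : u ∈ Units.torsion K
      · rw [indicator_of_mem (h3.2 hu), indicator_of_mem (by exact hu)]; rfl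
      · rw [indicator_of_notMem (fun h => hu (h3.1 h)), indicator_of_notMem (by exact hu)]
    refine (tsum_congr h1).trans ?_
    rw [← tsum_subtype]
    simp only [Pi.one_apply, ENNReal.tsum_set_const, mul_one]
    have hfin : (Units.torsion K : Set (𝓞 K)ˣ).Finite :=
      (inferInstance : Finite (Units.torsion K))
    rw [← hfin.cast_ncard_eq, ← Nat.card_coe_set_eq]
    simp [Units.torsionOrder]
  hCn x hx := by rw [nm_eq]; exact (norm_pos_of_mem hx).ne'
  M := (exists_cone_bound K).choose
  hM0 := (exists_cone_bound K).choose_spec.1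
  hM := (exists_cone_bound K).choose_spec.2

end
end Landau

namespace Landau
set_option linter.unusedSectionVars false
open MeasureTheory Filter Topology Set Metric
open scoped ContDiff ENNReal

section
variable {I J : Type*} [Fintype I] [Fintype J] [Nonempty (I ⊕ J)]
variable {ι : Type*} [Fintype ι]

lemma mem_LL_iff (b : Module.Basis ι ℝ (MS I J)) (v : MS I J) :
    v ∈ LL b ↔ v ≠ 0 ∧ v ∈ Submodule.span ℤ (Set.range b) := by
  rw [b.mem_span_iff_repr_mem ℤ v]
  refine and_congr_right fun _ => ?_
  constructor
  · rintro ⟨k, rfl⟩ i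
    refine ⟨k i, ?_⟩
    rw [← b.equivFun_apply, LinearEquiv.apply_symm_apply]
    simp [zc]
  · intro h
    choose k hk using h
    refine ⟨k, ?_⟩
    rw [LinearEquiv.symm_apply_eq]
    ext i
    rw [b.equivFun_apply, ← hk]
    simp [zc]
end

section
open NumberField NumberField.InfinitePlace NumberField.mixedEmbedding NumberField.mixedEmbedding.fundamentalCone
open scoped Classical nonZeroDivisors
variable (K : Type*) [Field K] [NumberField K]

/-- the basis of the ideal lattice -/
noncomputable def bJ (J : (Ideal (𝓞 K))⁰) := fractionalIdealLatticeBasis K (FractionalIdeal.mk0 K J)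

lemma mem_LL_bJ (J : (Ideal (𝓞 K))⁰) (v : MS (RP K) (CP K)) :
    v ∈ LL (I := RP K) (J := CP K) (bJ K J) ↔ v ≠ 0 ∧ ∃ a : 𝓞 K, a ∈ (J : Ideal (𝓞 K)) ∧ mixedEmbedding K a = v := by
  rw [mem_LL_iff]
  refine and_congr_right fun _ => ?_
  refine (mem_span_fractionalIdealLatticeBasis K _).trans ?_
  simp only [FractionalIdeal.coe_mk0, Set.mem_image, SetLike.mem_coe, FractionalIdeal.mem_coeIdeal]
  constructor
  · rintro ⟨_, ⟨a, ha, rfl⟩, h⟩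
    exact ⟨a, ha, h⟩
  · rintro ⟨a, ha, h⟩
    exact ⟨_, ⟨a, ha, rfl⟩, h⟩

theorem ideal_count (hn : 2 ≤ Module.finrank ℚ K) (J : (Ideal (𝓞 K))⁰) : ∃ c C : ℝ, 0 ≤ C ∧ ∀ s : ℝ, 1 ≤ s →
    |(Nat.card {a : idealSet K J // mixedEmbedding.norm (a : mixedSpace K) ≤ s} : ℝ) - c * s| ≤
      C * s ^ (((Module.finrank ℚ K : ℝ) - 1) / (Module.finrank ℚ K + 1)) := by
  have h := cone_count (I := RP K) (J := CP K) (by rw [dg_eq]; exact hn) (nfCone K) (bJ K J) (fun v hv => by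
    rw [mem_LL_bJ] at hv
    obtain ⟨hv0, a, ha, rfl⟩ := hv
    rw [nm_eq, Ne, norm_eq_zero_iff' ⟨_, rfl⟩]
    exact hv0) (fun u v hv => by
    rw [mem_LL_bJ] at hv ⊢
    obtain ⟨hv0, a, ha, rfl⟩ := hv
    have hu : (nfCone K).ρ u * mixedEmbedding K a = mixedEmbedding K ((u * a : 𝓞 K)) := by
      simp [nfCone]
    rw [hu]
    refine ⟨?_, u * a, Ideal.mul_mem_left _ _ ha, rfl⟩
    have h1 : a ≠ 0 := by rintro rfl; simp at hv0
    have h2 : ((u : 𝓞 K) * a) ≠ 0 := mul_ne_zero u.ne_zero h1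
    have h3 : ((u * a : 𝓞 K) : K) ≠ 0 := by exact_mod_cast h2
    intro h4
    exact h3 ((map_eq_zero (mixedEmbedding K)).1 h4))
  rw [dg_eq] at h
  obtain ⟨c, C, hC, h⟩ := h
  refine ⟨c, C, hC, fun s hs => ?_⟩
  convert! h s hs using 4
  rw [← Nat.card_coe_set_eq]
  refine Nat.card_congr ((Equiv.subtypeSubtypeEquivSubtypeInter (fun v => v ∈ idealSet K J) 
    (fun v => mixedEmbedding.norm v ≤ s)).trans (Equiv.subtypeEquivProp ?_))
  ext v
  show (v ∈ idealSet K J ∧ mixedEmbedding.norm v ≤ s) ↔ v ∈ LL (I := RP K) (J := CP K) (bJ K J) ∧ v ∈ fundamentalCone K ∧ nm (I := RP K) (J := CP K) v ≤ s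
  rw [nm_eq, mem_LL_bJ, mem_idealSet]
  constructor
  · rintro ⟨⟨h1, h2⟩, h3⟩
    refine ⟨⟨?_, h2⟩, h1, h3⟩
    rintro rfl
    have := norm_pos_of_mem h1
    simp at this
  · rintro ⟨⟨-, h2⟩, h1, h3⟩
    exact ⟨⟨h1, h2⟩, h3⟩

open Ideal Submodule in
lemma class_card {C : ClassGroup (𝓞 K)} {J : (Ideal (𝓞 K))⁰} {s : ℝ} (hJ : ClassGroup.mk0 J = C⁻¹) :
    Nat.card {I : (Ideal (𝓞 K))⁰ // absNorm (I : Ideal (𝓞 K)) ≤ s ∧ ClassGroup.mk0 I = C}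
      = Nat.card {I : (Ideal (𝓞 K))⁰ // (J : Ideal (𝓞 K)) ∣ I ∧ IsPrincipal (I : Ideal (𝓞 K)) ∧
        absNorm (I : Ideal (𝓞 K)) ≤ s * absNorm (J : Ideal (𝓞 K))} := by
  simp_rw [← nonZeroDivisors_dvd_iff_dvd_coe]
  refine Nat.card_congr ?_
  refine ((Equiv.dvd J).subtypeEquiv fun I ↦ ?_).trans
    (Equiv.subtypeSubtypeEquivSubtypeInter (fun I : (Ideal (𝓞 K))⁰ ↦ J ∣ I) _)
  rw [← ClassGroup.mk0_eq_one_iff (SetLike.coe_mem _)]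
  simp_rw [Equiv.dvd_apply, Submonoid.coe_mul, ← Submonoid.mul_def, _root_.map_mul, hJ,
    inv_mul_eq_one, Nat.cast_mul, mul_comm s, eq_comm, and_comm, and_congr_left_iff]
  exact fun _ ↦
    (mul_le_mul_iff_of_pos_left (Nat.cast_pos.mpr (absNorm_pos_of_nonZeroDivisors J))).symm

/-- number of nonzero ideals of norm at most s -/
noncomputable def cnt (s : ℝ) : ℝ := Nat.card {I : (Ideal (𝓞 K))⁰ // (Ideal.absNorm (I : Ideal (𝓞 K)) : ℝ) ≤ s}

lemma cnt_sum (s : ℝ) (hs : 0 ≤ s) : cnt K s = ∑ C : ClassGroup (𝓞 K),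
    (Nat.card {I : (Ideal (𝓞 K))⁰ // (Ideal.absNorm (I : Ideal (𝓞 K)) : ℝ) ≤ s ∧ ClassGroup.mk0 I = C} : ℝ) := by
  have : Fintype {I : (Ideal (𝓞 K))⁰ // (Ideal.absNorm (I : Ideal (𝓞 K)) : ℝ) ≤ s} := by
    simp_rw [← Nat.le_floor_iff hs]
    refine @Fintype.ofFinite _ (Ideal.finite_setOfPred_absNorm_le₀ ⌊s⌋₊)
  let e := fun C : ClassGroup (𝓞 K) ↦ Equiv.subtypeSubtypeEquivSubtypeInter
    (fun I : (Ideal (𝓞 K))⁰ ↦ (Ideal.absNorm I.1 : ℝ) ≤ s) (fun I ↦ ClassGroup.mk0 I = C)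
  simp_rw [cnt, ← Nat.card_congr (e _), Nat.card_eq_fintype_card, Fintype.subtype_card]
  rw [Fintype.card, Finset.card_eq_sum_card_fiberwise (f := fun I ↦ ClassGroup.mk0 I.1)
      (t := Finset.univ) (fun _ _ ↦ Finset.mem_univ _), Nat.cast_sum]

lemma class_count (hn : 2 ≤ Module.finrank ℚ K) (Cl : ClassGroup (𝓞 K)) : ∃ c C : ℝ, 0 ≤ C ∧ ∀ s : ℝ, 1 ≤ s →
    |(Nat.card {I : (Ideal (𝓞 K))⁰ // (Ideal.absNorm (I : Ideal (𝓞 K)) : ℝ) ≤ s ∧ ClassGroup.mk0 I = Cl} : ℝ) - c * s| ≤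
      C * s ^ (((Module.finrank ℚ K : ℝ) - 1) / (Module.finrank ℚ K + 1)) := by
  obtain ⟨J, hJ⟩ := ClassGroup.mk0_surjective Cl⁻¹
  obtain ⟨c, C, hC, h⟩ := ideal_count K hn J
  set θ : ℝ := ((Module.finrank ℚ K : ℝ) - 1) / (Module.finrank ℚ K + 1) with hθ
  set N : ℝ := ((Ideal.absNorm (J : Ideal (𝓞 K)) : ℕ) : ℝ) with hN
  have hN1 : 1 ≤ N := by rw [hN]; exact_mod_cast Ideal.absNorm_pos_of_nonZeroDivisors J
  set w : ℝ := ((Units.torsionOrder K : ℕ) : ℝ) with hw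
  have hw0 : 0 < w := by rw [hw]; exact_mod_cast Units.torsionOrder_pos K
  refine ⟨c * N / w, C * N ^ θ / w, by positivity, fun s hs => ?_⟩
  have h1 := h (s * N) (by nlinarith)
  rw [← card_isPrincipal_dvd_norm_le, ← class_card K hJ, Nat.cast_mul, Real.mul_rpow (by linarith) (by linarith)] at h1
  rw [← hw] at h1
  set X : ℝ := (Nat.card {I : (Ideal (𝓞 K))⁰ // (Ideal.absNorm (I : Ideal (𝓞 K)) : ℝ) ≤ s ∧ ClassGroup.mk0 I = Cl} : ℝ)
  have h2 : X - c * N / w * s = (X * w - c * (s * N)) / w := by field_simp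
  rw [h2, abs_div, abs_of_pos hw0, div_le_iff₀ hw0]
  refine h1.trans (le_of_eq ?_)
  field_simp

/-- the limiting constant -/
noncomputable def kap : ℝ := (2 ^ nrRealPlaces K * (2 * Real.pi) ^ nrComplexPlaces K * Units.regulator K * classNumber K) /
            (Units.torsionOrder K * Real.sqrt |(discr K : ℝ)|)

lemma kap_of_bound {c C θ : ℝ} (hθ : θ < 1) (h : ∀ s : ℝ, 1 ≤ s → |cnt K s - c * s| ≤ C * s ^ θ) : c = kap K := by
  have h1 : Tendsto (fun s : ℝ => cnt K s / s) atTop (𝓝 (kap K)) := by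
    have := NumberField.Ideal.tendsto_norm_le_div_atTop₀ K
    simpa [cnt, kap] using this
  refine tendsto_nhds_unique ?_ h1
  have h2 : Tendsto (fun s : ℝ => C * s ^ (-(1 - θ))) atTop (𝓝 0) := by
    simpa using (tendsto_rpow_neg_atTop (by linarith : 0 < 1 - θ)).const_mul C
  rw [← tendsto_sub_nhds_zero_iff]
  refine squeeze_zero_norm' ?_ h2
  filter_upwards [eventually_ge_atTop 1] with s hs
  have hs0 : 0 < s := by linarith
  rw [Real.norm_eq_abs]
  have h3 : cnt K s / s - c = (cnt K s - c * s) / s := by field_simp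
  rw [h3, abs_div, abs_of_pos hs0, div_le_iff₀ hs0]
  refine (h s hs).trans (le_of_eq ?_)
  rw [mul_assoc]
  congr 1
  nth_rewrite 3 [← Real.rpow_one s]
  rw [← Real.rpow_add hs0]; congr 1; ring

theorem cnt_bound2 (hn : 2 ≤ Module.finrank ℚ K) : ∃ C : ℝ, ∀ s : ℝ, 1 ≤ s →
    |cnt K s - kap K * s| ≤ C * s ^ (((Module.finrank ℚ K : ℝ) - 1) / (Module.finrank ℚ K + 1)) := by
  choose c C hC h using class_count K hn
  have h' : ∀ s : ℝ, 1 ≤ s → |cnt K s - (∑ Cl, c Cl) * s| ≤ (∑ Cl, C Cl) * s ^ (((Module.finrank ℚ K : ℝ) - 1) / (Module.finrank ℚ K + 1)) := by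
    intro s hs
    rw [cnt_sum K s (by linarith), Finset.sum_mul, Finset.sum_mul, ← Finset.sum_sub_distrib]
    refine (Finset.abs_sum_le_sum_abs _ _).trans (Finset.sum_le_sum fun Cl _ => h Cl s hs)
  refine ⟨∑ Cl, C Cl, ?_⟩
  rw [← kap_of_bound K ?_ h']
  · exact h'
  · rw [div_lt_one (by positivity)]; linarith

end
end Landau

namespace Landau
set_option linter.unusedSectionVars false
open MeasureTheory Filter Topology Set Metric
open scoped ContDiff ENNReal

section
open NumberField NumberField.InfinitePlace
open scoped Classical nonZeroDivisors
variable (K : Type*) [Field K] [NumberField K]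

/-- nonzero ideals of norm at most n -/
noncomputable def FS (n : ℕ) : Finset (Ideal (𝓞 K)) :=
  (Ideal.finite_setOfPred_absNorm_le (S := 𝓞 K) n).toFinset.filter (· ≠ 0)

lemma mem_FS (n : ℕ) (I : Ideal (𝓞 K)) : I ∈ FS K n ↔ I ≠ 0 ∧ Ideal.absNorm I ≤ n := by
  simp [FS, and_comm]

lemma cnt_FS (s : ℝ) (hs : 0 ≤ s) : cnt K s = (FS K ⌊s⌋₊).card := by
  rw [cnt, Nat.card_congr (Equiv.subtypeSubtypeEquivSubtypeInter (fun I : Ideal (𝓞 K) => I ∈ (Ideal (𝓞 K))⁰)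
    (fun I => (Ideal.absNorm I : ℝ) ≤ s)), Nat.subtype_card (FS K ⌊s⌋₊)]
  intro I
  rw [mem_FS, Nat.le_floor_iff hs, mem_nonZeroDivisors_iff_ne_zero]

/-- number of ideals of norm k -/
noncomputable def ac (k : ℕ) : ℝ := ((FS K k).filter (fun I => Ideal.absNorm I = k)).card

lemma ac_zero : ac K 0 = 0 := by
  rw [ac, Nat.cast_eq_zero, Finset.card_eq_zero, Finset.filter_eq_empty_iff]
  intro I hI h0
  rw [mem_FS] at hI
  exact hI.1 (Ideal.absNorm_eq_zero_iff.1 h0)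

lemma FS_sum (n : ℕ) (g : ℕ → ℝ) : ∑ I ∈ FS K n, g (Ideal.absNorm I) = ∑ k ∈ Finset.Icc 0 n, g k * ac K k := by
  rw [← Finset.sum_fiberwise_of_maps_to (t := Finset.Icc 0 n) (g := fun I => Ideal.absNorm I)
    (fun I hI => Finset.mem_Icc.2 ⟨Nat.zero_le _, ((mem_FS K n I).1 hI).2⟩)]
  refine Finset.sum_congr rfl fun k hk => ?_
  have h1 : (FS K n).filter (fun I => Ideal.absNorm I = k) = (FS K k).filter (fun I => Ideal.absNorm I = k) := by
    ext I
    simp only [Finset.mem_filter, mem_FS]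
    have := (Finset.mem_Icc.1 hk).2
    constructor
    · rintro ⟨⟨h1, h2⟩, h3⟩; exact ⟨⟨h1, h3.le⟩, h3⟩
    · rintro ⟨⟨h1, h2⟩, h3⟩; exact ⟨⟨h1, h2.trans this⟩, h3⟩
  rw [h1, Finset.sum_congr rfl (g := fun _ => g k) (fun I hI => by rw [(Finset.mem_filter.1 hI).2]), Finset.sum_const,
    nsmul_eq_mul, mul_comm]
  rfl

lemma cnt_ac (s : ℝ) (hs : 0 ≤ s) : cnt K s = ∑ k ∈ Finset.Icc 0 ⌊s⌋₊, ac K k := by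
  have := FS_sum K ⌊s⌋₊ (fun _ => 1)
  simp only [one_mul, Finset.sum_const, nsmul_eq_mul, mul_one] at this
  rw [cnt_FS K s hs, this]

lemma tsum_ac (x : ℝ) (hx : 0 ≤ x) : 
    ∑' m : {m : Ideal (𝓞 K) // m ≠ 0 ∧ (Ideal.absNorm m : ℝ) ≤ x}, 1 / (Ideal.absNorm m.1 : ℝ) =
      ∑ k ∈ Finset.Icc 0 ⌊x⌋₊, (k : ℝ)⁻¹ * ac K k := by
  rw [← FS_sum K ⌊x⌋₊ (fun k => (k : ℝ)⁻¹)]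
  have h1 : ∀ m : Ideal (𝓞 K), (m ≠ 0 ∧ (Ideal.absNorm m : ℝ) ≤ x) ↔ m ∈ FS K ⌊x⌋₊ := fun m => by
    rw [mem_FS, Nat.le_floor_iff hx]
  rw [← Finset.tsum_subtype]
  rw [← (Equiv.subtypeEquivRight h1).tsum_eq]
  simp

lemma absNorm_natCast_one (h1 : Module.finrank ℚ K = 1) (k : ℕ) : Ideal.absNorm (Ideal.span {(k : 𝓞 K)}) = k := by
  rw [Ideal.absNorm_span_singleton]
  have : (k : 𝓞 K) = algebraMap ℤ (𝓞 K) (k : ℤ) := by simp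
  rw [this, Algebra.norm_algebraMap, RingOfIntegers.rank, h1]
  simp

lemma eq_span_one (h1 : Module.finrank ℚ K = 1) (I : Ideal (𝓞 K)) (hI : I ≠ 0) :
    I = Ideal.span {(Ideal.absNorm I : 𝓞 K)} := by
  have h2 : Ideal.span {(Ideal.absNorm I : 𝓞 K)} ≤ I := by
    rw [Ideal.span_singleton_le_iff_mem]; exact Ideal.absNorm_mem I
  obtain ⟨L, hL⟩ := Ideal.dvd_iff_le.2 h2
  have h3 := congrArg Ideal.absNorm hL
  rw [absNorm_natCast_one K h1, map_mul] at h3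
  have h4 : Ideal.absNorm I ≠ 0 := fun h => hI (Ideal.absNorm_eq_zero_iff.1 h)
  have h5 : Ideal.absNorm L = 1 := by
    have : Ideal.absNorm I * Ideal.absNorm L = Ideal.absNorm I * 1 := by rw [← h3, mul_one]
    exact Nat.eq_of_mul_eq_mul_left (Nat.pos_of_ne_zero h4) this
  rw [Ideal.absNorm_eq_one_iff] at h5
  rw [hL, h5, Ideal.mul_top]

lemma FS_card_one (h1 : Module.finrank ℚ K = 1) (n : ℕ) : (FS K n).card = n := by
  have hc : (Finset.Icc 1 n).card = n := by simp
  conv_rhs => rw [← hc]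
  refine Finset.card_bij (fun I _ => Ideal.absNorm I) ?_ ?_ ?_
  · intro I hI
    rw [mem_FS] at hI
    exact Finset.mem_Icc.2 ⟨Nat.one_le_iff_ne_zero.2 fun h => hI.1 (Ideal.absNorm_eq_zero_iff.1 h), hI.2⟩
  · intro I hI L hL h
    rw [mem_FS] at hI hL
    rw [eq_span_one K h1 I hI.1, eq_span_one K h1 L hL.1, h]
  · intro k hk
    rw [Finset.mem_Icc] at hk
    refine ⟨Ideal.span {(k : 𝓞 K)}, ?_, absNorm_natCast_one K h1 k⟩
    rw [mem_FS, absNorm_natCast_one K h1 k]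
    refine ⟨fun h => ?_, hk.2⟩
    have := absNorm_natCast_one K h1 k
    rw [h] at this
    simp at this
    omega

theorem cnt_bound : ∃ C : ℝ, ∀ s : ℝ, 1 ≤ s →
    |cnt K s - kap K * s| ≤ C * s ^ (((Module.finrank ℚ K : ℝ) - 1) / (Module.finrank ℚ K + 1)) := by
  have hpos : 0 < Module.finrank ℚ K := Module.finrank_pos
  by_cases hn : 2 ≤ Module.finrank ℚ K
  · exact cnt_bound2 K hn
  · have h1 : Module.finrank ℚ K = 1 := by omega
    have h2 : ∀ s : ℝ, 1 ≤ s → |cnt K s - 1 * s| ≤ 1 * s ^ (((Module.finrank ℚ K : ℝ) - 1) / (Module.finrank ℚ K + 1)) := by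
      intro s hs
      rw [h1, cnt_FS K s (by linarith), FS_card_one K h1]
      have h3 := Nat.floor_le (by linarith : 0 ≤ s)
      have h4 := Nat.lt_floor_add_one s
      simp
      rw [abs_le]
      constructor <;> linarith
    refine ⟨1, ?_⟩
    rw [← kap_of_bound K ?_ h2]
    · exact h2
    · rw [h1]; norm_num

end
end Landau

namespace Landau
set_option linter.unusedSectionVars false
open MeasureTheory Filter Topology Set Metric
open scoped ContDiff ENNReal

theorem abel_sum {a : ℕ → ℝ} (ha : a 0 = 0) {κ C θ : ℝ} (hθ : θ < 1)
    (h : ∀ s : ℝ, 1 ≤ s → |∑ k ∈ Finset.Icc 0 ⌊s⌋₊, a k - κ * s| ≤ C * s ^ θ) :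
    ∃ B C' : ℝ, ∀ x : ℝ, 1 ≤ x →
      |∑ k ∈ Finset.Icc 0 ⌊x⌋₊, (k : ℝ)⁻¹ * a k - (κ * Real.log x + B)| ≤ C' * x ^ (θ - 1) := by
  set A : ℝ → ℝ := fun s => ∑ k ∈ Finset.Icc 0 ⌊s⌋₊, a k with hA
  set g : ℝ → ℝ := fun t => (t ^ 2)⁻¹ * (A t - κ * t) with hg
  have hAm : Measurable A := 
    (measurable_from_nat (f := fun n : ℕ => ∑ k ∈ Finset.Icc 0 n, a k)).comp Nat.measurable_floor
  have hgm : Measurable g := by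
    apply Measurable.mul
    · fun_prop
    · exact hAm.sub (by fun_prop)
  have hgb : ∀ t : ℝ, 1 ≤ t → |g t| ≤ C * t ^ (θ - 2) := by
    intro t ht
    have ht0 : 0 < t := by linarith
    rw [hg]
    simp only
    rw [abs_mul, abs_of_pos (by positivity : 0 < (t ^ 2)⁻¹), Real.rpow_sub ht0, inv_mul_le_iff₀ (by positivity)]
    refine (h t ht).trans (le_of_eq ?_)
    rw [Real.rpow_two]; field_simp
  have hdom : ∀ x : ℝ, 1 ≤ x → IntegrableOn (fun t : ℝ => C * t ^ (θ - 2)) (Ioi x) := fun x hx =>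
    (integrableOn_Ioi_rpow_of_lt (by linarith) (by linarith)).const_mul C
  have hgi : ∀ x : ℝ, 1 ≤ x → IntegrableOn g (Ioi x) := by
    intro x hx
    refine (hdom x hx).mono' hgm.aestronglyMeasurable ?_
    filter_upwards [ae_restrict_mem measurableSet_Ioi] with t ht
    exact hgb t (hx.trans (le_of_lt ht))
  refine ⟨κ + ∫ t in Ioi 1, g t, C + C / (1 - θ), fun x hx => ?_⟩
  have hx0 : 0 < x := by linarith
  have hab := sum_mul_eq_sub_integral_mul₀ (f := fun t : ℝ => t⁻¹) a ha x (fun t ht => by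
    have : t ≠ 0 := by linarith [ht.1]
    fun_prop (disch := assumption)) (by
    refine ContinuousOn.integrableOn_Icc ?_
    have : deriv (fun t : ℝ => t⁻¹) = fun t => -(t^2)⁻¹ := by ext t; simp
    rw [this]
    refine ContinuousOn.neg (ContinuousOn.inv₀ (by fun_prop) fun t ht => ?_)
    have : t ≠ 0 := by linarith [ht.1]
    positivity)
  have hIntg : ∫ t in Ioc 1 x, deriv (fun t : ℝ => t⁻¹) t * ∑ k ∈ Finset.Icc 0 ⌊t⌋₊, a k =
      -(κ * Real.log x) - ∫ t in Ioc 1 x, g t := by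
    have h1 : ∫ t in Ioc 1 x, t⁻¹ = Real.log x := by
      rw [← intervalIntegral.integral_of_le hx, integral_inv_of_pos one_pos hx0, div_one]
    have h2 : IntegrableOn (fun t : ℝ => t⁻¹) (Ioc 1 x) := by
      refine (ContinuousOn.integrableOn_Icc ?_).mono_set Ioc_subset_Icc_self
      exact continuousOn_id.inv₀ fun t ht => by simp only [id]; linarith [ht.1]
    rw [← h1, ← integral_const_mul, ← integral_neg, ← integral_sub]
    · refine setIntegral_congr_fun measurableSet_Ioc fun t ht => ?_
      have : t ≠ 0 := by linarith [ht.1]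
      simp only [deriv_inv', hg, hA]
      field_simp
      ring
    · exact (h2.const_mul κ).neg
    · exact (hgi 1 le_rfl).mono_set Ioc_subset_Ioi_self
  have hsplit : ∫ t in Ioi 1, g t = (∫ t in Ioc 1 x, g t) + ∫ t in Ioi x, g t := by
    rw [← Ioc_union_Ioi_eq_Ioi hx]
    exact setIntegral_union (Ioc_disjoint_Ioi le_rfl) measurableSet_Ioi
      ((hgi 1 le_rfl).mono_set Ioc_subset_Ioi_self) (hgi x hx)
  have htail : |∫ t in Ioi x, g t| ≤ C / (1 - θ) * x ^ (θ - 1) := by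
    have h1 : ‖∫ t in Ioi x, g t‖ ≤ ∫ t in Ioi x, C * t ^ (θ - 2) := by
      refine norm_integral_le_of_norm_le (hdom x hx) ?_
      filter_upwards [ae_restrict_mem measurableSet_Ioi] with t ht
      exact hgb t (hx.trans (le_of_lt ht))
    refine h1.trans (le_of_eq ?_)
    rw [integral_const_mul, integral_Ioi_rpow_of_lt (by linarith) hx0]
    have e1 : θ - 2 + 1 = -(1 - θ) := by ring
    have e2 : θ - 1 = -(1 - θ) := by ring
    rw [e1, e2]
    have : 1 - θ ≠ 0 := by linarith
    field_simp
  have hmain : |x⁻¹ * (A x - κ * x)| ≤ C * x ^ (θ - 1) := by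
    rw [abs_mul, abs_of_pos (by positivity : 0 < x⁻¹), Real.rpow_sub hx0, Real.rpow_one, inv_mul_le_iff₀ hx0]
    refine (h x hx).trans (le_of_eq ?_)
    field_simp
  have hfin : ∑ k ∈ Finset.Icc 0 ⌊x⌋₊, (k : ℝ)⁻¹ * a k - (κ * Real.log x + (κ + ∫ t in Ioi 1, g t)) =
      x⁻¹ * (A x - κ * x) - ∫ t in Ioi x, g t := by
    rw [hab, hIntg, hsplit]
    have : x⁻¹ * (A x - κ * x) = x⁻¹ * A x - κ := by field_simp
    rw [this]
    simp only [hA]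
    ring
  rw [hfin, add_mul]
  exact (abs_sub _ _).trans (add_le_add hmain htail)

end Landau

noncomputable section

variable (K : Type) [Field K] [NumberField K]

/-- There is a constant `B = B(K)` with
`Σ_{0 ≠ m, N(m) ≤ x} 1/N(m) = κ log x + B + O(x^{-2/(n_K+1)})`. -/
theorem sum_inv_norm_ideals_le
    : ∃ B C : ℝ, ∀ x : ℝ, 2 ≤ x →
      |(∑' m : {m : Ideal (NumberField.RingOfIntegers K) //
          m ≠ 0 ∧ (Ideal.absNorm m : ℝ) ≤ x},
        1 / (Ideal.absNorm m.1 : ℝ)) - (kappa K * Real.log x + B)| ≤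
      C * x ^ (-(2 / ((Module.finrank ℚ K : ℝ) + 1))) := by
  have hk : kappa K = Landau.kap K := by
    rw [kappa, Landau.kap]; ring
  obtain ⟨C0, hC0⟩ := Landau.cnt_bound K
  have hn : (0:ℝ) < (Module.finrank ℚ K : ℝ) + 1 := by positivity
  have hθ : ((Module.finrank ℚ K : ℝ) - 1) / (Module.finrank ℚ K + 1) < 1 := by
    rw [div_lt_one hn]; linarith
  obtain ⟨B, C, h⟩ := Landau.abel_sum (Landau.ac_zero K) hθ (κ := Landau.kap K) (C := C0) (fun s hs => by
    rw [← Landau.cnt_ac K s (by linarith)]; exact hC0 s hs)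
  refine ⟨B, C, fun x hx => ?_⟩
  rw [Landau.tsum_ac K x (by linarith), hk]
  refine (h x (by linarith)).trans (le_of_eq ?_)
  congr 2
  field_simp
  ring

end
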